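/- arXiv:1703.08854 — 3 statements merged into one kernel-verified Lean document; each statement's English description precedes it below -/
import Mathlib

section
/- Let (A₁,B₁) and (A₂,B₂) be pairs of ternary quadratic forms over ℚ such that for each i = 1,2: (a) Aᵢ and Bᵢ are linearly independent over ℚ; (b) there exist c, d ∈ ℚ such that c·Aᵢ + d·Bᵢ is positive definite; (c) q_ℤ(A₁,B₁) = q_ℤ(A₂,B₂); and such that the binary cubic form 4·det(Aᵢ·x − Bᵢ·y) has a repeated linear factor over an algebraic closure of ℚ for i = 1,2 (i.e., Disc(Aᵢ,Bᵢ) = 0). Then either (A₁,B₁) = (w,1)·(A₂,B₂) for some w ∈ GL₃(ℤ), or there exist w₁, w₂ ∈ GL₃(ℤ) and v ∈ GL₂(ℚ) such that, as an unordered pair, {(A₁,B₁), (A₂,B₂)} equals { (w₁,v)·(x₁² − x₁x₂ + x₂², x₃²), (w₂,v)·(x₁² + 3x₂², x₃²) } or { (w₁,v)·(x₁² − x₁x₂ + x₂², (x₁+x₂+3x₃)²), (w₂,v)·(x₁² + 3x₂², (x₁+3x₃)²) }. -/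
open Matrix

/-- Simultaneous representations over ℤ of a pair of rational ternary quadratic forms. -/
def simRepZ (A B : Matrix (Fin 3) (Fin 3) ℚ) : Set (ℚ × ℚ) :=
  {p : ℚ × ℚ | ∃ x : Fin 3 → ℤ, x ≠ 0 ∧
    (fun i => (x i : ℚ)) ⬝ᵥ (A *ᵥ fun i => (x i : ℚ)) = p.1 ∧
    (fun i => (x i : ℚ)) ⬝ᵥ (B *ᵥ fun i => (x i : ℚ)) = p.2}

/-- The action of `GL₃ × GL₂` on pairs of ternary quadratic forms:
`(w, v)·(A,B) = (v₀₀·A(xw) + v₀₁·B(xw), v₁₀·A(xw) + v₁₁·B(xw))`. -/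
def pairAct (w : Matrix (Fin 3) (Fin 3) ℚ) (v : Matrix (Fin 2) (Fin 2) ℚ)
    (A B : Matrix (Fin 3) (Fin 3) ℚ) :
    Matrix (Fin 3) (Fin 3) ℚ × Matrix (Fin 3) (Fin 3) ℚ :=
  (v 0 0 • (w * A * wᵀ) + v 0 1 • (w * B * wᵀ),
   v 1 0 • (w * A * wᵀ) + v 1 1 • (w * B * wᵀ))

/-- Gram matrix of `x₁² − x₁x₂ + x₂²`. -/
def formHex : Matrix (Fin 3) (Fin 3) ℚ := !![1, -1/2, 0; -1/2, 1, 0; 0, 0, 0]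

/-- Gram matrix of `x₁² + 3x₂²`. -/
def formE : Matrix (Fin 3) (Fin 3) ℚ := !![1, 0, 0; 0, 3, 0; 0, 0, 0]

/-- Gram matrix of `x₃²`. -/
def formZ : Matrix (Fin 3) (Fin 3) ℚ := !![0, 0, 0; 0, 0, 0; 0, 0, 1]

/-- Gram matrix of `(x₁ + x₂ + 3x₃)²`. -/
def formR : Matrix (Fin 3) (Fin 3) ℚ := !![1, 1, 3; 1, 1, 3; 3, 3, 9]

/-- Gram matrix of `(x₁ + 3x₃)²`. -/
def formR' : Matrix (Fin 3) (Fin 3) ℚ := !![1, 0, 3; 0, 0, 0; 3, 0, 9]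

/-- The binary form `x² - bxy + cy²` at integer arguments. -/
def binForm (b c : ℚ) (x y : ℤ) : ℚ := x ^ 2 - b * x * y + c * y ^ 2

/-- `v` is a value of `x² - bxy + cy²` on `ℤ²`. -/
def BinRep (b c v : ℚ) : Prop := ∃ x y : ℤ, binForm b c x y = v

/-- Distinct nonzero integral squares are at least five apart, except for `1` and `4`. -/
theorem sq_gap {m k : ℤ} (hm : m ≠ 0) (h : m ^ 2 < k ^ 2) :
    (m ^ 2 = 1 ∧ k ^ 2 = 4) ∨ m ^ 2 + 5 ≤ k ^ 2 := by
  have h1 : |m| < |k| := sq_lt_sq.mp h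
  have h0 : 1 ≤ |m| := Int.one_le_abs hm
  rw [← sq_abs m, ← sq_abs k]
  generalize |m| = m at *
  generalize |k| = k at *
  rcases eq_or_lt_of_le h0 with h2 | h2
  · subst h2
    rcases eq_or_lt_of_le (Int.add_one_le_iff.mpr h1) with h3 | h3
    · subst h3; left; norm_num
    · right; nlinarith
  · right; nlinarith

theorem sq_gap_rat {m k : ℤ} (hm : m ≠ 0) (h : (m : ℚ) ^ 2 < (k : ℚ) ^ 2) :
    ((m : ℚ) ^ 2 = 1 ∧ (k : ℚ) ^ 2 = 4) ∨ (m : ℚ) ^ 2 + 5 ≤ (k : ℚ) ^ 2 := by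
  exact_mod_cast sq_gap hm (by exact_mod_cast h)

theorem binForm_ge {b c : ℚ} (x y : ℤ) : (4 * c - b ^ 2) * y ^ 2 / 4 ≤ binForm b c x y := by
  unfold binForm
  nlinarith [sq_nonneg ((x : ℚ) - b * y / 2)]

/-- The coordinates of a vector of small value. -/
theorem binForm_small {b c : ℚ} (hb : 0 ≤ b) (hb1 : b ≤ 1) (hc : 1 ≤ c) {x y : ℤ}
    (h : binForm b c x y < 4 * c - b ^ 2) :
    (y = 0 ∧ binForm b c x y = x ^ 2) ∨ (y = 1 ∧ binForm b c x y = c + (x ^ 2 - b * x)) ∨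
      (y = -1 ∧ binForm b c x y = c + (x ^ 2 + b * x)) := by
  have h1 := (binForm_ge (b := b) (c := c) x y).trans_lt h
  have h2 : 0 < 4 * c - b ^ 2 := by nlinarith
  have h3 : (y : ℚ) ^ 2 < 4 := by
    by_contra h4
    push Not at h4
    nlinarith
  have h4 : y ^ 2 < 2 ^ 2 := by exact_mod_cast (by linarith : (y : ℚ) ^ 2 < 2 ^ 2)
  have h5 : |y| < 2 := by simpa using sq_lt_sq.mp h4
  rw [abs_lt] at h5
  obtain ⟨h6, h7⟩ := h5
  unfold binForm
  interval_cases y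
  · right; right; refine ⟨rfl, ?_⟩; push_cast; ring
  · left; refine ⟨rfl, ?_⟩; push_cast; ring
  · right; left; refine ⟨rfl, ?_⟩; push_cast; ring

theorem BinRep.cases {b c v : ℚ} (hb : 0 ≤ b) (hb1 : b ≤ 1) (hc : 1 ≤ c) (h : BinRep b c v)
    (hv : v < 4 * c - b ^ 2) :
    (∃ k : ℤ, v = k ^ 2) ∨ v = c ∨ v = c + 1 - b ∨ v = c + 1 + b ∨ v = c + 4 - 2 * b ∨
      v = c + 4 + 2 * b ∨ c + 6 ≤ v := by
  obtain ⟨x, y, rfl⟩ := h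
  have key (t : ℤ) : c + ((t : ℚ) ^ 2 - b * t) = c ∨ c + ((t : ℚ) ^ 2 - b * t) = c + 1 - b ∨
      c + ((t : ℚ) ^ 2 - b * t) = c + 1 + b ∨ c + ((t : ℚ) ^ 2 - b * t) = c + 4 - 2 * b ∨
      c + ((t : ℚ) ^ 2 - b * t) = c + 4 + 2 * b ∨ c + 6 ≤ c + ((t : ℚ) ^ 2 - b * t) := by
    rcases le_or_gt 3 t with h | h
    · have h' : (3 : ℚ) ≤ t := by exact_mod_cast h
      right; right; right; right; right; nlinarith
    rcases le_or_gt t (-3) with h1 | h1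
    · have h' : (t : ℚ) ≤ -3 := by exact_mod_cast h1
      right; right; right; right; right; nlinarith
    interval_cases t <;> norm_num
    · right; right; right; right; left; ring
    · right; right; left; ring
    · right; left; ring
    · right; right; right; left; ring
  rcases binForm_small hb hb1 hc hv with ⟨_, h⟩ | ⟨_, h⟩ | ⟨_, h⟩
  · exact Or.inl ⟨x, h⟩
  · rw [h]; exact Or.inr (key x)
  · have := key (-x)
    push_cast at this
    rw [h, show (x : ℚ) ^ 2 + b * x = (-x) ^ 2 - b * -x by ring]
    exact Or.inr this

theorem BinRep.sq_or_le {b c v : ℚ} (hb : 0 ≤ b) (hb1 : b ≤ 1) (hc : 1 ≤ c) (h : BinRep b c v) :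
    (∃ k : ℤ, v = k ^ 2) ∨ c ≤ v := by
  by_cases hv : v < 4 * c - b ^ 2
  · rcases h.cases hb hb1 hc hv with h | h | h | h | h | h | h
    · exact Or.inl h
    all_goals right; linarith
  · right; nlinarith

theorem binRep_row (b c : ℚ) (t : ℤ) : BinRep b c (c + (t ^ 2 - b * t)) :=
  ⟨t, 1, by unfold binForm; push_cast; ring⟩

theorem BinRep.of_row {b c v : ℚ} (t : ℤ) (h : c + (t ^ 2 - b * t) = v) : BinRep b c v :=
  h ▸ binRep_row b c t

section
variable {b c b' c' : ℚ}

theorem not_binRep_iff_of_lt (hb : 0 ≤ b) (hb1' : b' ≤ 1) (hc : 1 ≤ c)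
    (hlt : b < b')
    (h : ∀ v, BinRep b c v ↔ BinRep b' c v) : False := by
  have hb' : 0 ≤ b' := hb.trans hlt.le
  have hb1 : b ≤ 1 := hlt.le.trans hb1'
  have e1 : BinRep b c (1 + c - b') := (h _).2 (.of_row 1 (by push_cast; ring))
  have e2 : BinRep b' c (1 + c - b) := (h _).1 (.of_row 1 (by push_cast; ring))
  have e3 : BinRep b' c (1 + c + b) := (h _).1 (.of_row (-1) (by push_cast; ring))
  have e4 : BinRep b c (1 + c + b') := (h _).2 (.of_row (-1) (by push_cast; ring))
  have z1 := e1.cases hb hb1 hc (by nlinarith)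
  have z2 := e2.cases hb' hb1' hc (by nlinarith)
  have z3 := e3.cases hb' hb1' hc (by nlinarith)
  have nz {k : ℤ} {r : ℚ} (hk : r = k ^ 2) (hr : 1 ≤ r) : k ≠ 0 := by
    rintro rfl
    norm_num at hk
    linarith
  obtain ⟨k, hk⟩ : ∃ k : ℤ, 1 + c - b = k ^ 2 := by
    rcases z2 with z | z | z | z | z | z | z
    · exact z
    all_goals linarith
  have hk0 : k ≠ 0 := nz hk (by linarith)
  rcases hlt.le.trans hb1' |>.eq_or_lt with rfl | hb1
  · linarith
  rcases z1 with ⟨j, z⟩ | z | z | z | z | z | z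
  · have hj0 := nz z (by linarith)
    rcases sq_gap_rat hj0 (k := k) (by linarith) with ⟨_, _⟩ | _ <;> linarith
  · obtain rfl : b' = 1 := by linarith
    rcases hb.eq_or_lt with rfl | hb0
    · rcases e4.cases le_rfl zero_le_one hc (by linarith) with ⟨j, z⟩ | z | z | z | z | z | z
      · rcases sq_gap_rat hk0 (k := j) (by linarith) with ⟨_, _⟩ | _ <;> linarith
      all_goals linarith
    · rcases z3 with ⟨j, z⟩ | z | z | z | z | z | z
      · rcases sq_gap_rat hk0 (k := j) (by linarith) with ⟨_, _⟩ | _ <;> linarith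
      all_goals linarith
  all_goals linarith

theorem BinRep.second_le (hb : 0 ≤ b) (hb1 : b ≤ 1) (hc : 1 ≤ c) {v : ℚ} (h : BinRep b c v)
    (hs : ∀ k : ℤ, v ≠ k ^ 2) (hv : c < v) : v = c + 1 - b ∨ c + 1 - b < v := by
  by_cases hv' : v < 4 * c - b ^ 2
  · rcases h.cases hb hb1 hc hv' with ⟨k, z⟩ | z | z | z | z | z | z
    · exact absurd z (hs k)
    · linarith
    · exact Or.inl z
    · rcases hb.eq_or_lt with rfl | hb
      · left; linarith
      · right; linarith
    all_goals right; linarith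
  · right; nlinarith

theorem one_le_sq_rat {m : ℤ} (hm : m ≠ 0) : (1 : ℚ) ≤ m ^ 2 := by
  exact_mod_cast (one_le_sq_iff_one_le_abs m).2 (Int.one_le_abs hm)

/-- The square second coefficient `c` belongs to a form with `b < 1`. -/
theorem not_binRep_iff_of_lt_one (hb : 0 ≤ b) (hb1 : b < 1) (hb' : 0 ≤ b') (hb1' : b' ≤ 1)
    {m : ℤ} (hm : m ≠ 0) (hc : c = m ^ 2) (hcc : c < c') (hs : ∀ k : ℤ, c' ≠ k ^ 2)
    (h : ∀ v, BinRep b c v ↔ BinRep b' c' v) : False := by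
  have hc1 : 1 ≤ c := hc ▸ one_le_sq_rat hm
  have nosq {v : ℚ} {k : ℤ} (h1 : c < v) (h2 : v < c + 3) (hv : v = k ^ 2) : False := by
    rcases sq_gap_rat hm (k := k) (by linarith) with ⟨_, _⟩ | _ <;> linarith
  have hc'_eq : c' = c + 1 - b := by
    have h1 : BinRep b' c' (c + 1 - b) := (h _).1 (.of_row 1 (by push_cast; ring))
    have h2 : BinRep b c c' := (h _).2 (.of_row 0 (by push_cast; ring))
    rcases h1.sq_or_le hb' hb1' (by linarith) with ⟨k, z⟩ | z
    · exact (nosq (by linarith) (by linarith) z).elim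
    · rcases h2.second_le hb hb1.le hc1 hs hcc with z' | z' <;> linarith
  have z1 := ((h (c' + 1 - b')).2 (.of_row 1 (by push_cast; ring))).cases hb hb1.le hc1
    (by nlinarith)
  have hcase : b' = 1 ∨ b' = 1 - 2 * b := by
    rcases z1 with ⟨k, z⟩ | z | z | z | z | z | z
    · exact (nosq (by linarith) (by linarith) z).elim
    · linarith
    · left; linarith
    · right; linarith
    all_goals linarith
  by_cases hb'1 : b' = 1
  · subst hb'1
    have z2 := ((h (c + 1 + b)).1 (.of_row (-1) (by push_cast; ring))).cases hb' hb1'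
      (by linarith) (by nlinarith)
    obtain rfl : b = 0 := by
      rcases z2 with ⟨k, z⟩ | z | z | z | z | z | z
      · exact (nosq (by linarith) (by linarith) z).elim
      all_goals linarith
    rcases hc1.eq_or_lt with hc1 | hc1
    · have z3 := ((h (c + 4)).1 (.of_row 2 (by push_cast; ring))).cases hb' hb1'
        (by linarith) (by nlinarith)
      rcases z3 with ⟨k, z⟩ | z | z | z | z | z | z
      · rcases sq_gap_rat hm (k := k) (by linarith) with ⟨_, _⟩ | _ <;> linarith
      all_goals linarith
    · have z3 := ((h (c + 3)).2 (.of_row 2 (by push_cast; linarith))).cases hb hb1.le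
        (by linarith) (by nlinarith)
      rcases z3 with ⟨k, z⟩ | z | z | z | z | z | z
      · rcases sq_gap_rat hm (k := k) (by linarith) with ⟨_, _⟩ | _ <;> linarith
      all_goals linarith
  · have hb'2 : b' = 1 - 2 * b := hcase.resolve_left hb'1
    have hb0 : 0 < b := hb.lt_of_ne (by rintro rfl; apply hb'1; linarith)
    have z2 := ((h (c' + 1 + b')).2 (.of_row (-1) (by push_cast; ring))).cases hb hb1.le
      (by linarith) (by nlinarith)
    obtain rfl : b = 1 / 2 := by
      rcases z2 with ⟨k, z⟩ | z | z | z | z | z | z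
      · exact (nosq (by linarith) (by linarith) z).elim
      all_goals linarith
    obtain rfl : b' = 0 := by linarith
    have z3 := ((h (c + 3)).1 (.of_row 2 (by push_cast; linarith))).cases hb' hb1'
      (by linarith) (by nlinarith)
    obtain hc2 : c = 1 := by
      rcases z3 with ⟨k, z⟩ | z | z | z | z | z | z
      · rcases sq_gap_rat hm (k := k) (by linarith) with ⟨_, _⟩ | _ <;> linarith
      all_goals linarith
    obtain ⟨x, y, hxy⟩ := (h (c' + 4)).2 (.of_row 2 (by push_cast; linarith))
    have e : 2 * x ^ 2 - x * y + 2 * y ^ 2 = 11 := by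
      unfold binForm at hxy
      have : (2 * x ^ 2 - x * y + 2 * y ^ 2 : ℚ) = 11 := by
        rw [hc'_eq, hc2] at hxy
        linarith
      exact_mod_cast this
    have hy : |y| < 3 := abs_lt_of_sq_lt_sq (by nlinarith [sq_nonneg (4 * x - y)]) (by norm_num)
    have hx : |x| < 3 := abs_lt_of_sq_lt_sq (by nlinarith [sq_nonneg (4 * y - x)]) (by norm_num)
    rw [abs_lt] at hx hy
    obtain ⟨hx1, hx2⟩ := hx
    obtain ⟨hy1, hy2⟩ := hy
    interval_cases x <;> interval_cases y <;> omega

/-- The square second coefficient `c` belongs to a form with `b = 1`. -/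
theorem binRep_iff_hex (hb' : 0 ≤ b') (hb1' : b' ≤ 1)
    {m : ℤ} (hm : m ≠ 0) (hc : c = m ^ 2) (hcc : c < c') (hs : ∀ k : ℤ, c' ≠ k ^ 2)
    (h : ∀ v, BinRep 1 c v ↔ BinRep b' c' v) : c = 1 ∧ b' = 0 ∧ c' = 3 := by
  have hc1 : 1 ≤ c := hc ▸ one_le_sq_rat hm
  have nosq {v : ℚ} {k : ℤ} (h1 : c < v) (h2 : v < c + 3) (hv : v = k ^ 2) : False := by
    rcases sq_gap_rat hm (k := k) (by linarith) with ⟨_, _⟩ | _ <;> linarith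
  have hc'_eq : c' = c + 2 := by
    have h1 : BinRep b' c' (c + 2) := (h _).1 (.of_row 2 (by push_cast; ring))
    have h2 : BinRep 1 c c' := (h _).2 (.of_row 0 (by push_cast; ring))
    apply le_antisymm
    · rcases h1.sq_or_le hb' hb1' (by linarith) with ⟨k, z⟩ | z
      · exact (nosq (by linarith) (by linarith) z).elim
      · exact z
    · by_contra hlt
      rcases h2.cases zero_le_one le_rfl hc1 (by linarith) with ⟨k, z⟩ | z | z | z | z | z | z
      · exact hs k z
      all_goals linarith
  -- all values of the first form are integers
  have hb_int : b' = 0 ∨ b' = 1 := by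
    obtain ⟨x, y, hxy⟩ := (h (c' + 1 - b')).2 (.of_row 1 (by push_cast; ring))
    have e : b' = ((m ^ 2 + 3 - (x ^ 2 - x * y + m ^ 2 * y ^ 2) : ℤ) : ℚ) := by
      unfold binForm at hxy
      rw [hc'_eq, hc] at hxy
      push_cast
      linarith
    generalize (m ^ 2 + 3 - (x ^ 2 - x * y + m ^ 2 * y ^ 2) : ℤ) = j at e
    have h0 : 0 ≤ j := by exact_mod_cast e ▸ hb'
    have h1 : j ≤ 1 := by exact_mod_cast e ▸ hb1'
    interval_cases j
    · left; simpa using e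
    · right; simpa using e
  rcases hc1.eq_or_lt with hc1 | hc1
  · refine ⟨hc1.symm, hb_int.resolve_right ?_, by linarith⟩
    rintro rfl
    have z3 := ((h (c + 6)).1 (.of_row 3 (by push_cast; linarith))).cases hb' hb1'
      (by linarith) (by nlinarith)
    rcases z3 with ⟨k, z⟩ | z | z | z | z | z | z
    · have e : k ^ 2 = 7 := by exact_mod_cast (by linarith : (k : ℚ) ^ 2 = 7)
      have hk : |k| < 3 := abs_lt_of_sq_lt_sq (by linarith) (by norm_num)
      rw [abs_lt] at hk
      obtain ⟨h1, h2⟩ := hk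
      interval_cases k <;> omega
    all_goals linarith
  · exfalso
    have hc4 : 4 ≤ c := by
      have h1 : 1 < m ^ 2 := by exact_mod_cast hc ▸ hc1
      rcases sq_gap one_ne_zero (k := m) (by linarith) with h2 | h2
      · rw [hc]; exact_mod_cast h2.2.ge
      · rw [hc]; exact_mod_cast (by linarith : 4 ≤ m ^ 2)
    rcases hb_int with rfl | rfl
    · have z3 := ((h (c' + 1)).2 (.of_row 1 (by push_cast; linarith))).cases zero_le_one le_rfl
        (by linarith) (by nlinarith)
      rcases z3 with ⟨k, z⟩ | z | z | z | z | z | z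
      · rcases sq_gap_rat hm (k := k) (by linarith) with ⟨_, _⟩ | _ <;> linarith
      all_goals linarith
    · have z3 := ((h (c' + 2)).2 (.of_row 2 (by push_cast; linarith))).cases zero_le_one le_rfl
        (by linarith) (by nlinarith)
      rcases z3 with ⟨k, z⟩ | z | z | z | z | z | z
      · rcases sq_gap_rat hm (k := k) (by linarith) with ⟨_, _⟩ | _ <;> linarith
      all_goals linarith

theorem binRep_iff_of_lt (hb : 0 ≤ b) (hb1 : b ≤ 1) (hc1 : 1 ≤ c) (hb' : 0 ≤ b') (hb1' : b' ≤ 1)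
    (hcc : c < c') (h : ∀ v, BinRep b c v ↔ BinRep b' c' v) :
    b = 1 ∧ c = 1 ∧ b' = 0 ∧ c' = 3 := by
  obtain ⟨m, hc⟩ : ∃ m : ℤ, c = m ^ 2 := by
    have h1 : BinRep b' c' c := (h _).1 (.of_row 0 (by push_cast; ring))
    exact (h1.sq_or_le hb' hb1' (by linarith)).resolve_right (by linarith)
  have hm : m ≠ 0 := by
    rintro rfl
    norm_num at hc
    linarith
  by_cases hs : ∀ k : ℤ, c' ≠ k ^ 2
  · rcases hb1.eq_or_lt with rfl | hb1
    · exact ⟨rfl, binRep_iff_hex hb' hb1' hm hc hcc hs h⟩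
    · exact (not_binRep_iff_of_lt_one hb hb1 hb' hb1' hm hc hcc hs h).elim
  · exfalso
    push Not at hs
    obtain ⟨k, hk⟩ := hs
    have hge : c + 3 ≤ c' := by
      rcases sq_gap_rat hm (k := k) (by linarith) with ⟨_, _⟩ | _ <;> linarith
    have key (v : ℚ) (h1 : BinRep b c v) (h2 : c < v) (h3 : v < c + 3) : False := by
      rcases ((h _).1 h1).sq_or_le hb' hb1' (by linarith) with ⟨j, z⟩ | z
      · rcases sq_gap_rat hm (k := j) (by linarith) with ⟨_, _⟩ | _ <;> linarith
      · linarith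
    rcases hb1.eq_or_lt with rfl | hb1
    · exact key (c + 2) (.of_row 2 (by push_cast; ring)) (by linarith) (by linarith)
    · exact key (c + 1 - b) (.of_row 1 (by push_cast; ring)) (by linarith) (by linarith)

/-- Reduced positive binary forms with minimum `1` and the same values over `ℤ` are equal, apart
from `x² - xy + y²` and `x² + 3y²`. -/
theorem binRep_iff (hb : 0 ≤ b) (hb1 : b ≤ 1) (hc : 1 ≤ c) (hb' : 0 ≤ b') (hb1' : b' ≤ 1)
    (hc' : 1 ≤ c') (h : ∀ v, BinRep b c v ↔ BinRep b' c' v) :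
    (b = b' ∧ c = c') ∨ (b = 1 ∧ c = 1 ∧ b' = 0 ∧ c' = 3) ∨
      (b' = 1 ∧ c' = 1 ∧ b = 0 ∧ c = 3) := by
  rcases lt_trichotomy c c' with hcc | rfl | hcc
  · exact Or.inr (Or.inl (binRep_iff_of_lt hb hb1 hc hb' hb1' hcc h))
  · rcases lt_trichotomy b b' with hbb | rfl | hbb
    · exact (not_binRep_iff_of_lt hb hb1' hc hbb h).elim
    · exact Or.inl ⟨rfl, rfl⟩
    · exact (not_binRep_iff_of_lt hb' hb1 hc hbb fun v => (h v).symm).elim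
  · exact Or.inr (Or.inr (binRep_iff_of_lt hb' hb1' hc' hb hb1 hcc fun v => (h v).symm))
end

theorem colour_absurd {R : Type*} [CommRing R] {n m q : R}
    (g1 : 2 * n - 2 * m ≠ 0) (g2 : 3 * n ≠ 0) (g3 : 2 * n ≠ 0)
    (h8 : 5 * n - 2 * m = 0 ∨ 6 * n = 0)
    (h6 : n + 2 * m = 0 ∨ 6 * n = 0)
    (h3 : n - 2 * m = 0 ∨ q - (2 * n - m) = 0 ∨ q + (2 * n - m) = 0)
    (h4 : 3 * n - 2 * m = 0 ∨ 4 * n = 0 ∨ q - (3 * n - m) = 0 ∨ q + (3 * n - m) = 0)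
    (h1 : 3 * n - 2 * m = 0 ∨ q - m = 0 ∨ q + m = 0)
    (h2 : n - 2 * m = 0 ∨ 4 * n = 0 ∨ q - (n + m) = 0 ∨ q + (n + m) = 0) : False := by
  have h6n : 6 * n = 0 := by
    rcases h8 with h8 | h8
    · rcases h6 with h6 | h6
      · linear_combination h8 + h6
      · exact h6
    · exact h8
  have h4n : 4 * n ≠ 0 := fun h => g3 (by linear_combination h6n - h)
  rcases h3 with h3 | h3 | h3
  · have h3' : 3 * n - 2 * m ≠ 0 := fun h => g3 (by linear_combination h - h3)
    rcases h4 with h4 | h4 | h4 | h4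
    · exact h3' h4
    · exact h4n h4
    all_goals rcases h1 with h1 | h1 | h1
    · exact h3' h1
    · exact h3' (by linear_combination h1 - h4)
    · exact g2 (by linear_combination h1 - h4)
    · exact h3' h1
    · exact g2 (by linear_combination h4 - h1)
    · exact h3' (by linear_combination h4 - h1)
  · have h5 : 3 * n - 2 * m = 0 := by
      rcases h1 with h1 | h1 | h1
      · exact h1
      · exact (g1 (by linear_combination h1 - h3)).elim
      · exact (g3 (by linear_combination h1 - h3)).elim
    have h6 : n - 2 * m ≠ 0 := fun h => g3 (by linear_combination h5 - h)
    rcases h2 with h2 | h2 | h2 | h2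
    · exact h6 h2
    · exact h4n h2
    · exact h6 (by linear_combination h2 - h3)
    · exact g2 (by linear_combination h2 - h3)
  · have h5 : 3 * n - 2 * m = 0 := by
      rcases h1 with h1 | h1 | h1
      · exact h1
      · exact (g3 (by linear_combination h3 - h1)).elim
      · exact (g1 (by linear_combination h3 - h1)).elim
    have h6 : n - 2 * m ≠ 0 := fun h => g3 (by linear_combination h5 - h)
    rcases h2 with h2 | h2 | h2 | h2
    · exact h6 h2
    · exact h4n h2
    · exact g2 (by linear_combination h3 - h2)
    · exact h6 (by linear_combination h3 - h2)

theorem colour_absurd' {R : Type*} [CommRing R] {n m m' q : R} (hm : m' = 2 * n - m)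
    (h1 : m = m' ∨ m = -m' ∨ m = n + m' ∨ m = -(n + m') ∨ m = q ∨ m = -q)
    (h2 : n + m = m' ∨ n + m = -m' ∨ n + m = n + m' ∨ n + m = -(n + m') ∨ n + m = q ∨ n + m = -q)
    (h3 : m' = m ∨ m' = -m ∨ m' = n + m ∨ m' = -(n + m) ∨ m' = q ∨ m' = -q)
    (h4 : n + m' = m ∨ n + m' = -m ∨ n + m' = n + m ∨ n + m' = -(n + m) ∨ n + m' = q ∨ n + m' = -q)
    (h6 : 2 * n + m = m' - n ∨ 2 * n + m = -(m' - n) ∨ 2 * n + m = 2 * n + m' ∨ 2 * n + m = -(2 * n + m')) 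
    (h8 : 2 * n + m' = m - n ∨ 2 * n + m' = -(m - n) ∨ 2 * n + m' = 2 * n + m ∨ 2 * n + m' = -(2 * n + m))
    (g1 : 2 * n - 2 * m ≠ 0) (g2 : 3 * n ≠ 0) (g3 : 2 * n ≠ 0) : False := by
  subst hm
  refine colour_absurd (q := q) g1 g2 g3 ?_ ?_ ?_ ?_ ?_ ?_
  · rcases h8 with h | h | h | h
    · left; linear_combination h
    · exact (g2 (by linear_combination h)).elim
    · exact (g1 (by linear_combination h)).elim
    · right; linear_combination h
  · rcases h6 with h | h | h | h
    · left; linear_combination h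
    · exact (g2 (by linear_combination h)).elim
    · exact (g1 (by linear_combination -h)).elim
    · right; linear_combination h
  · rcases h3 with h | h | h | h | h | h
    · exact (g1 (by linear_combination h)).elim
    · exact (g3 (by linear_combination h)).elim
    · left; linear_combination h
    · exact (g2 (by linear_combination h)).elim
    · right; left; linear_combination -h
    · right; right; linear_combination h
  · rcases h4 with h | h | h | h | h | h
    · left; linear_combination h
    · exact (g2 (by linear_combination h)).elim
    · exact (g1 (by linear_combination h)).elim
    · right; left; linear_combination h
    · right; right; left; linear_combination -h
    · right; right; right; linear_combination h
  · rcases h1 with h | h | h | h | h | h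
    · exact (g1 (by linear_combination -h)).elim
    · exact (g3 (by linear_combination h)).elim
    · left; linear_combination -h
    · exact (g2 (by linear_combination h)).elim
    · right; left; linear_combination -h
    · right; right; linear_combination h
  · rcases h2 with h | h | h | h | h | h
    · left; linear_combination -h
    · exact (g2 (by linear_combination h)).elim
    · exact (g1 (by linear_combination -h)).elim
    · right; left; linear_combination h
    · right; right; left; linear_combination -h
    · right; right; right; linear_combination h

theorem colour_alg_one {R : Type*} [CommRing R] {n m m' q : R}
    (h1 : m = m' ∨ m = -m' ∨ m = n + m' ∨ m = -(n + m') ∨ m = q ∨ m = -q)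
    (h2 : n + m = m' ∨ n + m = -m' ∨ n + m = n + m' ∨ n + m = -(n + m') ∨ n + m = q ∨ n + m = -q)
    (h3 : m' = m ∨ m' = -m ∨ m' = n + m ∨ m' = -(n + m) ∨ m' = q ∨ m' = -q)
    (h4 : n + m' = m ∨ n + m' = -m ∨ n + m' = n + m ∨ n + m' = -(n + m) ∨ n + m' = q ∨ n + m' = -q)
    (h5 : m - n = m' - n ∨ m - n = -(m' - n) ∨ m - n = 2 * n + m' ∨ m - n = -(2 * n + m'))
    (h6 : 2 * n + m = m' - n ∨ 2 * n + m = -(m' - n) ∨ 2 * n + m = 2 * n + m' ∨ 2 * n + m = -(2 * n + m')) 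
    (h7 : m' - n = m - n ∨ m' - n = -(m - n) ∨ m' - n = 2 * n + m ∨ m' - n = -(2 * n + m))
    (h8 : 2 * n + m' = m - n ∨ 2 * n + m' = -(m - n) ∨ 2 * n + m' = 2 * n + m ∨ 2 * n + m' = -(2 * n + m)) :
    m' = m ∨ m' = -(n + m) ∨ (2 * n = 0 ∧ (m' = -m ∨ m' = n + m)) := by
  by_contra! hc
  obtain ⟨c1, c2, c3⟩ := hc
  rcases h7 with h7 | h7 | h7 | h7
  · exact c1 (by linear_combination h7)
  · refine colour_absurd' (by linear_combination h7) h1 h2 h3 h4 h6 h8 (fun h => c1 ?_) (fun h => c2 ?_)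
      (fun h => (c3 h).1 ?_)
    · linear_combination h7 + h
    · linear_combination h7 + h
    · linear_combination h7 + h
  · have e : n + -(n + m) = -m := by ring
    refine colour_absurd' (n := n) (m := -(n + m)) (m' := m') (q := q) (by linear_combination h7)
      ?_ ?_ ?_ ?_ ?_ ?_ (fun h => c2 ?_) (fun h => c1 ?_) (fun h => (c3 h).2 ?_)
    · rcases h2 with h | h | h | h | h | h
      · right; left; linear_combination -h
      · left; linear_combination -h
      · right; right; right; left; linear_combination -h
      · right; right; left; linear_combination -h
      · right; right; right; right; right; linear_combination -h
      · right; right; right; right; left; linear_combination -h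
    · rcases h1 with h | h | h | h | h | h
      · right; left; linear_combination -h
      · left; linear_combination -h
      · right; right; right; left; linear_combination -h
      · right; right; left; linear_combination -h
      · right; right; right; right; right; linear_combination -h
      · right; right; right; right; left; linear_combination -h
    · rcases h3 with h | h | h | h | h | h
      · right; right; right; left; linear_combination h
      · right; right; left; linear_combination h
      · right; left; linear_combination h
      · left; linear_combination h
      · right; right; right; right; left; linear_combination h
      · right; right; right; right; right; linear_combination h
    · rcases h4 with h | h | h | h | h | h
      · right; right; right; left; linear_combination h
      · right; right; left; linear_combination h
      · right; left; linear_combination h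
      · left; linear_combination h
      · right; right; right; right; left; linear_combination h
      · right; right; right; right; right; linear_combination h
    · rcases h5 with h | h | h | h
      · right; left; linear_combination -h
      · left; linear_combination -h
      · right; right; right; linear_combination -h
      · right; right; left; linear_combination -h
    · rcases h8 with h | h | h | h
      · right; right; right; linear_combination h
      · right; right; left; linear_combination h
      · right; left; linear_combination h
      · left; linear_combination h
    · linear_combination h7 + h
    · linear_combination h7 + h
    · linear_combination h7 + h
  · exact c2 (by linear_combination h7)

theorem colour_alg_two {R : Type*} [CommRing R] {n m m' : R}
    (h2 : n + m = m' ∨ n + m = -m' ∨ n + m = n + m' ∨ n + m = -(n + m'))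
    (h1 : m = m' ∨ m = -m' ∨ m = n + m' ∨ m = -(n + m'))
    (h3 : m' = m ∨ m' = -m ∨ m' = n + m ∨ m' = -(n + m))
    (h4 : n + m' = m ∨ n + m' = -m ∨ n + m' = n + m ∨ n + m' = -(n + m)) :
    m' = m ∨ m' = -(n + m) ∨ (2 * n = 0 ∧ (m' = -m ∨ m' = n + m)) := by
  by_contra! hc
  obtain ⟨c1, c2, c3⟩ := hc
  rcases h3 with h3 | h3 | h3 | h3
  · exact c1 h3
  · have g : 2 * n ≠ 0 := fun h => (c3 h).1 h3
    have e1 : n + 2 * m = 0 := by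
      rcases h2 with h | h | h | h
      · linear_combination h + h3
      · exact (g (by linear_combination 2 * h - 2 * h3)).elim
      · exact (c1 (by linear_combination -h)).elim
      · exact (g (by linear_combination h - h3)).elim
    have e2 : n - 2 * m = 0 := by
      rcases h4 with h | h | h | h
      · linear_combination h - h3
      · exact (c2 (by linear_combination h)).elim
      · exact (c1 (by linear_combination h)).elim
      · exact (g (by linear_combination h - h3)).elim
    exact g (by linear_combination e1 + e2)
  · have g : 2 * n ≠ 0 := fun h => (c3 h).2 h3
    have e1 : n + 2 * m = 0 := by
      rcases h1 with h | h | h | h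
      · exact (c1 (by linear_combination -h)).elim
      · linear_combination h - h3
      · exact (g (by linear_combination -h - h3)).elim
      · exact (c2 (by linear_combination h)).elim
    have e2 : 3 * n + 2 * m = 0 := by
      rcases h4 with h | h | h | h
      · exact (g (by linear_combination h - h3)).elim
      · exact (c2 (by linear_combination h)).elim
      · exact (c1 (by linear_combination h)).elim
      · linear_combination h - h3
    exact g (by linear_combination e2 - e1)
  · exact c2 h3
theorem colour_absurd_hex {R : Type*} [CommRing R] {n m : R}
    (g1 : 2 * m ≠ 0) (g2 : 2 * n ≠ 0)
    (hA : 2 * n + m = 0 ∨ n + 2 * m = 0) (hB : 2 * n - m = 0 ∨ n - 2 * m = 0)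
    (k : n - m = n + m ∨ n - m = -(n + m) ∨ n - m = 2 * n - m ∨ n - m = -(2 * n - m) ∨
      n - m = n - 2 * m ∨ n - m = -(n - 2 * m))
    (k' : n + m = n - m ∨ n + m = -(n - m) ∨ n + m = 2 * n + m ∨ n + m = -(2 * n + m) ∨
      n + m = n + 2 * m ∨ n + m = -(n + 2 * m)) : False := by
  rcases hA with hA | hA <;> rcases hB with hB | hB
  · exact g1 (by linear_combination hA - hB)
  · rcases k' with k' | k' | k' | k' | k' | k'
    · exact g1 (by linear_combination k')
    · exact g2 (by linear_combination k')
    · exact g2 (by linear_combination -2 * k')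
    · exact g2 (by linear_combination 4 * hA - 2 * k')
    · exact g1 (by linear_combination -2 * k')
    · exact g2 (by linear_combination 2 * hB - 2 * hA + 2 * k')
  · rcases k with k | k | k | k | k | k
    · exact g1 (by linear_combination -k)
    · exact g2 (by linear_combination k)
    · exact g2 (by linear_combination -2 * k)
    · exact g2 (by linear_combination 4 * hB - 2 * k)
    · exact g1 (by linear_combination 2 * k)
    · exact g2 (by linear_combination 2 * hA - 2 * hB + 2 * k)
  · exact g2 (by linear_combination hA + hB)

theorem colour_alg_hex {R : Type*} [CommRing R] {n m m' : R}
    (h1 : m = n ∨ m = -n ∨ m = m' ∨ m = -m' ∨ m = n + m' ∨ m = -(n + m'))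
    (h2 : n + m = n ∨ n + m = -n ∨ n + m = m' ∨ n + m = -m' ∨ n + m = n + m' ∨ n + m = -(n + m'))
    (h3 : m' = n ∨ m' = -n ∨ m' = m ∨ m' = -m ∨ m' = n + m ∨ m' = -(n + m))
    (h4 : n + m' = n ∨ n + m' = -n ∨ n + m' = m ∨ n + m' = -m ∨ n + m' = n + m ∨ n + m' = -(n + m))
    (k1 : n - m = n - m' ∨ n - m = -(n - m') ∨ n - m = 2 * n + m' ∨ n - m = -(2 * n + m') ∨
      n - m = n + 2 * m' ∨ n - m = -(n + 2 * m'))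
    (k2 : 2 * n + m = n - m' ∨ 2 * n + m = -(n - m') ∨ 2 * n + m = 2 * n + m' ∨
      2 * n + m = -(2 * n + m') ∨ 2 * n + m = n + 2 * m' ∨ 2 * n + m = -(n + 2 * m'))
    (k3 : n - m' = n - m ∨ n - m' = -(n - m) ∨ n - m' = 2 * n + m ∨ n - m' = -(2 * n + m) ∨
      n - m' = n + 2 * m ∨ n - m' = -(n + 2 * m)) :
    m' = m ∨ m' = -(n + m) ∨ (2 * n = 0 ∧ (m' = -m ∨ m' = n + m)) := by
  by_contra! hc
  obtain ⟨c1, c2, c3⟩ := hc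
  rcases h3 with h3 | h3 | h3 | h3 | h3 | h3
  · subst m'
    have e1 : m = 2 * n ∨ m = -n := by
      rcases h1 with h1 | h1 | h1 | h1 | h1 | h1
      · exact (c1 h1.symm).elim
      · exact Or.inr h1
      · exact (c1 h1.symm).elim
      · exact Or.inr h1
      · left; linear_combination h1
      · exact (c2 (by linear_combination h1)).elim
    rcases e1 with rfl | rfl
    · have g : 2 * n ≠ 0 := fun h => (c3 h).2 (by linear_combination -h)
      have g4 : 4 * n ≠ 0 := fun h => c2 (by linear_combination h)
      rcases k1 with h | h | h | h | h | h
      · exact g (by linear_combination -2 * h)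
      · exact g (by linear_combination -2 * h)
      · exact g4 (by linear_combination -h)
      · exact g (by linear_combination h)
      · exact g4 (by linear_combination -h)
      · exact g (by linear_combination h)
    · have g : 2 * n ≠ 0 := fun h => (c3 h).1 (by ring)
      rcases h2 with h | h | h | h | h | h
      · exact g (by linear_combination -2 * h)
      · exact g (by linear_combination 2 * h)
      · exact g (by linear_combination -2 * h)
      · exact g (by linear_combination 2 * h)
      · exact g (by linear_combination -h)
      · exact g (by linear_combination h)
  · subst m'
    have e1 : m = n := by
      rcases h1 with h1 | h1 | h1 | h1 | h1 | h1
      · exact h1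
      · exact (c1 h1.symm).elim
      · exact (c1 h1.symm).elim
      · linear_combination h1
      · exact (c2 (by linear_combination h1)).elim
      · exact (c2 (by linear_combination h1)).elim
    subst m
    have g : 2 * n ≠ 0 := fun h => c1 (by linear_combination -h)
    have g3 : 3 * n = 0 := by
      rcases h2 with h | h | h | h | h | h
      · exact (g (by linear_combination 2 * h)).elim
      · linear_combination h
      · linear_combination h
      · exact (g (by linear_combination 2 * h)).elim
      · exact (g (by linear_combination h)).elim
      · exact (g (by linear_combination h)).elim
    rcases k3 with h | h | h | h | h | h
    · exact g (by linear_combination h)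
    · exact g (by linear_combination h)
    · exact g (by linear_combination h + g3)
    · exact g (by linear_combination h - g3)
    · exact g (by linear_combination h + g3)
    · exact g (by linear_combination h - g3)
  · exact c1 h3
  · subst h3
    have g : 2 * n ≠ 0 := fun h => (c3 h).1 rfl
    refine colour_absurd_hex (n := n) (m := m) (fun h => c1 ?_) g ?_ ?_ ?_ ?_
    · linear_combination -h
    · rcases h2 with h | h | h | h | h | h
      · exact (c1 (by linear_combination -2 * h)).elim
      · left; linear_combination h
      · right; linear_combination h
      · exact (g (by linear_combination 2 * h)).elim
      · exact (c1 (by linear_combination -h)).elim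
      · exact (g (by linear_combination h)).elim
    · rcases h4 with h | h | h | h | h | h
      · exact (c1 (by linear_combination 2 * h)).elim
      · left; linear_combination h
      · right; linear_combination h
      · exact (g (by linear_combination 2 * h)).elim
      · exact (c1 (by linear_combination h)).elim
      · exact (g (by linear_combination h)).elim
    · simpa only [sub_neg_eq_add, mul_neg, ← sub_eq_add_neg] using k1
    · simpa only [sub_neg_eq_add] using k3
  · subst h3
    have g : 2 * n ≠ 0 := fun h => (c3 h).2 rfl
    refine colour_absurd_hex (n := n) (m := -(n + m)) (fun h => c2 ?_) g ?_ ?_ ?_ ?_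
    · linear_combination -h
    · rcases h1 with h | h | h | h | h | h
      · left; linear_combination -h
      · exact (c2 (by linear_combination 2 * h)).elim
      · exact (g (by linear_combination -2 * h)).elim
      · right; linear_combination -h
      · exact (g (by linear_combination -h)).elim
      · exact (c2 (by linear_combination h)).elim
    · rcases h4 with h | h | h | h | h | h
      · exact (c2 (by linear_combination 2 * h)).elim
      · left; linear_combination h
      · exact (g (by linear_combination h)).elim
      · exact (c2 (by linear_combination h)).elim
      · exact (g (by linear_combination 2 * h)).elim
      · right; linear_combination h
    · rcases k2 with h | h | h | h | h | h
      · left; linear_combination h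
      · right; left; linear_combination h
      · right; right; left; linear_combination h
      · right; right; right; left; linear_combination h
      · right; right; right; right; left; linear_combination h
      · right; right; right; right; right; linear_combination h
    · rcases k3 with h | h | h | h | h | h
      · right; right; left; linear_combination h
      · right; right; right; left; linear_combination h
      · left; linear_combination h
      · right; left; linear_combination h
      · right; right; right; right; right; linear_combination h
      · right; right; right; right; left; linear_combination h
  · exact c2 h3

/-- Every value of the first form is a value of the second form, with the same colour up to sign. -/
def ColLe {R : Type*} [CommRing R] (b c : ℚ) (n m : R) (b' c' : ℚ) (n' m' : R) : Prop :=
  ∀ x y : ℤ, ∃ x' y' : ℤ, binForm b' c' x' y' = binForm b c x y ∧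
    (n * x + m * y = n' * x' + m' * y' ∨ n * x + m * y = -(n' * x' + m' * y'))

def ColIso {R : Type*} [CommRing R] (b c : ℚ) (n m n' m' : R) : Prop :=
  ∃ p q r s : ℤ, IsUnit (p * s - q * r) ∧
    (∀ x y : ℤ, binForm b c (p * x + q * y) (r * x + s * y) = binForm b c x y) ∧
    ((n' = n * p + m * r ∧ m' = n * q + m * s) ∨ (n' = -(n * p + m * r) ∧ m' = -(n * q + m * s)))

section
variable {R : Type*} [CommRing R] {b c : ℚ} {n m n' m' n'' m'' : R}

theorem ColIso.refl : ColIso b c n m n m :=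
  ⟨1, 0, 0, 1, by simp, by simp, Or.inl (by simp)⟩

theorem ColIso.neg : ColIso b c n m (-n) (-m) :=
  ⟨1, 0, 0, 1, by simp, by simp, Or.inr (by simp)⟩

theorem ColIso.trans (h : ColIso b c n m n' m') (h' : ColIso b c n' m' n'' m'') :
    ColIso b c n m n'' m'' := by
  obtain ⟨p, q, r, s, hu, hf, hc⟩ := h
  obtain ⟨p', q', r', s', hu', hf', hc'⟩ := h'
  refine ⟨p * p' + q * r', p * q' + q * s', r * p' + s * r', r * q' + s * s', ?_, ?_, ?_⟩
  · have : (p * p' + q * r') * (r * q' + s * s') - (p * q' + q * s') * (r * p' + s * r')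
      = (p * s - q * r) * (p' * s' - q' * r') := by ring
    rw [this]
    exact hu.mul hu'
  · intro x y
    rw [← hf' x y, ← hf (p' * x + q' * y)]
    congr 1 <;> ring
  · push_cast
    rcases hc with ⟨rfl, rfl⟩ | ⟨rfl, rfl⟩ <;> rcases hc' with ⟨rfl, rfl⟩ | ⟨rfl, rfl⟩
    · left; constructor <;> ring
    · right; constructor <;> ring
    · right; constructor <;> ring
    · left; constructor <;> ring

theorem ColIso.symm (h : ColIso b c n m n' m') : ColIso b c n' m' n m := by
  obtain ⟨p, q, r, s, hu, hf, hc⟩ := h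
  obtain ⟨u, hu⟩ := hu
  have hu2 : ((p * s - q * r : ℤ)) * (p * s - q * r) = 1 := by
    rw [← hu]; rcases Int.units_eq_one_or u with rfl | rfl <;> simp
  have hu' : ((p : R) * s - q * r) * (p * s - q * r) = 1 := by exact_mod_cast congrArg (Int.cast : ℤ → R) hu2
  set e := p * s - q * r with he
  refine ⟨e * s, -(e * q), -(e * r), e * p, ?_, ?_, ?_⟩
  · have : e * s * (e * p) - -(e * q) * -(e * r) = e * (e * e) := by rw [he]; ring
    rw [this, hu2, mul_one, ← hu]
    exact u.isUnit
  · intro x y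
    rw [← hf]
    congr 1
    · linear_combination x * hu2 + (x * e) * he
    · linear_combination y * hu2 + (y * e) * he
  · push_cast
    have he' : (e : R) = p * s - q * r := by rw [he]; push_cast; ring
    rw [← he'] at hu'
    rcases hc with ⟨rfl, rfl⟩ | ⟨rfl, rfl⟩
    · left; constructor
      · linear_combination -n * hu' + n * e * he'
      · linear_combination -m * hu' + m * e * he'
    · right; constructor
      · linear_combination -n * hu' + n * e * he'
      · linear_combination -m * hu' + m * e * he'

theorem ColIso.colLe (h : ColIso b c n m n' m') : ColLe b c n' m' b c n m := by
  obtain ⟨p, q, r, s, hu, hf, hc⟩ := h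
  intro x y
  refine ⟨p * x + q * y, r * x + s * y, hf x y, ?_⟩
  push_cast
  rcases hc with ⟨rfl, rfl⟩ | ⟨rfl, rfl⟩
  · left; ring
  · right; ring

theorem ColLe.trans {b' c' b'' c'' : ℚ} (h : ColLe b c n m b' c' n' m')
    (h' : ColLe b' c' n' m' b'' c'' n'' m'') : ColLe b c n m b'' c'' n'' m'' := by
  intro x y
  obtain ⟨x', y', h1, h2⟩ := h x y
  obtain ⟨x'', y'', h3, h4⟩ := h' x' y'
  refine ⟨x'', y'', h3.trans h1, ?_⟩
  rcases h2 with h2 | h2 <;> rcases h4 with h4 | h4 <;> rw [h2, h4] <;> simp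

theorem ColIso.swap : ColIso b 1 n m m n :=
  ⟨0, 1, 1, 0, by simp, fun x y => by simp [binForm]; ring, Or.inl (by simp)⟩

theorem ColIso.reflect : ColIso 0 c n m n (-m) :=
  ⟨1, 0, 0, -1, by simp, fun x y => by simp [binForm], Or.inl (by simp)⟩

theorem ColIso.shear : ColIso 1 c n m n (-(n + m)) :=
  ⟨1, -1, 0, -1, by simp, fun x y => by simp [binForm]; ring, Or.inl (by constructor <;> simp; ring)⟩

end

theorem binForm_eq_last {b c : ℚ} (hb : 0 ≤ b) (hb1 : b ≤ 1) (hc : 1 ≤ c) (hbc : b < 1 ∨ 1 < c)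
    {x y : ℤ} (h : binForm b c x y = c) :
    (y = 0 ∧ (x : ℚ) ^ 2 = c) ∨ (x = 0 ∧ (y = 1 ∨ y = -1)) ∨
      (b = 1 ∧ (x = 1 ∧ y = 1 ∨ x = -1 ∧ y = -1)) := by
  have h4 : binForm b c x y < 4 * c - b ^ 2 := by
    rw [h]; rcases hbc with hbc | hbc <;> nlinarith
  rcases binForm_small hb hb1 hc h4 with ⟨rfl, h'⟩ | ⟨rfl, h'⟩ | ⟨rfl, h'⟩
  · left; exact ⟨rfl, h'.symm.trans h⟩
  · rw [h] at h'
    have h5 : (x : ℚ) * (x - b) = 0 := by linear_combination -h'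
    rcases mul_eq_zero.1 h5 with h5 | h5
    · right; left; exact ⟨by exact_mod_cast h5, Or.inl rfl⟩
    · have h6 : b = x := by linear_combination -h5
      subst h6
      have h7 : 0 ≤ x := by exact_mod_cast hb
      have h8 : x ≤ 1 := by exact_mod_cast hb1
      interval_cases x <;> simp
  · rw [h] at h'
    have h5 : (x : ℚ) * (x + b) = 0 := by linear_combination -h'
    rcases mul_eq_zero.1 h5 with h5 | h5
    · right; left; exact ⟨by exact_mod_cast h5, Or.inr rfl⟩
    · have h6 : b = (-x : ℤ) := by push_cast; linear_combination h5
      obtain ⟨t, rfl⟩ : ∃ t, x = -t := ⟨-x, by simp⟩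
      rw [neg_neg] at h6
      subst h6
      have h7 : 0 ≤ t := by exact_mod_cast hb
      have h8 : t ≤ 1 := by exact_mod_cast hb1
      interval_cases t <;> simp

theorem binForm_eq_diag {b c : ℚ} (hb : 0 < b) (hb1 : b < 1) (hc : 1 ≤ c)
    {x y : ℤ} (h : binForm b c x y = c + 1 - b) :
    (y = 0 ∧ (x : ℚ) ^ 2 = c + 1 - b) ∨ (x = 1 ∧ y = 1 ∨ x = -1 ∧ y = -1) := by
  have h4 : binForm b c x y < 4 * c - b ^ 2 := by rw [h]; nlinarith
  rcases binForm_small hb.le hb1.le hc h4 with ⟨rfl, h'⟩ | ⟨rfl, h'⟩ | ⟨rfl, h'⟩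
  · left; exact ⟨rfl, h'.symm.trans h⟩
  · rw [h] at h'
    have h5 : ((x : ℚ) - 1) * (x + 1 - b) = 0 := by linear_combination -h'
    rcases mul_eq_zero.1 h5 with h5 | h5
    · right; left; exact ⟨by exact_mod_cast sub_eq_zero.1 h5, rfl⟩
    · have h6 : b = (x + 1 : ℤ) := by push_cast; linear_combination -h5
      rw [h6] at hb hb1
      have h7 : 0 < x + 1 := by exact_mod_cast hb
      have h8 : x + 1 < 1 := by exact_mod_cast hb1
      omega
  · rw [h] at h'
    have h5 : ((x : ℚ) + 1) * (x - 1 + b) = 0 := by linear_combination -h'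
    rcases mul_eq_zero.1 h5 with h5 | h5
    · right; right; exact ⟨by exact_mod_cast eq_neg_of_add_eq_zero_left h5, rfl⟩
    · have h6 : b = (1 - x : ℤ) := by push_cast; linear_combination h5
      rw [h6] at hb hb1
      have h7 : 0 < 1 - x := by exact_mod_cast hb
      have h8 : 1 - x < 1 := by exact_mod_cast hb1
      omega

theorem binForm_one_eq_add_two {c : ℚ} (hc : 1 < c) {x y : ℤ} (h : binForm 1 c x y = c + 2) :
    (y = 0 ∧ (x : ℚ) ^ 2 = c + 2) ∨ (x = 2 ∧ y = 1 ∨ x = -2 ∧ y = -1) ∨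
      (x = -1 ∧ y = 1 ∨ x = 1 ∧ y = -1) := by
  have h4 : binForm 1 c x y < 4 * c - 1 ^ 2 := by rw [h]; linarith
  rcases binForm_small zero_le_one le_rfl hc.le h4 with ⟨rfl, h'⟩ | ⟨rfl, h'⟩ | ⟨rfl, h'⟩
  · left; exact ⟨rfl, h'.symm.trans h⟩
  · rw [h] at h'
    have h5 : ((x : ℚ) - 2) * (x + 1) = 0 := by linear_combination -h'
    have h6 : (x - 2) * (x + 1) = 0 := by exact_mod_cast h5
    rcases mul_eq_zero.1 h6 with h6 | h6 <;> omega
  · rw [h] at h'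
    have h5 : ((x : ℚ) + 2) * (x - 1) = 0 := by linear_combination -h'
    have h6 : (x + 2) * (x - 1) = 0 := by exact_mod_cast h5
    rcases mul_eq_zero.1 h6 with h6 | h6 <;> omega

theorem mul_le_sq_int {b : ℚ} (hb : 0 ≤ b) (hb1 : b ≤ 1) (x : ℤ) : b * x ≤ (x : ℚ) ^ 2 := by
  have h : (x : ℚ) ≤ (x : ℚ) ^ 2 := by exact_mod_cast Int.le_self_sq x
  rcases le_total (0 : ℚ) x with h0 | h0
  · nlinarith
  · nlinarith

theorem binForm_eq_one {b c : ℚ} (hb : 0 ≤ b) (hb1 : b ≤ 1) (hc : 1 ≤ c) (hbc : b < 1 ∨ 1 < c)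
    {x y : ℤ} (h : binForm b c x y = 1) :
    (y = 0 ∧ (x = 1 ∨ x = -1)) ∨ (c = 1 ∧ x = 0 ∧ (y = 1 ∨ y = -1)) := by
  rcases hc.eq_or_lt with rfl | hc1
  · rcases binForm_eq_last hb hb1 le_rfl hbc h with h' | h' | h'
    · left; exact ⟨h'.1, sq_eq_one_iff.1 (by exact_mod_cast h'.2)⟩
    · right; exact ⟨rfl, h'⟩
    · rcases hbc with hbc | hbc
      · exact absurd h'.1 hbc.ne
      · exact absurd hbc (lt_irrefl _)
  · have h4 : binForm b c x y < 4 * c - b ^ 2 := by rw [h]; nlinarith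
    rcases binForm_small hb hb1 hc h4 with ⟨rfl, h'⟩ | ⟨rfl, h'⟩ | ⟨rfl, h'⟩
    · left; exact ⟨rfl, sq_eq_one_iff.1 (by exact_mod_cast h'.symm.trans h)⟩
    · have := mul_le_sq_int hb hb1 x
      nlinarith
    · have := mul_le_sq_int hb hb1 (-x)
      push_cast at this
      nlinarith

section
variable {R : Type*} [CommRing R] {b c : ℚ} {n m n' m' : R}

theorem ColLe.last_mem (hb : 0 ≤ b) (hb1 : b ≤ 1) (hc : 1 ≤ c) (hbc : b < 1 ∨ 1 < c)
    {x y : ℤ} (h : ColLe b c n m b c n' m') (hxy : binForm b c x y = c) :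
    (∃ k : ℤ, (k : ℚ) ^ 2 = c ∧ n * x + m * y = n' * k) ∨ (n * x + m * y = m' ∨ n * x + m * y = -m') ∨
      (b = 1 ∧ (n * x + m * y = n' + m' ∨ n * x + m * y = -(n' + m'))) := by
  obtain ⟨x', y', h1, h2⟩ := h x y
  rcases binForm_eq_last hb hb1 hc hbc (h1.trans hxy) with ⟨rfl, h3⟩ | ⟨rfl, rfl | rfl⟩ |
    ⟨h3, ⟨rfl, rfl⟩ | ⟨rfl, rfl⟩⟩
  · left
    rcases h2 with h2 | h2
    · exact ⟨x', h3, by simpa using h2⟩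
    · exact ⟨-x', by simpa using h3, by simpa using h2⟩
  · right; left; simpa using h2
  · right; left; simpa [or_comm] using h2
  · right; right; exact ⟨h3, by simpa using h2⟩
  · right; right; refine ⟨h3, ?_⟩
    rcases h2 with h2 | h2
    · right; rw [h2]; push_cast; ring
    · left; rw [h2]; push_cast; ring

theorem ColLe.diag_mem (hb : 0 < b) (hb1 : b < 1) (hc : 1 ≤ c)
    (h : ColLe b c n m b c n' m') :
    (∃ k : ℤ, (k : ℚ) ^ 2 = c + 1 - b ∧ n + m = n' * k) ∨ (n + m = n' + m' ∨ n + m = -(n' + m')) := by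
  obtain ⟨x', y', h1, h2⟩ := h 1 1
  rcases binForm_eq_diag hb hb1 hc (h1.trans (by simp [binForm]; ring)) with
    ⟨rfl, h3⟩ | ⟨rfl, rfl⟩ | ⟨rfl, rfl⟩
  · left
    rcases h2 with h2 | h2
    · exact ⟨x', h3, by simpa using h2⟩
    · exact ⟨-x', by simpa using h3, by simpa using h2⟩
  · right; simpa using h2
  · right
    rcases h2 with h2 | h2
    · right; linear_combination (by simpa using h2 : n + m = -n' + -m')
    · left; linear_combination (by simpa using h2 : n + m = m' + n')

theorem eq_or_eq_neg_of_int_sq {n m m' : R} {k k' : ℤ} (h : (k : ℚ) ^ 2 = (k' : ℚ) ^ 2)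
    (hm : m = n * k) (hm' : m' = n * k') : m' = m ∨ m' = -m := by
  have h' : k' ^ 2 = k ^ 2 := by exact_mod_cast h.symm
  rcases sq_eq_sq_iff_eq_or_eq_neg.1 h' with rfl | rfl
  · left; rw [hm, hm']
  · right; rw [hm, hm']; push_cast; ring

theorem colIso_of_lt (hb : 0 ≤ b) (hb1 : b < 1) (hc : 1 ≤ c) (h : ColLe b c n m b c n m')
    (h' : ColLe b c n m' b c n m) : ColIso b c n m n m' := by
  have hv : binForm b c 0 1 = c := by simp [binForm]
  have hm : m' = m ∨ m' = -m := by
    have h1 := h.last_mem hb hb1.le hc (Or.inl hb1) hv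
    have h1' := h'.last_mem hb hb1.le hc (Or.inl hb1) hv
    simp only [Int.cast_zero, mul_zero, Int.cast_one, mul_one, zero_add, hb1.ne, false_and, or_false] at h1 h1'
    rcases h1' with ⟨k', hk', h1'⟩ | h1'
    · rcases h1 with ⟨k, hk, h1⟩ | h1 | h1
      · exact eq_or_eq_neg_of_int_sq (hk.trans hk'.symm) h1 h1'
      · exact Or.inl h1.symm
      · right; rw [h1, neg_neg]
    · exact h1'
  rcases hm with rfl | rfl
  · exact ColIso.refl
  rcases hb.eq_or_lt with rfl | hb
  · exact ColIso.reflect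
  have hd : n + -m = n + m ∨ n + -m = -(n + m) := by
    rcases h'.diag_mem hb hb1 hc with ⟨k', hk', h1'⟩ | h1'
    · rcases h.diag_mem hb hb1 hc with ⟨k, hk, h1⟩ | h1 | h1
      · exact eq_or_eq_neg_of_int_sq (hk.trans hk'.symm) h1 h1'
      · exact Or.inl h1.symm
      · right; rw [h1, neg_neg]
    · exact h1'
  rcases hd with hd | hd
  · have : -m = m := by linear_combination hd
    rw [this]; exact ColIso.refl
  · have : n = -n := by linear_combination hd
    rw [show ColIso b c n m n (-m) = ColIso b c n m (-n) (-m) by rw [← this]]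
    exact ColIso.neg

theorem colIso_of_alg {n m m' : R} (h : m' = m ∨ m' = -(n + m) ∨ (2 * n = 0 ∧ (m' = -m ∨ m' = n + m))) :
    ColIso 1 c n m n m' := by
  rcases h with rfl | rfl | ⟨h, rfl | rfl⟩
  · exact ColIso.refl
  · exact ColIso.shear
  · have : n = -n := by linear_combination h
    rw [show ColIso 1 c n m n (-m) = ColIso 1 c n m (-n) (-m) by rw [← this]]
    exact ColIso.neg
  · have : n = -n := by linear_combination h
    rw [show ColIso 1 c n m n (n + m) = ColIso 1 c n m (-n) (- -(n + m)) by rw [← this, neg_neg]]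
    exact ColIso.shear.trans ColIso.neg

theorem colIso_one_of_lt (hc : 1 < c) (h : ColLe 1 c n m 1 c n m')
    (h' : ColLe 1 c n m' 1 c n m) : ColIso 1 c n m n m' := by
  apply colIso_of_alg
  have hv : binForm 1 c 0 1 = c := by simp [binForm]
  have hv' : binForm 1 c 1 1 = c := by simp [binForm]
  have g1 := h.last_mem zero_le_one le_rfl hc.le (Or.inr hc) hv
  have g2 := h.last_mem zero_le_one le_rfl hc.le (Or.inr hc) hv'
  have g3 := h'.last_mem zero_le_one le_rfl hc.le (Or.inr hc) hv
  have g4 := h'.last_mem zero_le_one le_rfl hc.le (Or.inr hc) hv'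
  simp only [Int.cast_zero, mul_zero, Int.cast_one, mul_one, zero_add, true_and] at g1 g2 g3 g4
  by_cases hk : ∃ k : ℤ, (k : ℚ) ^ 2 = c
  · obtain ⟨k, hk⟩ := hk
    have key {t u v : R} (ht : (∃ j : ℤ, (j : ℚ) ^ 2 = c ∧ t = n * j) ∨ (t = u ∨ t = -u) ∨ t = v ∨ t = -v) :
        t = u ∨ t = -u ∨ t = v ∨ t = -v ∨ t = n * k ∨ t = -(n * k) := by
      rcases ht with ⟨j, hj, ht⟩ | ht
      · exact Or.inr (Or.inr (Or.inr (Or.inr (eq_or_eq_neg_of_int_sq (hk.trans hj.symm) rfl ht))))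
      · exact ht.elim (fun ht => ht.elim Or.inl fun ht => Or.inr (Or.inl ht))
          fun ht => Or.inr (Or.inr (ht.elim Or.inl fun ht => Or.inr (Or.inl ht)))
    have key' {m m' : R} {x y : ℤ} (h : ColLe 1 c n m 1 c n m') (hxy : binForm 1 c x y = c + 2) :
        n * x + m * y = m' - n ∨ n * x + m * y = -(m' - n) ∨ n * x + m * y = 2 * n + m' ∨
          n * x + m * y = -(2 * n + m') := by
      obtain ⟨x', y', h1, h2⟩ := h x y
      rcases binForm_one_eq_add_two hc (h1.trans hxy) with ⟨rfl, h3⟩ | h3 | h3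
      · exfalso
        have hk0 : k ≠ 0 := by rintro rfl; norm_num at hk; linarith
        rcases sq_gap_rat hk0 (k := x') (by linarith) with h4 | h4 <;> linarith
      · right; right
        rcases h3 with ⟨rfl, rfl⟩ | ⟨rfl, rfl⟩ <;> rcases h2 with h2 | h2 <;> rw [h2] <;> push_cast
        · left; ring
        · right; ring
        · right; ring
        · left; ring
      · rw [← or_assoc]; left
        rcases h3 with ⟨rfl, rfl⟩ | ⟨rfl, rfl⟩ <;> rcases h2 with h2 | h2 <;> rw [h2] <;> push_cast
        · left; ring
        · right; ring
        · right; ring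
        · left; ring
    have w1 : binForm 1 c (-1) 1 = c + 2 := by simp [binForm]; ring
    have w2 : binForm 1 c 2 1 = c + 2 := by simp [binForm]; ring
    have e (m : R) : n * ((-1 : ℤ) : R) + m * ((1 : ℤ) : R) = m - n := by push_cast; ring
    have e' (m : R) : n * ((2 : ℤ) : R) + m * ((1 : ℤ) : R) = 2 * n + m := by push_cast; ring
    refine colour_alg_one (q := n * k) (key g1) (key g2) (key g3) (key g4) ?_ ?_ ?_ ?_
    · simpa only [e] using key' h w1
    · simpa only [e'] using key' h w2
    · simpa only [e] using key' h' w1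
    · simpa only [e'] using key' h' w2
  · have key {t u v : R} (ht : (∃ j : ℤ, (j : ℚ) ^ 2 = c ∧ t = n * j) ∨ (t = u ∨ t = -u) ∨ t = v ∨ t = -v) :
        t = u ∨ t = -u ∨ t = v ∨ t = -v := by
      rcases ht with ⟨j, hj, -⟩ | ht
      · exact absurd ⟨j, hj⟩ hk
      · exact or_assoc.1 ht
    exact colour_alg_two (key g2) (key g1) (key g3) (key g4)

theorem ColLe.one_mem (hb : 0 ≤ b) (hb1 : b ≤ 1) (hc : 1 ≤ c) (hbc : b < 1 ∨ 1 < c)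
    (h : ColLe b c n m b c n' m') :
    (n = n' ∨ n = -n') ∨ (c = 1 ∧ (n = m' ∨ n = -m')) := by
  obtain ⟨x', y', h1, h2⟩ := h 1 0
  rcases binForm_eq_one hb hb1 hc hbc (h1.trans (by simp [binForm])) with ⟨rfl, h3⟩ | ⟨h4, rfl, h3⟩
  · left
    rcases h3 with rfl | rfl
    · simpa using h2
    · simpa [or_comm] using h2
  · right
    refine ⟨h4, ?_⟩
    rcases h3 with rfl | rfl
    · simpa using h2
    · simpa [or_comm] using h2

theorem colIso_of_not_hex (hb : 0 ≤ b) (hb1 : b ≤ 1) (hc : 1 ≤ c) (hbc : b < 1 ∨ 1 < c)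
    (h : ColLe b c n m b c n' m') (h' : ColLe b c n' m' b c n m) : ColIso b c n m n' m' := by
  have key {n m m' : R} (h : ColLe b c n m b c n m') (h' : ColLe b c n m' b c n m) :
      ColIso b c n m n m' := by
    rcases hb1.eq_or_lt with rfl | hb1
    · exact colIso_one_of_lt (hbc.resolve_left (lt_irrefl _)) h h'
    · exact colIso_of_lt hb hb1 hc h h'
  have key' {n m n' m' : R} (h : ColLe b c n m b c n' m') (h' : ColLe b c n' m' b c n m)
      (hn : n = n' ∨ n = -n') : ColIso b c n m n' m' := by
    rcases hn with rfl | rfl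
    · exact key h h'
    · have hneg : ColIso b c n' m' (-n') (-m') := ColIso.neg
      exact (key (h.trans hneg.symm.colLe) (hneg.colLe.trans h')).trans hneg.symm
  rcases h.one_mem hb hb1 hc hbc with hn | ⟨rfl, hn⟩
  · exact key' h h' hn
  · have hs : ColIso b 1 n' m' m' n' := ColIso.swap
    exact (key' (h.trans hs.symm.colLe) (hs.colLe.trans h') hn).trans hs.symm
end

theorem binForm_hex_eq_one {x y : ℤ} (h : binForm 1 1 x y = 1) :
    (x = 1 ∧ y = 0 ∨ x = -1 ∧ y = 0) ∨ (x = 0 ∧ y = 1 ∨ x = 0 ∧ y = -1) ∨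
      (x = 1 ∧ y = 1 ∨ x = -1 ∧ y = -1) := by
  have h1 : x ^ 2 - x * y + y ^ 2 = 1 := by
    simp only [binForm, one_mul] at h; exact_mod_cast h
  have h2 : -2 < y ∧ y < 2 := by constructor <;> nlinarith [sq_nonneg (2 * x - y)]
  have h3 : -2 < x ∧ x < 2 := by constructor <;> nlinarith [sq_nonneg (2 * y - x)]
  obtain ⟨h2, h2'⟩ := h2
  obtain ⟨h3, h3'⟩ := h3
  interval_cases x <;> interval_cases y <;> simp at h1 ⊢

theorem binForm_hex_eq_three {x y : ℤ} (h : binForm 1 1 x y = 3) :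
    (x = 1 ∧ y = -1 ∨ x = -1 ∧ y = 1) ∨ (x = 2 ∧ y = 1 ∨ x = -2 ∧ y = -1) ∨
      (x = 1 ∧ y = 2 ∨ x = -1 ∧ y = -2) := by
  have h1 : x ^ 2 - x * y + y ^ 2 = 3 := by
    simp only [binForm, one_mul] at h; exact_mod_cast h
  have h2 : -3 < y ∧ y < 3 := by constructor <;> nlinarith [sq_nonneg (2 * x - y)]
  have h3 : -3 < x ∧ x < 3 := by constructor <;> nlinarith [sq_nonneg (2 * y - x)]
  obtain ⟨h2, h2'⟩ := h2
  obtain ⟨h3, h3'⟩ := h3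
  interval_cases x <;> interval_cases y <;> simp at h1 ⊢

theorem binForm_eisenstein_eq {x y : ℤ} :
    (binForm 0 3 x y = 1 → y = 0 ∧ (x = 1 ∨ x = -1)) ∧
      (binForm 0 3 x y = 3 → x = 0 ∧ (y = 1 ∨ y = -1)) := by
  have e : binForm 0 3 x y = ((x ^ 2 + 3 * y ^ 2 : ℤ) : ℚ) := by simp [binForm]
  rw [e]
  constructor
  all_goals
    intro h
    norm_cast at h
    have h2 : -2 < y ∧ y < 2 := by constructor <;> nlinarith [sq_nonneg x]
    have h3 : -2 < x ∧ x < 2 := by constructor <;> nlinarith [sq_nonneg y]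
    obtain ⟨h2, h2'⟩ := h2
    obtain ⟨h3, h3'⟩ := h3
    interval_cases x <;> interval_cases y <;> simp at h ⊢

section
variable {R : Type*} [CommRing R] {n m n' m' : R}

theorem ColLe.hex_one_mem {b c : ℚ} {x y : ℤ} (h : ColLe b c n m 1 1 n' m') (hxy : binForm b c x y = 1) :
    n * x + m * y = n' ∨ n * x + m * y = -n' ∨ n * x + m * y = m' ∨ n * x + m * y = -m' ∨
      n * x + m * y = n' + m' ∨ n * x + m * y = -(n' + m') := by
  obtain ⟨x', y', h1, h2⟩ := h x y
  rcases binForm_hex_eq_one (h1.trans hxy) with h3 | h3 | h3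
  · rw [← or_assoc]; left
    rcases h3 with ⟨rfl, rfl⟩ | ⟨rfl, rfl⟩
    · simpa using h2
    · simpa [or_comm] using h2
  · right; right; rw [← or_assoc]; left
    rcases h3 with ⟨rfl, rfl⟩ | ⟨rfl, rfl⟩
    · simpa using h2
    · simpa [or_comm] using h2
  · right; right; right; right
    rcases h3 with ⟨rfl, rfl⟩ | ⟨rfl, rfl⟩
    · simpa using h2
    · rcases h2 with h2 | h2 <;> rw [h2] <;> push_cast
      · right; ring
      · left; ring

theorem ColLe.hex_three_mem {b c : ℚ} {x y : ℤ} (h : ColLe b c n m 1 1 n' m') (hxy : binForm b c x y = 3) :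
    n * x + m * y = n' - m' ∨ n * x + m * y = -(n' - m') ∨ n * x + m * y = 2 * n' + m' ∨
      n * x + m * y = -(2 * n' + m') ∨ n * x + m * y = n' + 2 * m' ∨ n * x + m * y = -(n' + 2 * m') := by
  obtain ⟨x', y', h1, h2⟩ := h x y
  rcases binForm_hex_eq_three (h1.trans hxy) with h3 | h3 | h3
  · rw [← or_assoc]; left
    rcases h3 with ⟨rfl, rfl⟩ | ⟨rfl, rfl⟩ <;> rcases h2 with h2 | h2 <;> rw [h2] <;> push_cast
    · left; ring
    · right; ring
    · right; ring
    · left; ring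
  · right; right; rw [← or_assoc]; left
    rcases h3 with ⟨rfl, rfl⟩ | ⟨rfl, rfl⟩ <;> rcases h2 with h2 | h2 <;> rw [h2] <;> push_cast
    · left; ring
    · right; ring
    · right; ring
    · left; ring
  · right; right; right; right
    rcases h3 with ⟨rfl, rfl⟩ | ⟨rfl, rfl⟩ <;> rcases h2 with h2 | h2 <;> rw [h2] <;> push_cast
    · left; ring
    · right; ring
    · right; ring
    · left; ring

theorem colIso_hex (h : ColLe 1 1 n m 1 1 n' m') (h' : ColLe 1 1 n' m' 1 1 n m) :
    ColIso 1 1 n m n' m' := by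
  have u1 : binForm 1 1 0 1 = 1 := by norm_num [binForm]
  have u2 : binForm 1 1 1 1 = 1 := by norm_num [binForm]
  have v1 : binForm 1 1 1 (-1) = 3 := by norm_num [binForm]
  have v2 : binForm 1 1 2 1 = 3 := by norm_num [binForm]
  have key {n m m' : R} (h : ColLe 1 1 n m 1 1 n m') (h' : ColLe 1 1 n m' 1 1 n m) :
      ColIso 1 1 n m n m' := by
    apply colIso_of_alg
    have e1 (m : R) : n * ((0 : ℤ) : R) + m * ((1 : ℤ) : R) = m := by push_cast; ring
    have e2 (m : R) : n * ((1 : ℤ) : R) + m * ((1 : ℤ) : R) = n + m := by push_cast; ring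
    have e3 (m : R) : n * ((1 : ℤ) : R) + m * ((-1 : ℤ) : R) = n - m := by push_cast; ring
    have e4 (m : R) : n * ((2 : ℤ) : R) + m * ((1 : ℤ) : R) = 2 * n + m := by push_cast; ring
    have h1 := h.hex_one_mem u1
    have h2 := h.hex_one_mem u2
    have h3 := h'.hex_one_mem u1
    have h4 := h'.hex_one_mem u2
    have k1 := h.hex_three_mem v1
    have k2 := h.hex_three_mem v2
    have k3 := h'.hex_three_mem v1
    rw [e1] at h1 h3
    rw [e2] at h2 h4
    rw [e3] at k1 k3
    rw [e4] at k2
    exact colour_alg_hex h1 h2 h3 h4 k1 k2 k3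
  have key' {n m n' m' : R} (h : ColLe 1 1 n m 1 1 n' m') (h' : ColLe 1 1 n' m' 1 1 n m)
      (hn : n = n' ∨ n = -n') : ColIso 1 1 n m n' m' := by
    rcases hn with rfl | rfl
    · exact key h h'
    · have hneg : ColIso 1 1 n' m' (-n') (-m') := ColIso.neg
      exact (key (h.trans hneg.symm.colLe) (hneg.colLe.trans h')).trans hneg.symm
  have h1 := h.hex_one_mem (x := 1) (y := 0) (by norm_num [binForm])
  rw [show n * ((1 : ℤ) : R) + m * ((0 : ℤ) : R) = n by push_cast; ring] at h1
  rcases h1 with h1 | h1 | h1 | h1 | h1 | h1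
  · exact key' h h' (Or.inl h1)
  · exact key' h h' (Or.inr h1)
  · have hs : ColIso 1 1 n' m' m' n' := ColIso.swap
    exact (key' (h.trans hs.symm.colLe) (hs.colLe.trans h') (Or.inl h1)).trans hs.symm
  · have hs : ColIso 1 1 n' m' m' n' := ColIso.swap
    exact (key' (h.trans hs.symm.colLe) (hs.colLe.trans h') (Or.inr h1)).trans hs.symm
  · have hs : ColIso 1 1 n' m' (-(n' + m')) n' := ColIso.shear.trans ColIso.swap
    exact (key' (h.trans hs.symm.colLe) (hs.colLe.trans h') (Or.inr (by rw [h1, neg_neg]))).trans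
      hs.symm
  · have hs : ColIso 1 1 n' m' (-(n' + m')) n' := ColIso.shear.trans ColIso.swap
    exact (key' (h.trans hs.symm.colLe) (hs.colLe.trans h') (Or.inl h1)).trans hs.symm

theorem ColLe.hex_eisenstein (h : ColLe 1 1 n m 0 3 n' m') :
    3 * n = 0 ∧ m = n ∧ (n' = n ∨ n' = -n) ∧ m' = 0 := by
  have one {x y : ℤ} (hxy : binForm 1 1 x y = 1) : n * x + m * y = n' ∨ n * x + m * y = -n' := by
    obtain ⟨x', y', h1, h2⟩ := h x y
    obtain ⟨rfl, rfl | rfl⟩ := binForm_eisenstein_eq.1 (h1.trans hxy)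
    · simpa using h2
    · simpa [or_comm] using h2
  have three {x y : ℤ} (hxy : binForm 1 1 x y = 3) : n * x + m * y = m' ∨ n * x + m * y = -m' := by
    obtain ⟨x', y', h1, h2⟩ := h x y
    obtain ⟨rfl, rfl | rfl⟩ := binForm_eisenstein_eq.2 (h1.trans hxy)
    · simpa using h2
    · simpa [or_comm] using h2
  have h1 := one (x := 1) (y := 0) (by norm_num [binForm])
  have h2 := one (x := 0) (y := 1) (by norm_num [binForm])
  have h3 := one (x := 1) (y := 1) (by norm_num [binForm])
  have h4 := three (x := 1) (y := -1) (by norm_num [binForm])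
  have h5 := three (x := 2) (y := 1) (by norm_num [binForm])
  simp only [Int.cast_one, Int.cast_zero, Int.cast_neg, mul_one, mul_zero, add_zero, zero_add,
    Int.cast_ofNat] at h1 h2 h3 h4 h5
  have key {n m n' m' : R} (h1 : n = n') (h2 : m = n' ∨ m = -n') (h3 : n + m = n' ∨ n + m = -n')
      (h4 : n + m * -1 = m' ∨ n + m * -1 = -m') (h5 : n * 2 + m = m' ∨ n * 2 + m = -m') :
      3 * n = 0 ∧ m = n ∧ m' = 0 := by
    have h6 : m = n ∧ 3 * n = 0 := by
      rcases h2 with h2 | h2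
      · refine ⟨h2.trans h1.symm, ?_⟩
        rcases h3 with h3 | h3
        · linear_combination -h1 + 3 * h3 - 3 * h2 + h1
        · linear_combination h3 - h2 + 2 * h1
      · have h0 : n' = 0 := by
          rcases h3 with h3 | h3
          · linear_combination h1 + h2 - h3
          · linear_combination h3 - h1 - h2
        rw [h1, h2, h0]; simp
    obtain ⟨rfl, h6⟩ := h6
    refine ⟨h6, rfl, ?_⟩
    rcases h4 with h4 | h4
    · linear_combination -h4
    · linear_combination h4
  rcases h1 with h1 | h1
  · obtain ⟨k1, k2, k3⟩ := key h1 h2 h3 h4 h5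
    exact ⟨k1, k2, Or.inl h1.symm, k3⟩
  · obtain ⟨k1, k2, k3⟩ := key h1 (by simpa [or_comm] using h2) (by simpa [or_comm] using h3) h4 h5
    exact ⟨k1, k2, Or.inr (by rw [h1, neg_neg]), k3⟩

end

/-- Classification of coloured reduced binary forms with the same coloured values. -/
theorem colIso_or_hex {R : Type*} [CommRing R] {b c b' c' : ℚ} {n m n' m' : R}
    (hb : 0 ≤ b) (hb1 : b ≤ 1) (hc : 1 ≤ c) (hb' : 0 ≤ b') (hb1' : b' ≤ 1) (hc' : 1 ≤ c')
    (h : ColLe b c n m b' c' n' m') (h' : ColLe b' c' n' m' b c n m) :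
    (b = b' ∧ c = c' ∧ ColIso b c n m n' m') ∨
      (b = 1 ∧ c = 1 ∧ b' = 0 ∧ c' = 3 ∧ 3 * n = 0 ∧ m = n ∧ (n' = n ∨ n' = -n) ∧ m' = 0) ∨
      (b' = 1 ∧ c' = 1 ∧ b = 0 ∧ c = 3 ∧ 3 * n' = 0 ∧ m' = n' ∧ (n = n' ∨ n = -n') ∧ m = 0) := by
  have hrep (v : ℚ) : BinRep b c v ↔ BinRep b' c' v := by
    constructor
    · rintro ⟨x, y, rfl⟩
      obtain ⟨x', y', h1, -⟩ := h x y
      exact ⟨x', y', h1⟩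
    · rintro ⟨x, y, rfl⟩
      obtain ⟨x', y', h1, -⟩ := h' x y
      exact ⟨x', y', h1⟩
  rcases binRep_iff hb hb1 hc hb' hb1' hc' hrep with ⟨rfl, rfl⟩ | ⟨rfl, rfl, rfl, rfl⟩ |
    ⟨rfl, rfl, rfl, rfl⟩
  · refine Or.inl ⟨rfl, rfl, ?_⟩
    rcases hb1.eq_or_lt with rfl | hb1'
    · rcases hc.eq_or_lt with rfl | hc''
      · exact colIso_hex h h'
      · exact colIso_of_not_hex hb hb1 hc (Or.inr hc'') h h'
    · exact colIso_of_not_hex hb hb1 hc (Or.inl hb1') h h'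
  · exact Or.inr (Or.inl ⟨rfl, rfl, rfl, rfl, h.hex_eisenstein⟩)
  · exact Or.inr (Or.inr ⟨rfl, rfl, rfl, rfl, h'.hex_eisenstein⟩)

/-- A rational cubic with a double root in an extension field has rational roots. -/
theorem exists_rat_double_root {K : Type*} [Field K] [CharZero K] {d₀ a₂ a₁ a₀ : ℚ} (hd : d₀ ≠ 0)
    {p q p' q' : K}
    (h : ∀ t : ℚ, ((d₀ * t ^ 3 + a₂ * t ^ 2 + a₁ * t + a₀ : ℚ) : K) =
      (p * t + q) ^ 2 * (p' * t + q')) :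
    ∃ l m : ℚ, ∀ t : ℚ, d₀ * t ^ 3 + a₂ * t ^ 2 + a₁ * t + a₀ = d₀ * (t - l) ^ 2 * (t - m) := by
  have h0 := h 0
  have h1 := h 1
  have h2 := h (-1)
  have h3 := h 2
  push_cast at h0 h1 h2 h3
  have c3 : (d₀ : K) = p ^ 2 * p' := by
    linear_combination (-1 / 2) * h1 - (1 / 6) * h2 + (1 / 6) * h3 + (1 / 2) * h0
  have c0 : (a₀ : K) = q ^ 2 * q' := by linear_combination h0
  have c2 : (a₂ : K) = p ^ 2 * q' + 2 * p * q * p' := by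
    linear_combination (1 / 2) * h1 + (1 / 2) * h2 - h0
  have c1 : (a₁ : K) = q ^ 2 * p' + 2 * p * q * q' := by
    linear_combination (1 / 2) * h1 - (1 / 2) * h2 - c3
  have hd' : (d₀ : K) ≠ 0 := by exact_mod_cast hd
  have hp : p ≠ 0 := by rintro rfl; simp [c3] at hd'
  have hp' : p' ≠ 0 := by rintro rfl; simp [c3] at hd'
  obtain ⟨l, rfl⟩ : ∃ l, q = -(p * l) := ⟨-q / p, by field_simp⟩
  obtain ⟨m, rfl⟩ : ∃ m, q' = -(p' * m) := ⟨-q' / p', by field_simp⟩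
  have e2 : (a₂ : K) = -d₀ * (2 * l + m) := by rw [c2, c3]; ring
  have e1 : (a₁ : K) = d₀ * (l ^ 2 + 2 * l * m) := by rw [c1, c3]; ring
  have e0 : (a₀ : K) = -d₀ * (l ^ 2 * m) := by rw [c0, c3]; ring
  have hdisc : ((a₂ ^ 2 - 3 * a₁ * d₀ : ℚ) : K) = d₀ ^ 2 * (l - m) ^ 2 := by
    push_cast; rw [e2, e1]; ring
  suffices hl : ∃ l₀ : ℚ, (l₀ : K) = l by
    obtain ⟨l₀, rfl⟩ := hl
    have hm : m = ((-a₂ / d₀ - 2 * l₀ : ℚ) : K) := by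
      push_cast; rw [e2]; field_simp; ring
    refine ⟨l₀, -a₂ / d₀ - 2 * l₀, fun t => ?_⟩
    have : ((d₀ * t ^ 3 + a₂ * t ^ 2 + a₁ * t + a₀ : ℚ) : K)
        = ((d₀ * (t - l₀) ^ 2 * (t - (-a₂ / d₀ - 2 * l₀)) : ℚ) : K) := by
      rw [h t, Rat.cast_mul, Rat.cast_sub t, ← hm]
      push_cast
      rw [c3]; ring
    exact_mod_cast this
  by_cases hD : a₂ ^ 2 - 3 * a₁ * d₀ = 0
  · rw [hD, Rat.cast_zero] at hdisc
    have hlm : l = m := by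
      rcases mul_eq_zero.1 hdisc.symm with h | h
      · exact absurd (pow_eq_zero_iff (two_ne_zero) |>.1 h) hd'
      · exact sub_eq_zero.1 (pow_eq_zero_iff (two_ne_zero) |>.1 h)
    refine ⟨-a₂ / (3 * d₀), ?_⟩
    push_cast
    rw [e2, ← hlm]; field_simp; ring
  · have hD' : ((a₂ ^ 2 - 3 * a₁ * d₀ : ℚ) : K) ≠ 0 := by exact_mod_cast hD
    refine ⟨(9 * d₀ * a₀ - a₂ * a₁) / (2 * (a₂ ^ 2 - 3 * a₁ * d₀)), ?_⟩
    rw [Rat.cast_div, div_eq_iff (by push_cast at hD' ⊢; exact mul_ne_zero two_ne_zero hD')]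
    push_cast at hdisc ⊢
    rw [hdisc, e2, e1, e0]; ring

theorem eq_zero_of_forall_int_nonneg {a b : ℚ} (h : ∀ t : ℤ, 0 ≤ a + t * b) : b = 0 := by
  by_contra hb
  obtain ⟨t, ht⟩ := exists_int_lt (-a / b)
  obtain ⟨t', ht'⟩ := exists_int_gt (-a / b)
  rcases lt_or_gt_of_ne hb with hb | hb
  · have := h t'
    rw [div_lt_iff_of_neg hb] at ht'
    linarith
  · have := h t
    rw [lt_div_iff₀ hb] at ht
    linarith

theorem int_discrim_eq_zero {a b c : ℤ} (ha : 0 < a) (h : ∀ t : ℤ, ∃ k : ℤ, (2 * a * t + b) ^ 2 + c = k ^ 2) :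
    c = 0 := by
  obtain ⟨k, hk⟩ := h (|b| + |c| + 1)
  have hb := neg_abs_le b
  have hM : |c| < 2 * a * (|b| + |c| + 1) + b := by nlinarith [abs_nonneg b, abs_nonneg c]
  generalize 2 * a * (|b| + |c| + 1) + b = M at *
  rw [← sq_abs k] at hk
  have hk0 := abs_nonneg k
  generalize |k| = k at *
  have h1 := le_abs_self c
  have h2 := neg_abs_le c
  rcases lt_trichotomy k M with h3 | h3 | h3
  · nlinarith
  · subst h3; linarith
  · nlinarith

theorem sq_eq_of_forall_isSquare {a b c : ℚ} (h : ∀ t : ℤ, ∃ k : ℤ, a * t ^ 2 + 2 * b * t + c = k ^ 2)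
    (ha : ∃ k : ℤ, a = k ^ 2) : b ^ 2 = a * c := by
  obtain ⟨k, rfl⟩ := ha
  by_cases hk : k = 0
  · subst hk
    have : 2 * b = 0 := eq_zero_of_forall_int_nonneg (a := c) fun t => by
      obtain ⟨j, hj⟩ := h t
      push_cast at hj
      nlinarith [sq_nonneg (j : ℚ)]
    have hb : b = 0 := by linarith
    subst hb; simp
  · obtain ⟨c₀, hc⟩ := h 0
    obtain ⟨b₀, hb⟩ := h 1
    have e1 : c = ((c₀ ^ 2 : ℤ) : ℚ) := by push_cast; rw [← hc]; simp
    have e2 : 2 * b = ((b₀ ^ 2 - k ^ 2 - c₀ ^ 2 : ℤ) : ℚ) := by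
      push_cast; rw [← hb, ← hc]; push_cast; ring
    have key : 4 * k ^ 2 * c₀ ^ 2 - (b₀ ^ 2 - k ^ 2 - c₀ ^ 2) ^ 2 = 0 := by
      refine int_discrim_eq_zero (a := k ^ 2) (b := b₀ ^ 2 - k ^ 2 - c₀ ^ 2) (by positivity) fun t => ?_
      obtain ⟨j, hj⟩ := h t
      rw [e1, e2] at hj
      have hj' : k ^ 2 * t ^ 2 + (b₀ ^ 2 - k ^ 2 - c₀ ^ 2) * t + c₀ ^ 2 = j ^ 2 := by exact_mod_cast hj
      exact ⟨2 * k * j, by linear_combination 4 * k ^ 2 * hj'⟩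
    have key' : 4 * (k : ℚ) ^ 2 * ((c₀ ^ 2 : ℤ) : ℚ) - ((b₀ ^ 2 - k ^ 2 - c₀ ^ 2 : ℤ) : ℚ) ^ 2 = 0 := by
      exact_mod_cast key
    rw [← e1, ← e2] at key'
    linarith

/-- Gauss reduction of a positive definite integral binary form. -/
theorem exists_reduced_int (a b c : ℤ) (hpos : ∀ x y : ℤ, (x ≠ 0 ∨ y ≠ 0) → 0 < a * x ^ 2 + b * x * y + c * y ^ 2) :
    ∃ p q r s a' b' c' : ℤ, IsUnit (p * s - q * r) ∧ 0 ≤ b' ∧ b' ≤ a' ∧ a' ≤ c' ∧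
      ∀ x y : ℤ, a * (p * x + q * y) ^ 2 + b * (p * x + q * y) * (r * x + s * y) + c * (r * x + s * y) ^ 2
        = a' * x ^ 2 - b' * x * y + c' * y ^ 2 := by
  induction hk : (a + c).toNat using Nat.strong_induction_on generalizing a b c with
  | _ k ih =>
    have ha : 0 < a := by simpa using hpos 1 0 (by simp)
    have hc : 0 < c := by simpa using hpos 0 1 (by simp)
    have step (e : ℤ) (he : IsUnit e) (h : e * b < -a) :
        ∃ p q r s a' b' c' : ℤ, IsUnit (p * s - q * r) ∧ 0 ≤ b' ∧ b' ≤ a' ∧ a' ≤ c' ∧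
          ∀ x y : ℤ, a * (p * x + q * y) ^ 2 + b * (p * x + q * y) * (r * x + s * y) + c * (r * x + s * y) ^ 2
            = a' * x ^ 2 - b' * x * y + c' * y ^ 2 := by
      have he2 : e * e = 1 := Int.isUnit_mul_self he
      have hpos' (x y : ℤ) (hxy : x ≠ 0 ∨ y ≠ 0) :
          0 < a * x ^ 2 + (b + 2 * e * a) * x * y + (a + c + e * b) * y ^ 2 := by
        have := hpos (x + e * y) y (by
          by_cases hy : y = 0
          · subst hy; simpa using hxy
          · exact Or.inr hy)
        linear_combination this + a * y ^ 2 * he2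
      have hc' : 0 < a + c + e * b := by simpa using hpos' 0 1 (by simp)
      obtain ⟨p, q, r, s, a', b', c', hu, h1, h2, h3, h4⟩ :=
        ih (a + (a + c + e * b)).toNat (by omega) a (b + 2 * e * a) (a + c + e * b) hpos' rfl
      refine ⟨p + e * r, q + e * s, r, s, a', b', c', ?_, h1, h2, h3, fun x y => ?_⟩
      · convert hu using 1; ring
      · rw [← h4]; linear_combination a * (r * x + s * y) ^ 2 * he2
    have step' (e : ℤ) (he : IsUnit e) (h : e * b < -c) :
        ∃ p q r s a' b' c' : ℤ, IsUnit (p * s - q * r) ∧ 0 ≤ b' ∧ b' ≤ a' ∧ a' ≤ c' ∧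
          ∀ x y : ℤ, a * (p * x + q * y) ^ 2 + b * (p * x + q * y) * (r * x + s * y) + c * (r * x + s * y) ^ 2
            = a' * x ^ 2 - b' * x * y + c' * y ^ 2 := by
      have he2 : e * e = 1 := Int.isUnit_mul_self he
      have hpos' (x y : ℤ) (hxy : x ≠ 0 ∨ y ≠ 0) :
          0 < (a + c + e * b) * x ^ 2 + (b + 2 * e * c) * x * y + c * y ^ 2 := by
        have := hpos x (y + e * x) (by
          by_cases hy : x = 0
          · subst hy; simpa using hxy
          · exact Or.inl hy)
        linear_combination this + c * x ^ 2 * he2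
      have hc' : 0 < a + c + e * b := by simpa using hpos' 1 0 (by simp)
      obtain ⟨p, q, r, s, a', b', c', hu, h1, h2, h3, h4⟩ :=
        ih (a + c + e * b + c).toNat (by omega) (a + c + e * b) (b + 2 * e * c) c hpos' rfl
      refine ⟨p, q, r + e * p, s + e * q, a', b', c', ?_, h1, h2, h3, fun x y => ?_⟩
      · convert hu using 1; ring
      · rw [← h4]; linear_combination c * (p * x + q * y) ^ 2 * he2
    by_cases k1 : b < -a
    · exact step 1 isUnit_one (by simpa using k1)
    by_cases k2 : a < b
    · exact step (-1) isUnit_one.neg (by linarith)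
    by_cases k3 : b < -c
    · exact step' 1 isUnit_one (by simpa using k3)
    by_cases k4 : c < b
    · exact step' (-1) isUnit_one.neg (by linarith)
    rcases le_total a c with hac | hac <;> rcases le_total b 0 with hb | hb
    · exact ⟨1, 0, 0, 1, a, -b, c, by simp, by omega, by omega, hac, fun x y => by ring⟩
    · exact ⟨1, 0, 0, -1, a, b, c, by simp, by omega, by omega, hac, fun x y => by ring⟩
    · exact ⟨0, 1, 1, 0, c, -b, a, by simp, by omega, by omega, hac, fun x y => by ring⟩
    · exact ⟨0, 1, -1, 0, c, b, a, by simp, by omega, by omega, hac, fun x y => by ring⟩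

theorem exists_coprime_factor (a b : ℤ) : ∃ g p q s t : ℤ, a = g * p ∧ b = g * q ∧ p * s + q * t = 1 := by
  by_cases h : b = 0
  · exact ⟨a, 1, 0, 1, 0, by simp, by simp [h], by simp⟩
  · obtain ⟨s, t, hst⟩ := isCoprime_div_gcd_div_gcd (p := a) h
    refine ⟨gcd a b, a / gcd a b, b / gcd a b, s, t, ?_, ?_, by linarith⟩
    · exact (Int.mul_ediv_cancel' (gcd_dvd_left a b)).symm
    · exact (Int.mul_ediv_cancel' (gcd_dvd_right a b)).symm

/-- Every integer vector is a multiple of the last row of a unimodular matrix. -/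
theorem exists_unimodular_row (u : Fin 3 → ℤ) :
    ∃ (W : Matrix (Fin 3) (Fin 3) ℤ) (k : ℤ), IsUnit W.det ∧ ∀ i, u i = k * W 2 i := by
  obtain ⟨g, p, q, s, t, h0, h1, h2⟩ := exists_coprime_factor (u 0) (u 1)
  obtain ⟨d, e, f, x, y, h3, h4, h5⟩ := exists_coprime_factor g (u 2)
  refine ⟨!![-t, s, 0; -y * p, -y * q, x; e * p, e * q, f], d, ?_, fun i => ?_⟩
  · have : (!![-t, s, 0; -y * p, -y * q, x; e * p, e * q, f] : Matrix (Fin 3) (Fin 3) ℤ).det = 1 := by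
      rw [Matrix.det_fin_three]
      simp
      linear_combination (p * s + q * t) * h5 + h2
    rw [this]; exact isUnit_one
  · fin_cases i
    · simp [h0, h3]; ring
    · simp [h1, h3]; ring
    · simp [h4]

/-- The value of the quadratic form `A` at an integer vector. -/
def intVal (A : Matrix (Fin 3) (Fin 3) ℚ) (x : Fin 3 → ℤ) : ℚ :=
  (fun i => (x i : ℚ)) ⬝ᵥ (A *ᵥ fun i => (x i : ℚ))

theorem mem_simRepZ {A B : Matrix (Fin 3) (Fin 3) ℚ} {p : ℚ × ℚ} :
    p ∈ simRepZ A B ↔ ∃ x : Fin 3 → ℤ, x ≠ 0 ∧ intVal A x = p.1 ∧ intVal B x = p.2 := Iff.rfl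

theorem intVal_add (A B : Matrix (Fin 3) (Fin 3) ℚ) (x : Fin 3 → ℤ) :
    intVal (A + B) x = intVal A x + intVal B x := by
  simp [intVal, add_mulVec]

theorem intVal_smul (r : ℚ) (A : Matrix (Fin 3) (Fin 3) ℚ) (x : Fin 3 → ℤ) :
    intVal (r • A) x = r * intVal A x := by
  simp [intVal, smul_mulVec]

theorem intVal_conj (w : Matrix (Fin 3) (Fin 3) ℤ) (A : Matrix (Fin 3) (Fin 3) ℚ) (x : Fin 3 → ℤ) :
    intVal (w.map ((↑) : ℤ → ℚ) * A * (w.map ((↑) : ℤ → ℚ))ᵀ) x = intVal A (x ᵥ* w) := by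
  have h : (fun i => ((x ᵥ* w) i : ℚ)) = (fun i => (x i : ℚ)) ᵥ* w.map ((↑) : ℤ → ℚ) := by
    ext i; simp [vecMul, dotProduct]
  rw [intVal, intVal, h, ← mulVec_mulVec, ← mulVec_mulVec, mulVec_transpose, dotProduct_mulVec]

theorem intVal_add_smul {A : Matrix (Fin 3) (Fin 3) ℚ} (hA : A.IsSymm) (x u : Fin 3 → ℤ) (t : ℤ) :
    intVal A (x + t • u) = intVal A x + 2 * t * ((fun i => (x i : ℚ)) ⬝ᵥ (A *ᵥ fun i => (u i : ℚ)))
      + t ^ 2 * intVal A u := by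
  have h := hA.apply
  simp only [intVal, dotProduct, mulVec, Fin.sum_univ_three, Pi.add_apply, Pi.smul_apply, smul_eq_mul]
  rw [h 0 1, h 0 2, h 1 2]
  push_cast
  ring

theorem vecMul_ne_zero_of_isUnit {w : Matrix (Fin 3) (Fin 3) ℤ} (hw : IsUnit w.det) {x : Fin 3 → ℤ}
    (hx : x ≠ 0) : x ᵥ* w ≠ 0 := fun h => hx <| by
  have := congrArg (· ᵥ* w⁻¹) h
  simpa [vecMul_vecMul, mul_nonsing_inv _ hw] using this

theorem pairAct_pairAct (w w' : Matrix (Fin 3) (Fin 3) ℚ) (v v' : Matrix (Fin 2) (Fin 2) ℚ)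
    (A B : Matrix (Fin 3) (Fin 3) ℚ) :
    pairAct w v (pairAct w' v' A B).1 (pairAct w' v' A B).2 = pairAct (w * w') (v * v') A B := by
  ext1 <;>
  · simp only [pairAct, mul_apply, Fin.sum_univ_two, Matrix.mul_add, Matrix.add_mul, Matrix.mul_smul,
      Matrix.smul_mul, transpose_mul, Matrix.mul_assoc, smul_add, smul_smul, add_smul]
    abel

theorem pairAct_one_one (A B : Matrix (Fin 3) (Fin 3) ℚ) : pairAct 1 1 A B = (A, B) := by
  simp [pairAct]

theorem simRepZ_pairAct {w : Matrix (Fin 3) (Fin 3) ℤ} (hw : IsUnit w.det)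
    (v : Matrix (Fin 2) (Fin 2) ℚ) (A B : Matrix (Fin 3) (Fin 3) ℚ) :
    simRepZ (pairAct (w.map ((↑) : ℤ → ℚ)) v A B).1 (pairAct (w.map ((↑) : ℤ → ℚ)) v A B).2 =
      (fun p => (v 0 0 * p.1 + v 0 1 * p.2, v 1 0 * p.1 + v 1 1 * p.2)) '' simRepZ A B := by
  ext p
  simp only [mem_simRepZ, Set.mem_image, pairAct, intVal_add, intVal_smul, intVal_conj]
  constructor
  · rintro ⟨x, hx, h1, h2⟩
    exact ⟨(_, _), ⟨x ᵥ* w, vecMul_ne_zero_of_isUnit hw hx, rfl, rfl⟩, Prod.ext h1 h2⟩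
  · rintro ⟨q, ⟨x, hx, h1, h2⟩, rfl⟩
    have hw' : IsUnit w⁻¹.det := by simpa [isUnit_nonsing_inv_det_iff] using hw
    refine ⟨x ᵥ* w⁻¹, vecMul_ne_zero_of_isUnit hw' hx, ?_⟩
    simp [vecMul_vecMul, nonsing_inv_mul _ hw, h1, h2]

/-- The Gram matrix of the square of the integral linear form `l`. -/
def sqMat (l : Fin 3 → ℤ) : Matrix (Fin 3) (Fin 3) ℚ := (vecMulVec l l).map ((↑) : ℤ → ℚ)

theorem sqMat_apply (l : Fin 3 → ℤ) (i j : Fin 3) : sqMat l i j = l i * l j := by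
  simp [sqMat, vecMulVec_apply]

theorem isSymm_sqMat (l : Fin 3 → ℤ) : (sqMat l).IsSymm := by
  ext i j
  simp [sqMat_apply, mul_comm]

theorem conj_sqMat (w : Matrix (Fin 3) (Fin 3) ℤ) (l : Fin 3 → ℤ) :
    w.map ((↑) : ℤ → ℚ) * sqMat l * (w.map ((↑) : ℤ → ℚ))ᵀ = sqMat (w *ᵥ l) := by
  have : ((Int.castRingHom ℚ : ℤ →+* ℚ) : ℤ → ℚ) = ((↑) : ℤ → ℚ) := rfl
  rw [sqMat, sqMat, ← this, ← transpose_map, ← Matrix.map_mul, ← Matrix.map_mul, mul_vecMulVec, vecMulVec_mul,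
    vecMul_transpose]

theorem intVal_sqMat (l x : Fin 3 → ℤ) :
    intVal (sqMat l) x = ((l ⬝ᵥ x : ℤ) : ℚ) ^ 2 := by
  simp only [intVal, dotProduct, mulVec, Fin.sum_univ_three, sqMat_apply]
  push_cast
  ring

/-- A symmetric matrix is determined by the values of its quadratic form at `0/1` vectors. -/
theorem eq_of_intVal_eq {A B : Matrix (Fin 3) (Fin 3) ℚ} (hA : A.IsSymm) (hB : B.IsSymm)
    (h : ∀ x, intVal A x = intVal B x) : A = B := by
  have h0 := h ![1, 0, 0]
  have h1 := h ![0, 1, 0]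
  have h2 := h ![0, 0, 1]
  have h01 := h ![1, 1, 0]
  have h02 := h ![1, 0, 1]
  have h12 := h ![0, 1, 1]
  have sA := hA.apply
  have sB := hB.apply
  simp only [intVal, dotProduct, mulVec, Fin.sum_univ_three] at h0 h1 h2 h01 h02 h12
  simp [sA 0 1, sA 0 2, sA 1 2, sB 0 1, sB 0 2, sB 1 2] at h0 h1 h2 h01 h02 h12
  ext i j
  fin_cases i <;> fin_cases j <;> simp [sA 0 1, sA 0 2, sA 1 2, sB 0 1, sB 0 2, sB 1 2] <;> linarith

/-- The Gram matrix of `a x² - b x y + c y²`. -/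
def binMat (a b c : ℚ) : Matrix (Fin 3) (Fin 3) ℚ := !![a, -b / 2, 0; -b / 2, c, 0; 0, 0, 0]

theorem isSymm_binMat (a b c : ℚ) : (binMat a b c).IsSymm := by
  ext i j
  fin_cases i <;> fin_cases j <;> simp [binMat]

theorem intVal_binMat (a b c : ℚ) (x : Fin 3 → ℤ) :
    intVal (binMat a b c) x = a * x 0 ^ 2 - b * x 0 * x 1 + c * x 1 ^ 2 := by
  simp [intVal, dotProduct, mulVec, Fin.sum_univ_three, binMat]
  ring

theorem isSymm_conj {A : Matrix (Fin 3) (Fin 3) ℚ} (hA : A.IsSymm) (w : Matrix (Fin 3) (Fin 3) ℚ) :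
    (w * A * wᵀ).IsSymm := by
  simp [IsSymm, transpose_mul, hA.eq, Matrix.mul_assoc]

theorem cast_single_one (i : Fin 3) :
    (fun j => ((Pi.single i 1 : Fin 3 → ℤ) j : ℚ)) = Pi.single i 1 := by
  ext j
  by_cases h : j = i
  · subst h; simp
  · simp [h]

theorem mulVec_eq_zero_of_intVal_nonneg {H : Matrix (Fin 3) (Fin 3) ℚ} (hH : H.IsSymm)
    (hpos : ∀ x, 0 ≤ intVal H x) {u : Fin 3 → ℤ} (hu : intVal H u = 0) :
    H *ᵥ (fun i => (u i : ℚ)) = 0 := by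
  ext i
  have := eq_zero_of_forall_int_nonneg (a := intVal H (Pi.single i 1))
    (b := 2 * ((fun j => ((Pi.single i 1 : Fin 3 → ℤ) j : ℚ)) ⬝ᵥ (H *ᵥ fun i => (u i : ℚ)))) fun t => by
      have := hpos (Pi.single i 1 + t • u)
      rw [intVal_add_smul hH, hu] at this
      linarith
  rw [cast_single_one, single_one_dotProduct] at this
  simpa using this

/-- Gauss reduction of a positive definite rational binary form. -/
theorem exists_reduced_rat (a b c : ℚ)
    (hpos : ∀ x y : ℤ, (x ≠ 0 ∨ y ≠ 0) → 0 < a * x ^ 2 + b * x * y + c * y ^ 2) :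
    ∃ (p q r s : ℤ) (a' b' c' : ℚ), IsUnit (p * s - q * r) ∧ 0 < a' ∧ 0 ≤ b' ∧ b' ≤ a' ∧ a' ≤ c' ∧
      ∀ x y : ℤ, a * (p * x + q * y) ^ 2 + b * (p * x + q * y) * (r * x + s * y)
        + c * (r * x + s * y) ^ 2 = a' * x ^ 2 - b' * x * y + c' * y ^ 2 := by
  obtain ⟨D, hD, A, hA, B, hB, C, hC⟩ : ∃ D : ℚ, 0 < D ∧ ∃ A : ℤ, D * a = A ∧
      ∃ B : ℤ, D * b = B ∧ ∃ C : ℤ, D * c = C := by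
    refine ⟨a.den * b.den * c.den, by positivity, a.num * b.den * c.den, ?_,
      b.num * a.den * c.den, ?_, c.num * a.den * b.den, ?_⟩
    · push_cast; linear_combination (b.den * c.den : ℚ) * Rat.mul_den_eq_num a
    · push_cast; linear_combination (a.den * c.den : ℚ) * Rat.mul_den_eq_num b
    · push_cast; linear_combination (a.den * b.den : ℚ) * Rat.mul_den_eq_num c
  obtain ⟨p, q, r, s, a', b', c', h1, h2, h3, h4, h5⟩ := exists_reduced_int A B C fun x y h => by
    have := mul_pos hD (hpos x y h)
    have e : D * (a * x ^ 2 + b * x * y + c * y ^ 2) = (A * x ^ 2 + B * x * y + C * y ^ 2 : ℤ) := by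
      push_cast; rw [← hA, ← hB, ← hC]; ring
    rw [e] at this
    exact_mod_cast this
  have key (x y : ℤ) : a * (p * x + q * y) ^ 2 + b * (p * x + q * y) * (r * x + s * y)
        + c * (r * x + s * y) ^ 2 = a' / D * x ^ 2 - b' / D * x * y + c' / D * y ^ 2 := by
    have e := h5 x y
    have e' : (A * (p * x + q * y) ^ 2 + B * (p * x + q * y) * (r * x + s * y)
        + C * (r * x + s * y) ^ 2 : ℚ) = a' * x ^ 2 - b' * x * y + c' * y ^ 2 := by exact_mod_cast e
    rw [← hA, ← hB, ← hC] at e'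
    field_simp
    linear_combination e'
  refine ⟨p, q, r, s, a' / D, b' / D, c' / D, h1, ?_, by positivity, by gcongr, by gcongr, key⟩
  have k := key 1 0
  have := hpos p r (by
    by_contra! h
    simp [h.1, h.2] at h1)
  push_cast at k
  linarith

theorem exists_normal_form {H : Matrix (Fin 3) (Fin 3) ℚ} (hH : H.IsSymm) {l u : Fin 3 → ℤ}
    (hpos : ∀ x, 0 ≤ intVal H x) (hu : intVal H u = 0) (hlu : l ⬝ᵥ u ≠ 0)
    (hker : ∀ x : Fin 3 → ℤ, intVal H x = 0 → l ⬝ᵥ x = 0 → x = 0) :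
    ∃ (W : Matrix (Fin 3) (Fin 3) ℤ) (a b c : ℚ) (n m N : ℤ), IsUnit W.det ∧ 0 < a ∧ 0 ≤ b ∧ b ≤ a ∧
      a ≤ c ∧ 0 < N ∧ W.map ((↑) : ℤ → ℚ) * H * (W.map ((↑) : ℤ → ℚ))ᵀ = binMat a b c ∧
      W *ᵥ l = ![n, m, N] := by
  have hHu := mulVec_eq_zero_of_intVal_nonneg hH hpos hu
  obtain ⟨W, k, hW, hk⟩ := exists_unimodular_row u
  have hk0 : k ≠ 0 := by
    rintro rfl
    apply hlu
    rw [show u = 0 by ext i; simp [hk], dotProduct_zero]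
  have hN0 : (W *ᵥ l) 2 ≠ 0 := by
    intro h
    apply hlu
    rw [show u = k • W 2 by ext i; simp [hk], dotProduct_smul, dotProduct_comm]
    change k * (W *ᵥ l) 2 = 0
    rw [h, mul_zero]
  have hHW : H *ᵥ (fun i => (W 2 i : ℚ)) = 0 := by
    have : (fun i => (u i : ℚ)) = (k : ℚ) • fun i => (W 2 i : ℚ) := by ext i; simp [hk]
    rw [this, mulVec_smul] at hHu
    exact (smul_eq_zero.1 hHu).resolve_left (by exact_mod_cast hk0)
  set G := W.map ((↑) : ℤ → ℚ) * H * (W.map ((↑) : ℤ → ℚ))ᵀ with hG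
  have sG := (isSymm_conj hH (W.map ((↑) : ℤ → ℚ))).apply
  rw [← hG] at sG
  have hG2 (i : Fin 3) : G i 2 = 0 := by
    have : G i 2 = (fun j => (W i j : ℚ)) ⬝ᵥ (H *ᵥ fun i => (W 2 i : ℚ)) := by
      rw [hG, Matrix.mul_assoc]; rfl
    rw [this, hHW, dotProduct_zero]
  have hGval (x y z : ℤ) : intVal G ![x, y, z] = G 0 0 * x ^ 2 + 2 * G 0 1 * x * y + G 1 1 * y ^ 2 := by
    simp [intVal, dotProduct, mulVec, Fin.sum_univ_three, hG2, ← sG 0 1]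
    rw [sG 1 2, sG 0 2, sG 0 1, hG2, hG2]
    ring
  obtain ⟨p, q, r, s, a, b, c, h1, h2, h3, h4, h5, h6⟩ := exists_reduced_rat (G 0 0) (2 * G 0 1) (G 1 1)
    fun x y hxy => by
      have h0 : intVal G ![x, y, 0] = G 0 0 * x ^ 2 + 2 * G 0 1 * x * y + G 1 1 * y ^ 2 := hGval x y 0
      rw [← h0]
      have hnn (v : Fin 3 → ℤ) : 0 ≤ intVal G v := by rw [hG, intVal_conj]; exact hpos _
      refine lt_of_le_of_ne (hnn _) fun h => ?_
      set v : Fin 3 → ℤ := ![(W *ᵥ l) 2 * x, (W *ᵥ l) 2 * y, -((W *ᵥ l) 0 * x + (W *ᵥ l) 1 * y)] with hv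
      have hv0 : v ≠ 0 := by
        intro h
        have e0 := congrFun h 0
        have e1 := congrFun h 1
        simp [hv, hN0] at e0 e1
        tauto
      refine vecMul_ne_zero_of_isUnit hW hv0 (hker _ ?_ ?_)
      · rw [← intVal_conj, ← hG, hv, hGval]
        rw [h0] at h
        push_cast
        linear_combination (-((W *ᵥ l) 2 : ℚ) ^ 2) * h
      · rw [dotProduct_comm, ← dotProduct_mulVec]
        simp [dotProduct, hv, Fin.sum_univ_three]
        ring
  obtain ⟨e, he, heN⟩ : ∃ e : ℤ, IsUnit e ∧ 0 < e * (W *ᵥ l) 2 := by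
    rcases lt_or_gt_of_ne hN0 with h | h
    · exact ⟨-1, isUnit_one.neg, by linarith⟩
    · exact ⟨1, isUnit_one, by linarith⟩
  let W₁ : Matrix (Fin 3) (Fin 3) ℤ := !![p, r, 0; q, s, 0; 0, 0, e]
  refine ⟨W₁ * W, a, b, c, p * (W *ᵥ l) 0 + r * (W *ᵥ l) 1, q * (W *ᵥ l) 0 + s * (W *ᵥ l) 1,
    e * (W *ᵥ l) 2, ?_, h2, h3, h4, h5, heN, ?_, ?_⟩
  · rw [det_mul]
    refine IsUnit.mul ?_ hW
    have : W₁.det = (p * s - q * r) * e := by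
      rw [det_fin_three]; simp [W₁]; ring
    rw [this]
    exact h1.mul he
  · refine eq_of_intVal_eq (isSymm_conj hH _) (isSymm_binMat a b c) fun x => ?_
    rw [intVal_conj, ← vecMul_vecMul, ← intVal_conj, ← hG, intVal_binMat, ← h6]
    have : x ᵥ* W₁ = ![p * x 0 + q * x 1, r * x 0 + s * x 1, e * x 2] := by
      ext i; fin_cases i <;> simp [W₁, vecMul, dotProduct, Fin.sum_univ_three] <;> ring
    rw [this, hGval]
    push_cast
    ring
  · rw [← mulVec_mulVec]
    ext i; fin_cases i <;> simp [W₁, mulVec, dotProduct, Fin.sum_univ_three]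

theorem exists_eq_sqMat {R : Matrix (Fin 3) (Fin 3) ℚ} (hR : R.IsSymm)
    (h : ∀ x, ∃ k : ℤ, intVal R x = k ^ 2) : ∃ l, R = sqMat l := by
  have key (x u : Fin 3 → ℤ) : ((fun i => (x i : ℚ)) ⬝ᵥ (R *ᵥ fun i => (u i : ℚ))) ^ 2
      = intVal R u * intVal R x := by
    refine sq_eq_of_forall_isSquare (fun t => ?_) (h u)
    obtain ⟨k, hk⟩ := h (x + t • u)
    rw [intVal_add_smul hR] at hk
    exact ⟨k, by rw [← hk]; ring⟩
  have hdiag (i : Fin 3) : intVal R (Pi.single i 1) = R i i := by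
    rw [intVal, cast_single_one]; simp
  have hent (i j : Fin 3) : R i j ^ 2 = R j j * R i i := by
    have := key (Pi.single i 1) (Pi.single j 1)
    rw [hdiag, hdiag, cast_single_one, cast_single_one] at this
    simpa using this
  have hpol (i j k : Fin 3) : R i j * R i k = R i i * R j k := by
    have e := key (Pi.single i 1) (Pi.single j 1 + (1 : ℤ) • Pi.single k 1)
    have e1 : (fun a => ((Pi.single j 1 + (1 : ℤ) • Pi.single k 1 : Fin 3 → ℤ) a : ℚ)) =
        Pi.single j 1 + Pi.single k 1 := by
      rw [← cast_single_one, ← cast_single_one]; ext a; simp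
    rw [intVal_add_smul hR, hdiag, hdiag, hdiag, e1, cast_single_one, cast_single_one,
      cast_single_one, mulVec_add] at e
    simp at e
    linear_combination (1 / 2) * e - (1 / 2) * hent i j - (1 / 2) * hent i k
  have hk (i : Fin 3) : ∃ k : ℤ, R i i = k ^ 2 := by rw [← hdiag]; exact h _
  choose k hk using hk
  by_cases hz : ∃ i, k i ≠ 0
  · obtain ⟨i, hi⟩ := hz
    have hl (j : Fin 3) : ∃ l : ℤ, R i j = k i * l := by
      have := hent i j
      rw [hk, hk, ← mul_pow, sq_eq_sq_iff_eq_or_eq_neg] at this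
      rcases this with e | e
      · exact ⟨k j, by rw [e]; ring⟩
      · exact ⟨-k j, by rw [e]; push_cast; ring⟩
    choose l hl using hl
    refine ⟨l, ?_⟩
    ext a b
    have := hpol i a b
    rw [hl, hl, hk] at this
    have hi' : (k i : ℚ) ^ 2 ≠ 0 := by positivity
    rw [sqMat_apply]
    apply mul_left_cancel₀ hi'
    linear_combination -this
  · push Not at hz
    refine ⟨0, ?_⟩
    ext a b
    have := hent a b
    rw [hk, hz] at this
    simpa [sqMat_apply] using this

theorem exists_common_den (q : Fin 3 → ℚ) : ∃ D : ℚ, 0 < D ∧ ∃ l : Fin 3 → ℤ, ∀ i, D * q i = l i := by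
  refine ⟨(q 0).den * (q 1).den * (q 2).den, by positivity,
    ![(q 0).num * (q 1).den * (q 2).den, (q 1).num * (q 0).den * (q 2).den,
      (q 2).num * (q 0).den * (q 1).den], fun i => ?_⟩
  fin_cases i <;> simp
  · linear_combination ((q 1).den * (q 2).den : ℚ) * Rat.mul_den_eq_num (q 0)
  · linear_combination ((q 0).den * (q 2).den : ℚ) * Rat.mul_den_eq_num (q 1)
  · linear_combination ((q 0).den * (q 1).den : ℚ) * Rat.mul_den_eq_num (q 2)

/-- If `det (s P + M)` vanishes to order two at `s = 0` for a definite `P`, then `M` has rank one. -/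
theorem exists_eq_smul_sqMat {P M : Matrix (Fin 3) (Fin 3) ℚ} (hP : P.IsSymm) (hM : M.IsSymm)
    (hpos : ∀ x : Fin 3 → ℚ, x ≠ 0 → 0 < x ⬝ᵥ (P *ᵥ x)) (hM0 : M ≠ 0) {α β : ℚ}
    (h : ∀ s : ℚ, (s • P + M).det = s ^ 2 * (α * s + β)) :
    ∃ r : ℚ, r ≠ 0 ∧ ∃ l : Fin 3 → ℤ, l ≠ 0 ∧ M = r • sqMat l := by
  have sP := hP.apply
  have sM := hM.apply
  have h0 := h 0
  have h1 := h 1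
  have h2 := h (-1)
  have h3 := h 2
  simp only [det_fin_three, Matrix.add_apply, Matrix.smul_apply, smul_eq_mul, sP 0 1, sP 0 2, sP 1 2, sM 0 1, sM 0 2,
    sM 1 2] at h0 h1 h2 h3
  have htr : P 0 0 * (M 1 1 * M 2 2 - M 1 2 ^ 2) + P 1 1 * (M 0 0 * M 2 2 - M 0 2 ^ 2)
      + P 2 2 * (M 0 0 * M 1 1 - M 0 1 ^ 2) + 2 * P 0 1 * (M 0 2 * M 1 2 - M 0 1 * M 2 2)
      + 2 * P 0 2 * (M 0 1 * M 1 2 - M 0 2 * M 1 1) + 2 * P 1 2 * (M 0 1 * M 0 2 - M 1 2 * M 0 0) = 0 := by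
    linear_combination h1 - (1 / 3) * h2 - (1 / 6) * h3 - (1 / 2) * h0
  have hdet : M 0 0 * M 1 1 * M 2 2 + 2 * M 0 1 * M 0 2 * M 1 2 - M 0 0 * M 1 2 ^ 2 - M 1 1 * M 0 2 ^ 2
      - M 2 2 * M 0 1 ^ 2 = 0 := by linear_combination h0
  have hzero (a b c : ℚ) (e : a ^ 2 * P 0 0 + b ^ 2 * P 1 1 + c ^ 2 * P 2 2 + 2 * a * b * P 0 1
      + 2 * a * c * P 0 2 + 2 * b * c * P 1 2 = 0) : a = 0 ∧ b = 0 ∧ c = 0 := by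
    by_contra hne
    refine (hpos ![a, b, c] fun h => hne ?_).ne' ?_
    · exact ⟨congrFun h 0, congrFun h 1, congrFun h 2⟩
    · simp only [dotProduct, mulVec, Fin.sum_univ_three, sP 0 1, sP 0 2, sP 1 2]
      simp
      linear_combination e
  obtain ⟨c00, c01, c02⟩ := hzero (M 1 1 * M 2 2 - M 1 2 ^ 2) (M 0 2 * M 1 2 - M 0 1 * M 2 2)
    (M 0 1 * M 1 2 - M 0 2 * M 1 1) (by
      linear_combination (M 1 1 * M 2 2 - M 1 2 ^ 2) * htr -
        (M 2 2 * P 1 1 + M 1 1 * P 2 2 - 2 * M 1 2 * P 1 2) * hdet)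
  obtain ⟨-, c11, c12⟩ := hzero (M 0 2 * M 1 2 - M 0 1 * M 2 2) (M 0 0 * M 2 2 - M 0 2 ^ 2)
    (M 0 1 * M 0 2 - M 1 2 * M 0 0) (by
      linear_combination (M 0 0 * M 2 2 - M 0 2 ^ 2) * htr -
        (M 2 2 * P 0 0 + M 0 0 * P 2 2 - 2 * M 0 2 * P 0 2) * hdet)
  obtain ⟨-, -, c22⟩ := hzero (M 0 1 * M 1 2 - M 0 2 * M 1 1) (M 0 1 * M 0 2 - M 1 2 * M 0 0)
    (M 0 0 * M 1 1 - M 0 1 ^ 2) (by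
      linear_combination (M 0 0 * M 1 1 - M 0 1 ^ 2) * htr -
        (M 1 1 * P 0 0 + M 0 0 * P 1 1 - 2 * M 0 1 * P 0 1) * hdet)
  have hminor (k i j : Fin 3) : M k k * M i j = M k i * M k j := by
    fin_cases k <;> fin_cases i <;> fin_cases j <;> simp [sM 0 1, sM 0 2, sM 1 2] <;> linarith
  obtain ⟨k, hk⟩ : ∃ k, M k k ≠ 0 := by
    by_contra! hz
    refine hM0 ?_
    ext i j
    have := hminor i j j
    rw [hz, zero_mul] at this
    simpa using this.symm
  obtain ⟨D, hD, l, hl⟩ := exists_common_den (M k)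
  have hD0 := hD.ne'
  refine ⟨1 / (D ^ 2 * M k k), by positivity, l, fun h0 => hk ?_, ?_⟩
  · have := hl k
    simpa [h0, hD0] using this
  · ext i j
    simp only [Matrix.smul_apply, sqMat_apply, smul_eq_mul, ← hl]
    field_simp
    linear_combination hminor k i j

/-- Splitting off from a definite form the direction orthogonal to the kernel of `l`. -/
theorem exists_semidefinite_sub_sqMat {P : Matrix (Fin 3) (Fin 3) ℚ} (hP : P.IsSymm)
    (hpos : ∀ x : Fin 3 → ℚ, x ≠ 0 → 0 < x ⬝ᵥ (P *ᵥ x)) {l : Fin 3 → ℤ} (hl : l ≠ 0) :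
    ∃ (t : ℚ) (u : Fin 3 → ℤ), (∀ x, 0 ≤ intVal (P - t • sqMat l) x) ∧ intVal (P - t • sqMat l) u = 0 ∧
      l ⬝ᵥ u ≠ 0 ∧ ∀ x : Fin 3 → ℤ, intVal (P - t • sqMat l) x = 0 → l ⬝ᵥ x = 0 → x = 0 := by
  have hcast {x : Fin 3 → ℤ} (hx : x ≠ 0) : (fun i => (x i : ℚ)) ≠ 0 := fun h => hx <| by
    ext i; simpa using congrFun h i
  have hpos' (x : Fin 3 → ℤ) : 0 ≤ intVal P x := by
    by_cases hx : x = 0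
    · subst hx; simp [intVal]
    · exact (hpos _ (hcast hx)).le
  have hdet : P.det ≠ 0 := fun h => by
    obtain ⟨v, hv, h⟩ := exists_mulVec_eq_zero_iff.2 h
    simpa [h] using hpos v hv
  obtain ⟨D, hD, u, hu⟩ := exists_common_den (P.adjugate *ᵥ fun i => (l i : ℚ))
  have hPu : P *ᵥ (fun i => (u i : ℚ)) = (D * P.det) • fun i => (l i : ℚ) := by
    have : (fun i => (u i : ℚ)) = D • (P.adjugate *ᵥ fun i => (l i : ℚ)) := by ext i; simp [← hu]
    rw [this, mulVec_smul, mulVec_mulVec, mul_adjugate, smul_mulVec, one_mulVec, smul_smul]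
  have hu0 : u ≠ 0 := by
    rintro rfl
    have : (D * P.det) • (fun i => (l i : ℚ)) = 0 := by rw [← hPu]; ext i; simp [mulVec, dotProduct]
    exact (smul_ne_zero (mul_ne_zero hD.ne' hdet) (hcast hl)) this
  have hbil (x : Fin 3 → ℤ) : (fun i => (x i : ℚ)) ⬝ᵥ (P *ᵥ fun i => (u i : ℚ)) =
      D * P.det * (l ⬝ᵥ x : ℤ) := by
    rw [hPu]; simp [dotProduct, Fin.sum_univ_three]; ring
  have hPuu : intVal P u = D * P.det * (l ⬝ᵥ u : ℤ) := hbil u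
  have hlu : l ⬝ᵥ u ≠ 0 := fun h => by
    have := hpos _ (hcast hu0)
    change 0 < intVal P u at this
    rw [hPuu, h] at this
    simp at this
  have hlu' : ((l ⬝ᵥ u : ℤ) : ℚ) ≠ 0 := by exact_mod_cast hlu
  have hval (x : Fin 3 → ℤ) : intVal (P - (D * P.det / (l ⬝ᵥ u : ℤ)) • sqMat l) x =
      intVal P x - D * P.det / (l ⬝ᵥ u : ℤ) * ((l ⬝ᵥ x : ℤ) : ℚ) ^ 2 := by
    rw [sub_eq_add_neg, ← neg_smul, intVal_add, intVal_smul, intVal_sqMat]; ring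
  refine ⟨D * P.det / (l ⬝ᵥ u : ℤ), u, fun x => ?_, ?_, hlu, fun x hx hlx => ?_⟩
  · rw [hval]
    have e := hpos' ((l ⬝ᵥ u) • x + (-(l ⬝ᵥ x)) • u)
    have e2 : intVal P ((l ⬝ᵥ u) • x) = ((l ⬝ᵥ u : ℤ) : ℚ) ^ 2 * intVal P x := by
      have := intVal_add_smul hP 0 x (l ⬝ᵥ u)
      simpa [intVal] using this
    rw [intVal_add_smul hP, hbil, e2, hPuu, dotProduct_smul] at e
    push_cast at e
    have e3 : 0 ≤ ((l ⬝ᵥ u : ℤ) : ℚ) ^ 2 * (intVal P x - D * P.det / (l ⬝ᵥ u : ℤ) * ((l ⬝ᵥ x : ℤ) : ℚ) ^ 2) := by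
      refine e.trans_eq ?_
      field_simp
      simp
      ring
    exact nonneg_of_mul_nonneg_right e3 (by positivity)
  · rw [hval, hPuu]; field_simp; ring
  · by_contra h
    rw [hval, hlx] at hx
    have := hpos _ (hcast h)
    change 0 < intVal P x at this
    simp at hx
    linarith

theorem exists_pair_normal_form {A B : Matrix (Fin 3) (Fin 3) ℚ} (hA : A.IsSymm) (hB : B.IsSymm)
    (hli : ∀ a b : ℚ, a • A + b • B = 0 → a = 0 ∧ b = 0)
    (hpd : ∃ c d : ℚ, ((c • A + d • B).map ((↑) : ℚ → ℝ)).PosDef)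
    (hdisc : ∃ l l' : AlgebraicClosure ℚ × AlgebraicClosure ℚ,
      ∀ x y : AlgebraicClosure ℚ,
        4 * (x • A.map (algebraMap ℚ (AlgebraicClosure ℚ))
            - y • B.map (algebraMap ℚ (AlgebraicClosure ℚ))).det
          = (l.1 * x - l.2 * y) ^ 2 * (l'.1 * x - l'.2 * y)) :
    ∃ (W : Matrix (Fin 3) (Fin 3) ℤ) (v : Matrix (Fin 2) (Fin 2) ℚ) (b c : ℚ) (n m N : ℤ),
      IsUnit W.det ∧ IsUnit v.det ∧ 0 ≤ b ∧ b ≤ 1 ∧ 1 ≤ c ∧ 0 < N ∧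
      pairAct (W.map ((↑) : ℤ → ℚ)) v A B = (binMat 1 b c, sqMat ![n, m, N]) := by
  obtain ⟨c, d, hpd⟩ := hpd
  obtain ⟨⟨l₁, l₂⟩, ⟨l₁', l₂'⟩, hdisc⟩ := hdisc
  obtain ⟨P, hP⟩ : ∃ P, P = c • A + d • B := ⟨_, rfl⟩
  obtain ⟨Q, hQ⟩ : ∃ Q, Q = (-d) • A + c • B := ⟨_, rfl⟩
  rw [← hP] at hpd
  have hpos (x : Fin 3 → ℚ) (hx : x ≠ 0) : 0 < x ⬝ᵥ (P *ᵥ x) := by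
    have h0 : (fun i => (x i : ℝ)) ≠ 0 := fun h => hx <| by
      ext i; simpa using congrFun h i
    have := hpd.dotProduct_mulVec_pos h0
    have e : star (fun i => (x i : ℝ)) ⬝ᵥ (P.map ((↑) : ℚ → ℝ) *ᵥ fun i => (x i : ℝ)) =
        ((x ⬝ᵥ (P *ᵥ x) : ℚ) : ℝ) := by
      simp [dotProduct, mulVec]
    rw [e] at this
    exact_mod_cast this
  have hdetP : P.det ≠ 0 := fun h => by
    obtain ⟨v, hv, h⟩ := exists_mulVec_eq_zero_iff.2 h
    simpa [h] using hpos v hv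
  have sP : P.IsSymm := by rw [hP]; exact (hA.smul c).add (hB.smul d)
  have sQ : Q.IsSymm := by rw [hQ]; exact (hA.smul (-d)).add (hB.smul c)
  have hcd : c ^ 2 + d ^ 2 ≠ 0 := fun h => by
    have hc : c = 0 := by nlinarith [sq_nonneg c, sq_nonneg d]
    have hd : d = 0 := by nlinarith [sq_nonneg c, sq_nonneg d]
    simp [hP, hc, hd] at hdetP
  have hcubic (t : ℚ) : (t • P - Q).det = P.det * t ^ 3 +
      (((P - Q).det + (-P - Q).det) / 2 + Q.det) * t ^ 2 +
      (((P - Q).det - (-P - Q).det) / 2 - P.det) * t + -Q.det := by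
    simp only [det_fin_three, Matrix.sub_apply, Matrix.smul_apply, Matrix.neg_apply, smul_eq_mul]
    ring
  obtain ⟨x, y, hxy⟩ := exists_rat_double_root (K := AlgebraicClosure ℚ) hdetP
    (p := l₁ * c + l₂ * d) (q := l₁ * d - l₂ * c) (p' := (l₁' * c + l₂' * d) / 4)
    (q' := (l₁' * d - l₂' * c) / 4) fun t => by
      rw [← hcubic]
      have e := hdisc (t * c + d) (c - t * d)
      have e2 : (((t • P - Q).det : ℚ) : AlgebraicClosure ℚ) =
          (((t * c + d : AlgebraicClosure ℚ)) • A.map (algebraMap ℚ (AlgebraicClosure ℚ))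
            - (c - t * d : AlgebraicClosure ℚ) • B.map (algebraMap ℚ (AlgebraicClosure ℚ))).det := by
        rw [hP, hQ]
        simp only [det_fin_three, Matrix.sub_apply, Matrix.add_apply, Matrix.smul_apply, map_apply,
          smul_eq_mul, eq_ratCast]
        push_cast
        ring
      rw [e2]
      linear_combination (1 / 4) * e
  have hM : x • P - Q = (x * c + d) • A + (x * d - c) • B := by
    rw [hP, hQ]; ext i j; simp; ring
  have hM0 : x • P - Q ≠ 0 := fun h => hcd <| by
    rw [hM] at h
    obtain ⟨h1, h2⟩ := hli _ _ h
    linear_combination d * h1 - c * h2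
  obtain ⟨r, hr, l, hl, hrl⟩ := exists_eq_smul_sqMat sP ((sP.smul x).sub sQ) hpos hM0
    (α := P.det) (β := P.det * (x - y)) fun s => by
      rw [show s • P + (x • P - Q) = (s + x) • P - Q by rw [add_smul]; abel, hcubic, hxy]; ring
  obtain ⟨t, u, h1, h2, h3, h4⟩ := exists_semidefinite_sub_sqMat sP hpos hl
  obtain ⟨W, a, b, c', n, m, N, hW, ha, hb, hba, hac, hN, hH, hWl⟩ :=
    exists_normal_form (sP.sub ((isSymm_sqMat l).smul t)) h1 h2 h3 h4
  have hL : sqMat l = (r⁻¹ * (x * c + d)) • A + (r⁻¹ * (x * d - c)) • B := by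
    rw [mul_smul, mul_smul, ← smul_add, ← hM, hrl, smul_smul, inv_mul_cancel₀ hr, one_smul]
  refine ⟨W, !![a⁻¹ * (c - t * (r⁻¹ * (x * c + d))), a⁻¹ * (d - t * (r⁻¹ * (x * d - c)));
    r⁻¹ * (x * c + d), r⁻¹ * (x * d - c)], b / a, c' / a, n, m, N, hW, ?_, by positivity,
    (div_le_one ha).2 hba, (one_le_div ha).2 hac, hN, Prod.ext ?_ ?_⟩
  · rw [det_fin_two_of, isUnit_iff_ne_zero]
    have e : a⁻¹ * (c - t * (r⁻¹ * (x * c + d))) * (r⁻¹ * (x * d - c)) -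
        a⁻¹ * (d - t * (r⁻¹ * (x * d - c))) * (r⁻¹ * (x * c + d)) =
        -(a⁻¹ * r⁻¹ * (c ^ 2 + d ^ 2)) := by ring
    rw [e]
    exact neg_ne_zero.2 (mul_ne_zero (mul_ne_zero (inv_ne_zero ha.ne') (inv_ne_zero hr)) hcd)
  · have e : binMat 1 (b / a) (c' / a) = a⁻¹ • binMat a b c' := by
      ext i j
      fin_cases i <;> fin_cases j <;> simp [binMat] <;> field_simp
    rw [e, ← hH, hL, hP]
    ext i j
    simp [pairAct, Matrix.mul_add, Matrix.add_mul, Matrix.mul_sub, Matrix.sub_mul]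
    ring
  · rw [← hWl, ← conj_sqMat, hL]
    simp [pairAct, Matrix.mul_add, Matrix.add_mul]

theorem binary_min_le {a b c : ℚ} (hb : 0 ≤ b) (hba : b ≤ a) (hac : a ≤ c) {x y : ℤ}
    (h : x ≠ 0 ∨ y ≠ 0) : a ≤ a * x ^ 2 - b * x * y + c * y ^ 2 := by
  have ha := hb.trans hba
  have key (z : ℤ) (hz : z = x * y ∨ z = 0) (hz' : x * y ≤ z) : (1 : ℚ) ≤ x ^ 2 - z + y ^ 2 := by
    have : 1 ≤ x ^ 2 - z + y ^ 2 := by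
      by_contra! hlt
      have h0 : x ^ 2 + y ^ 2 ≤ 0 := by
        rcases hz with rfl | rfl
        · nlinarith [sq_nonneg (x - y)]
        · linarith
      have hx : x = 0 := by nlinarith [sq_nonneg x, sq_nonneg y]
      have hy : y = 0 := by nlinarith [sq_nonneg x, sq_nonneg y]
      tauto
    exact_mod_cast this
  have hy2 : a * (y : ℚ) ^ 2 ≤ c * y ^ 2 := by gcongr
  rcases le_total (x * y) 0 with hxy | hxy
  · have h1 := mul_le_mul_of_nonneg_left (key 0 (Or.inr rfl) hxy) ha
    have h2 : (x * y : ℚ) ≤ 0 := by exact_mod_cast hxy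
    push_cast at h1
    nlinarith [mul_nonneg hb (neg_nonneg.2 h2)]
  · have h1 := mul_le_mul_of_nonneg_left (key _ (Or.inl rfl) le_rfl) ha
    have h2 : (0 : ℚ) ≤ x * y := by exact_mod_cast hxy
    push_cast at h1
    nlinarith [mul_nonneg (sub_nonneg.2 hba) h2]

theorem intVal_mem_simRepZ (A B : Matrix (Fin 3) (Fin 3) ℚ) {x : Fin 3 → ℤ} (hx : x ≠ 0) :
    (intVal A x, intVal B x) ∈ simRepZ A B := ⟨x, hx, rfl, rfl⟩

theorem dotProduct_vec3 (n m N : ℤ) (x : Fin 3 → ℤ) :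
    ![n, m, N] ⬝ᵥ x = n * x 0 + m * x 1 + N * x 2 := by
  simp [dotProduct, Fin.sum_univ_three]

/-- The first minimum of the binary form and the coefficient of `x₃` are determined by the
simultaneous representations. -/
theorem le_and_dvd_of_simRepZ_subset {a b c a' b' c' : ℚ} {n m N n' m' N' : ℤ} (hb : 0 ≤ b)
    (hba : b ≤ a) (hac : a ≤ c) (ha' : 0 < a') (ha : 0 < a)
    (h : simRepZ (binMat a' b' c') (sqMat ![n', m', N']) ⊆ simRepZ (binMat a b c) (sqMat ![n, m, N])) :
    a ≤ a' ∧ N ∣ N' := by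
  have hb0 {x y : ℤ} (h : a * x ^ 2 - b * x * y + c * y ^ 2 ≤ 0) : x = 0 ∧ y = 0 := by
    by_contra hne
    have := binary_min_le hb hba hac (x := x) (y := y) (by tauto)
    linarith
  constructor
  · obtain ⟨x, hx, h1, -⟩ := mem_simRepZ.1 (h (intVal_mem_simRepZ _ _ (x := ![1, 0, 0]) (by simp)))
    simp only [intVal_binMat] at h1
    simp at h1
    rw [← h1]
    refine binary_min_le hb hba hac ?_
    by_contra! h0
    simp [h0.1, h0.2] at h1
    linarith
  · obtain ⟨x, hx, h1, h2⟩ := mem_simRepZ.1 (h (intVal_mem_simRepZ _ _ (x := ![0, 0, 1]) (by simp)))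
    simp only [intVal_binMat, intVal_sqMat, dotProduct_vec3] at h1 h2
    simp at h1
    obtain ⟨h3, h4⟩ := hb0 h1.le
    rw [h3, h4] at h2
    simp at h2
    have h5 : (N * x 2) ^ 2 = N' ^ 2 := by exact_mod_cast h2
    rcases sq_eq_sq_iff_eq_or_eq_neg.1 h5 with h6 | h6
    · exact ⟨x 2, h6.symm⟩
    · exact ⟨-x 2, by linarith⟩

theorem exists_partner_normal_form {b c : ℚ} {n m N : ℤ} (hb : 0 ≤ b) (hb1 : b ≤ 1) (hc : 1 ≤ c)
    (hN : 0 < N) {H R : Matrix (Fin 3) (Fin 3) ℚ} (hH : H.IsSymm) (hR : R.IsSymm)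
    (hrep : simRepZ (binMat 1 b c) (sqMat ![n, m, N]) = simRepZ H R) :
    ∃ (W : Matrix (Fin 3) (Fin 3) ℤ) (b' c' : ℚ) (n' m' : ℤ), IsUnit W.det ∧ 0 ≤ b' ∧ b' ≤ 1 ∧
      1 ≤ c' ∧ pairAct (W.map ((↑) : ℤ → ℚ)) 1 H R = (binMat 1 b' c', sqMat ![n', m', N]) := by
  have hbwd (x : Fin 3 → ℤ) (hx : x ≠ 0) : ∃ y, y ≠ 0 ∧ intVal (binMat 1 b c) y = intVal H x ∧
      intVal (sqMat ![n, m, N]) y = intVal R x :=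
    mem_simRepZ.1 (hrep.ge (intVal_mem_simRepZ H R hx))
  have hb0 {x y : ℤ} (h : x ≠ 0 ∨ y ≠ 0) : 1 ≤ 1 * (x : ℚ) ^ 2 - b * x * y + c * y ^ 2 :=
    binary_min_le hb hb1 hc h
  obtain ⟨l, rfl⟩ := exists_eq_sqMat hR fun x => by
    by_cases hx : x = 0
    · exact ⟨0, by simp [hx, intVal]⟩
    · obtain ⟨y, -, -, h2⟩ := hbwd x hx
      exact ⟨_, by rw [← h2, intVal_sqMat]⟩
  obtain ⟨u, -, hu1, hu2⟩ := mem_simRepZ.1 (hrep.le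
    (intVal_mem_simRepZ (binMat 1 b c) (sqMat ![n, m, N]) (x := ![0, 0, 1]) (by simp)))
  simp only [intVal_binMat, intVal_sqMat, dotProduct_vec3] at hu1 hu2
  simp at hu1
  obtain ⟨W, a, b', c', n', m', N', hW, ha, hb', hba, hac, hN', hWH, hWl⟩ :=
    exists_normal_form (l := l) hH (fun x => by
      by_cases hx : x = 0
      · simp [hx, intVal]
      · obtain ⟨y, -, h1, -⟩ := hbwd x hx
        rw [← h1, intVal_binMat]
        by_cases h : y 0 ≠ 0 ∨ y 1 ≠ 0
        · linarith [hb0 h]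
        · push Not at h
          simp [h.1, h.2]) hu1
      (fun h => by
        rw [h] at hu2
        exact hN.ne' (by simpa using hu2.symm))
      fun x h1 h2 => by
        by_contra hx
        obtain ⟨y, hy, h3, h4⟩ := hbwd x hx
        rw [h1, intVal_binMat] at h3
        rw [intVal_sqMat, intVal_sqMat, h2, dotProduct_vec3] at h4
        have h5 : y 0 = 0 ∧ y 1 = 0 := by
          by_contra hne
          have := hb0 (x := y 0) (y := y 1) (by tauto)
          linarith
        rw [h5.1, h5.2] at h4
        simp [hN.ne'] at h4
        exact hy (by ext i; fin_cases i <;> simp [h5, h4])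
  have hact : pairAct (W.map ((↑) : ℤ → ℚ)) 1 H (sqMat l) = (binMat a b' c', sqMat ![n', m', N']) := by
    simp [pairAct, hWH, conj_sqMat, hWl]
  have hrep' : simRepZ (binMat 1 b c) (sqMat ![n, m, N]) = simRepZ (binMat a b' c') (sqMat ![n', m', N']) := by
    have := simRepZ_pairAct hW 1 H (sqMat l)
    rw [hact] at this
    rw [this, hrep]
    simp
  obtain ⟨h1, h2⟩ := le_and_dvd_of_simRepZ_subset hb hb1 hc ha one_pos hrep'.ge
  obtain ⟨h3, h4⟩ := le_and_dvd_of_simRepZ_subset hb' hba hac one_pos ha hrep'.le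
  obtain rfl : a = 1 := le_antisymm h3 h1
  obtain rfl : N' = N := Int.dvd_antisymm hN'.le hN.le h4 h2
  exact ⟨W, b', c', n', m', hW, hb', hba, hac, hact⟩

theorem colLe_of_simRepZ_subset {b c b' c' : ℚ} {n m n' m' : ℤ} {N : ℕ}
    (h : simRepZ (binMat 1 b c) (sqMat ![n, m, N]) ⊆ simRepZ (binMat 1 b' c') (sqMat ![n', m', N])) :
    ColLe b c (n : ZMod N) (m : ZMod N) b' c' (n' : ZMod N) (m' : ZMod N) := fun x y => by
  by_cases hxy : x = 0 ∧ y = 0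
  · exact ⟨0, 0, by simp [hxy, binForm], by simp [hxy]⟩
  · obtain ⟨z, -, h1, h2⟩ := mem_simRepZ.1 (h (intVal_mem_simRepZ _ _ (x := ![x, y, 0]) (by simpa using hxy)))
    simp only [intVal_binMat, intVal_sqMat, dotProduct_vec3] at h1 h2
    refine ⟨z 0, z 1, ?_, ?_⟩
    · simpa [binForm] using h1
    · have h3 : (n' * z 0 + m' * z 1 + N * z 2) ^ 2 = (n * x + m * y) ^ 2 := by
        simp at h2
        exact_mod_cast h2
      rcases sq_eq_sq_iff_eq_or_eq_neg.1 h3 with h4 | h4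
      · have := congrArg (Int.cast : ℤ → ZMod N) h4
        push_cast at this
        rw [CharP.cast_eq_zero] at this
        left; linear_combination -this
      · have := congrArg (Int.cast : ℤ → ZMod N) h4
        push_cast at this
        rw [CharP.cast_eq_zero] at this
        right; linear_combination this

theorem exists_pairAct_of_colIso {b c : ℚ} {n m n' m' : ℤ} {N : ℕ}
    (h : ColIso b c (n : ZMod N) (m : ZMod N) (n' : ZMod N) (m' : ZMod N)) :
    ∃ w : Matrix (Fin 3) (Fin 3) ℤ, IsUnit w.det ∧
      (binMat 1 b c, sqMat ![n', m', N]) =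
        pairAct (w.map ((↑) : ℤ → ℚ)) 1 (binMat 1 b c) (sqMat ![n, m, N]) := by
  obtain ⟨p, q, r, s, hu, hf, hcol⟩ := h
  obtain ⟨e, he, h1, h2⟩ : ∃ e : ℤ, IsUnit e ∧ (N : ℤ) ∣ e * n' - (n * p + m * r) ∧
      (N : ℤ) ∣ e * m' - (n * q + m * s) := by
    rcases hcol with ⟨h1, h2⟩ | ⟨h1, h2⟩
    · refine ⟨1, isUnit_one, ?_, ?_⟩ <;> rw [← ZMod.intCast_zmod_eq_zero_iff_dvd] <;> push_cast
      · linear_combination h1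
      · linear_combination h2
    · refine ⟨-1, isUnit_one.neg, ?_, ?_⟩ <;> rw [← ZMod.intCast_zmod_eq_zero_iff_dvd] <;> push_cast
      · linear_combination -h1
      · linear_combination -h2
  obtain ⟨j, hj⟩ := h1
  obtain ⟨k, hk⟩ := h2
  have he2 : (e * e : ℚ) = 1 := by exact_mod_cast Int.isUnit_mul_self he
  let w : Matrix (Fin 3) (Fin 3) ℤ := !![p, r, j; q, s, k; 0, 0, e]
  have hl : w *ᵥ ![n, m, N] = e • ![n', m', (N : ℤ)] := by
    ext i
    fin_cases i <;> simp [w, mulVec, dotProduct, Fin.sum_univ_three] <;> linarith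
  refine ⟨w, ?_, Prod.ext ?_ ?_⟩
  · have : w.det = (p * s - q * r) * e := by
      rw [det_fin_three]; simp [w]; ring
    rw [this]
    exact hu.mul he
  · simp only [pairAct, one_apply_eq, one_smul, one_apply_ne (zero_ne_one (α := Fin 2)), zero_smul, add_zero]
    refine eq_of_intVal_eq (isSymm_binMat 1 b c) (isSymm_conj (isSymm_binMat 1 b c) _) fun x => ?_
    have hx : x ᵥ* w = ![p * x 0 + q * x 1, r * x 0 + s * x 1, j * x 0 + k * x 1 + e * x 2] := by
      ext i; fin_cases i <;> simp [w, vecMul, dotProduct, Fin.sum_univ_three] <;> ring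
    have := hf (x 0) (x 1)
    rw [intVal_conj, hx, intVal_binMat, intVal_binMat]
    simp only [binForm] at this
    simp
    push_cast at this
    linarith
  · simp only [pairAct, one_apply_eq, one_smul, one_apply_ne (one_ne_zero (α := Fin 2)), zero_smul,
      zero_add, conj_sqMat, hl]
    ext i j
    simp only [sqMat_apply, Pi.smul_apply, smul_eq_mul]
    push_cast
    linear_combination (-(![n', m', (N : ℤ)] i : ℚ) * ![n', m', (N : ℤ)] j) * he2

theorem pairAct_upper {p s : ℤ} (j k M : ℤ) {b : ℚ} (c : ℚ) (l : Fin 3 → ℤ) (hp : IsUnit p)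
    (hs : IsUnit s) (hb : b * p * s = b) :
    pairAct ((!![p, 0, j; 0, s, k; 0, 0, 1] : Matrix (Fin 3) (Fin 3) ℤ).map ((↑) : ℤ → ℚ))
      !![1, 0; 0, (M : ℚ) ^ 2] (binMat 1 b c) (sqMat l) =
      (binMat 1 b c, sqMat ![M * (p * l 0 + j * l 2), M * (s * l 1 + k * l 2), M * l 2]) := by
  have hp2 : (p * p : ℚ) = 1 := by exact_mod_cast Int.isUnit_mul_self hp
  have hs2 : (s * s : ℚ) = 1 := by exact_mod_cast Int.isUnit_mul_self hs
  refine Prod.ext ?_ ?_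
  · ext x y
    fin_cases x <;> fin_cases y <;> simp [pairAct, binMat, mul_apply, Fin.sum_univ_three]
    · exact hp2
    · linear_combination (-1 / 2) * hb
    · linear_combination (-1 / 2) * hb
    · linear_combination c * hs2
  · have e : (!![p, 0, j; 0, s, k; 0, 0, 1] : Matrix (Fin 3) (Fin 3) ℤ) *ᵥ l =
        ![p * l 0 + j * l 2, s * l 1 + k * l 2, l 2] := by
      ext i; fin_cases i <;> simp [mulVec, dotProduct, Fin.sum_univ_three]
    simp only [pairAct, conj_sqMat, e]
    ext x y
    fin_cases x <;> fin_cases y <;> simp [sqMat_apply] <;> ring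

theorem formHex_eq : formHex = binMat 1 1 1 := by simp [formHex, binMat]

theorem formE_eq : formE = binMat 1 0 3 := by simp [formE, binMat]

theorem formZ_eq : formZ = sqMat ![0, 0, 1] := by
  ext i j; fin_cases i <;> fin_cases j <;> simp [formZ, sqMat_apply]

theorem formR_eq : formR = sqMat ![1, 1, 3] := by
  ext i j; fin_cases i <;> fin_cases j <;> norm_num [formR, sqMat_apply]

theorem formR'_eq : formR' = sqMat ![1, 0, 3] := by
  ext i j; fin_cases i <;> fin_cases j <;> norm_num [formR', sqMat_apply]

theorem exists_pairAct_hex {n m n' m' : ℤ} {N : ℕ} (hN : 0 < N) (h3 : 3 * (n : ZMod N) = 0)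
    (hm : (m : ZMod N) = n) (hn' : (n' : ZMod N) = n ∨ (n' : ZMod N) = -n) (hm' : (m' : ZMod N) = 0) :
    ∃ (w₁ w₂ : Matrix (Fin 3) (Fin 3) ℤ) (t : ℚ), IsUnit w₁.det ∧ IsUnit w₂.det ∧ t ≠ 0 ∧
      (((binMat 1 1 1, sqMat ![n, m, N]) = pairAct (w₁.map ((↑) : ℤ → ℚ)) !![1, 0; 0, t] formHex formZ ∧
        (binMat 1 0 3, sqMat ![n', m', N]) = pairAct (w₂.map ((↑) : ℤ → ℚ)) !![1, 0; 0, t] formE formZ) ∨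
      ((binMat 1 1 1, sqMat ![n, m, N]) = pairAct (w₁.map ((↑) : ℤ → ℚ)) !![1, 0; 0, t] formHex formR ∧
        (binMat 1 0 3, sqMat ![n', m', N]) = pairAct (w₂.map ((↑) : ℤ → ℚ)) !![1, 0; 0, t] formE formR')) := by
  have hunit {e₁ e₂ j k : ℤ} (h₁ : IsUnit e₁) (h₂ : IsUnit e₂) :
      IsUnit (!![e₁, 0, j; 0, e₂, k; 0, 0, 1] : Matrix (Fin 3) (Fin 3) ℤ).det := by
    have : (!![e₁, 0, j; 0, e₂, k; 0, 0, 1] : Matrix (Fin 3) (Fin 3) ℤ).det = e₁ * e₂ := by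
      rw [det_fin_three]; simp
    rw [this]
    exact h₁.mul h₂
  have hN0 : (N : ℚ) ≠ 0 := by exact_mod_cast hN.ne'
  obtain ⟨j₂, hj₂⟩ : (N : ℤ) ∣ m - n := by
    rw [← ZMod.intCast_zmod_eq_zero_iff_dvd]; push_cast; rw [hm, sub_self]
  obtain ⟨e, he, j', hj'⟩ : ∃ e : ℤ, IsUnit e ∧ (N : ℤ) ∣ n' - e * n := by
    rcases hn' with h | h
    · exact ⟨1, isUnit_one, by rw [← ZMod.intCast_zmod_eq_zero_iff_dvd]; push_cast; rw [h]; ring⟩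
    · exact ⟨-1, isUnit_one.neg, by rw [← ZMod.intCast_zmod_eq_zero_iff_dvd]; push_cast; rw [h]; ring⟩
  obtain ⟨j₂', rfl⟩ : (N : ℤ) ∣ m' := by rwa [← ZMod.intCast_zmod_eq_zero_iff_dvd]
  obtain ⟨k, hk⟩ : (N : ℤ) ∣ 3 * n := by
    rw [← ZMod.intCast_zmod_eq_zero_iff_dvd]; push_cast; exact h3
  obtain rfl : m = n + N * j₂ := by linarith
  obtain rfl : n' = e * n + N * j' := by linarith
  obtain ⟨j, hj⟩ | ⟨f, j, hf, hkf⟩ : (∃ j, k = 3 * j) ∨ ∃ f j : ℤ, IsUnit f ∧ k = f + 3 * j := by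
    have : k % 3 = 0 ∨ k % 3 = 1 ∨ k % 3 = 2 := by omega
    rcases this with h | h | h
    · exact Or.inl ⟨k / 3, by omega⟩
    · exact Or.inr ⟨1, k / 3, isUnit_one, by omega⟩
    · exact Or.inr ⟨-1, k / 3 + 1, isUnit_one.neg, by omega⟩
  · obtain rfl : n = N * j := by
      rw [hj] at hk; linarith
    refine ⟨!![1, 0, j; 0, 1, j + j₂; 0, 0, 1], !![1, 0, e * j + j'; 0, 1, j₂'; 0, 0, 1], (N : ℤ) ^ 2,
      hunit isUnit_one isUnit_one, hunit isUnit_one isUnit_one, by positivity, Or.inl ⟨?_, ?_⟩⟩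
    · rw [formHex_eq, formZ_eq, pairAct_upper _ _ _ _ _ isUnit_one isUnit_one (by simp)]
      simp [mul_add]
    · rw [formE_eq, formZ_eq, pairAct_upper _ _ _ _ _ isUnit_one isUnit_one (by simp)]
      simp [mul_add, mul_left_comm]
  · obtain ⟨M, hM⟩ : (3 : ℤ) ∣ N := by
      have h3f : IsCoprime (3 : ℤ) k := ⟨-j * f, f, by
        rw [hkf]; linear_combination Int.isUnit_mul_self hf⟩
      exact h3f.dvd_of_dvd_mul_right ⟨n, hk.symm⟩
    have hM0 : (M : ℚ) ≠ 0 := fun h => hN0 <| by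
      have : (N : ℚ) = 3 * M := by exact_mod_cast hM
      rw [this, h, mul_zero]
    rw [hM] at hk ⊢
    obtain rfl : n = M * (f + 3 * j) := by rw [← hkf]; linarith
    refine ⟨!![f, 0, j; 0, f, j + j₂; 0, 0, 1], !![e * f, 0, e * j + j'; 0, 1, j₂'; 0, 0, 1], M ^ 2,
      hunit hf hf, hunit (he.mul hf) isUnit_one, by positivity, Or.inr ⟨?_, ?_⟩⟩
    · have hf2 : (f * f : ℚ) = 1 := by exact_mod_cast Int.isUnit_mul_self hf
      rw [formHex_eq, formR_eq, pairAct_upper _ _ _ _ _ hf hf (by rw [one_mul, hf2])]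
      congr 2
      ext i; fin_cases i <;> simp [-mul_eq_mul_left_iff] <;> ring
    · rw [formE_eq, formR'_eq, pairAct_upper _ _ _ _ _ (he.mul hf) isUnit_one (by simp)]
      congr 2
      ext i; fin_cases i <;> simp <;> ring

theorem pairAct_mul_map (w w' : Matrix (Fin 3) (Fin 3) ℤ) (v v' : Matrix (Fin 2) (Fin 2) ℚ)
    (A B : Matrix (Fin 3) (Fin 3) ℚ) :
    pairAct ((w * w').map ((↑) : ℤ → ℚ)) (v * v') A B =
      pairAct (w.map ((↑) : ℤ → ℚ)) v (pairAct (w'.map ((↑) : ℤ → ℚ)) v' A B).1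
        (pairAct (w'.map ((↑) : ℤ → ℚ)) v' A B).2 := by
  rw [pairAct_pairAct]
  congr 1
  exact Matrix.map_mul (f := Int.castRingHom ℚ)

theorem eq_pairAct_inv {w : Matrix (Fin 3) (Fin 3) ℤ} (hw : IsUnit w.det)
    {v : Matrix (Fin 2) (Fin 2) ℚ} (hv : IsUnit v.det) {A B X Y : Matrix (Fin 3) (Fin 3) ℚ}
    (h : pairAct (w.map ((↑) : ℤ → ℚ)) v A B = (X, Y)) :
    (A, B) = pairAct (w⁻¹.map ((↑) : ℤ → ℚ)) v⁻¹ X Y := by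
  have := pairAct_mul_map w⁻¹ w v⁻¹ v A B
  rw [h, nonsing_inv_mul _ hw, nonsing_inv_mul _ hv, Matrix.map_one _ Int.cast_zero Int.cast_one,
    pairAct_one_one] at this
  exact this

theorem eq_pairAct_of_eq {w w' : Matrix (Fin 3) (Fin 3) ℤ} (hw : IsUnit w.det)
    {v v' : Matrix (Fin 2) (Fin 2) ℚ} (hv : IsUnit v.det) {A B A' B' : Matrix (Fin 3) (Fin 3) ℚ}
    (h : pairAct (w.map ((↑) : ℤ → ℚ)) v A B = pairAct (w'.map ((↑) : ℤ → ℚ)) v' A' B') :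
    (A, B) = pairAct ((w⁻¹ * w').map ((↑) : ℤ → ℚ)) (v⁻¹ * v') A' B' := by
  rw [pairAct_mul_map, ← h]
  exact eq_pairAct_inv hw hv rfl

theorem stmt_15
    (A₁ B₁ A₂ B₂ : Matrix (Fin 3) (Fin 3) ℚ)
    (hsA₁ : A₁.IsSymm) (hsB₁ : B₁.IsSymm) (hsA₂ : A₂.IsSymm) (hsB₂ : B₂.IsSymm)
    -- (a) linear independence over ℚ
    (hli₁ : ∀ a b : ℚ, a • A₁ + b • B₁ = 0 → a = 0 ∧ b = 0)
    (hli₂ : ∀ a b : ℚ, a • A₂ + b • B₂ = 0 → a = 0 ∧ b = 0)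
    -- (b) some rational combination is positive definite
    (hpd₁ : ∃ c d : ℚ, ((c • A₁ + d • B₁).map ((↑) : ℚ → ℝ)).PosDef)
    (hpd₂ : ∃ c d : ℚ, ((c • A₂ + d • B₂).map ((↑) : ℚ → ℝ)).PosDef)
    -- (c) identical simultaneous representations over ℤ
    (hrep : simRepZ A₁ B₁ = simRepZ A₂ B₂)
    -- Disc(Aᵢ,Bᵢ) = 0 : the binary cubic 4·det(Aᵢ·x − Bᵢ·y) has a repeated linear
    -- factor over an algebraic closure of ℚ
    (hdisc₁ : ∃ l l' : AlgebraicClosure ℚ × AlgebraicClosure ℚ,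
      ∀ x y : AlgebraicClosure ℚ,
        4 * (x • A₁.map (algebraMap ℚ (AlgebraicClosure ℚ))
            - y • B₁.map (algebraMap ℚ (AlgebraicClosure ℚ))).det
          = (l.1 * x - l.2 * y) ^ 2 * (l'.1 * x - l'.2 * y))
    (hdisc₂ : ∃ l l' : AlgebraicClosure ℚ × AlgebraicClosure ℚ,
      ∀ x y : AlgebraicClosure ℚ,
        4 * (x • A₂.map (algebraMap ℚ (AlgebraicClosure ℚ))
            - y • B₂.map (algebraMap ℚ (AlgebraicClosure ℚ))).det
          = (l.1 * x - l.2 * y) ^ 2 * (l'.1 * x - l'.2 * y)) :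
    (∃ w : Matrix (Fin 3) (Fin 3) ℤ, IsUnit w.det ∧
      (A₁, B₁) = pairAct (w.map ((↑) : ℤ → ℚ)) 1 A₂ B₂) ∨
    ∃ w₁ w₂ : Matrix (Fin 3) (Fin 3) ℤ, IsUnit w₁.det ∧ IsUnit w₂.det ∧
      ∃ v : Matrix (Fin 2) (Fin 2) ℚ, IsUnit v.det ∧
        (({(A₁, B₁), (A₂, B₂)} :
            Set (Matrix (Fin 3) (Fin 3) ℚ × Matrix (Fin 3) (Fin 3) ℚ))
          = {pairAct (w₁.map ((↑) : ℤ → ℚ)) v formHex formZ,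
             pairAct (w₂.map ((↑) : ℤ → ℚ)) v formE formZ} ∨
         ({(A₁, B₁), (A₂, B₂)} :
            Set (Matrix (Fin 3) (Fin 3) ℚ × Matrix (Fin 3) (Fin 3) ℚ))
          = {pairAct (w₁.map ((↑) : ℤ → ℚ)) v formHex formR,
             pairAct (w₂.map ((↑) : ℤ → ℚ)) v formE formR'}) := by
  obtain ⟨W, v, b, c, n, m, N, hW, hv, hb, hb1, hc, hN, h₁⟩ :=
    exists_pair_normal_form hsA₁ hsB₁ hli₁ hpd₁ hdisc₁
  lift N to ℕ using hN.le
  have hsmul (x y : ℚ) : (x • A₂ + y • B₂).IsSymm := (hsA₂.smul x).add (hsB₂.smul y)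
  have hone : ((1 : Matrix (Fin 3) (Fin 3) ℤ).map ((↑) : ℤ → ℚ)) = 1 :=
    Matrix.map_one _ Int.cast_zero Int.cast_one
  have hdet : IsUnit (1 : Matrix (Fin 3) (Fin 3) ℤ).det := by simp
  have hrep₁ := simRepZ_pairAct hW v A₁ B₁
  rw [h₁, hrep, ← simRepZ_pairAct hdet v A₂ B₂] at hrep₁
  obtain ⟨W', b', c', n', m', hW', hb', hb1', hc', h₂⟩ :=
    exists_partner_normal_form hb hb1 hc hN (by rw [hone]; simpa [pairAct] using hsmul _ _)
      (by rw [hone]; simpa [pairAct] using hsmul _ _) hrep₁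
  rw [← pairAct_mul_map, mul_one, one_mul] at h₂
  have hrep₂ : simRepZ (binMat 1 b c) (sqMat ![n, m, N]) = simRepZ (binMat 1 b' c') (sqMat ![n', m', N]) := by
    have e₁ := simRepZ_pairAct hW v A₁ B₁
    have e₂ := simRepZ_pairAct hW' v A₂ B₂
    rw [h₁] at e₁
    rw [h₂] at e₂
    rw [e₁, e₂, hrep]
  have hWinv : IsUnit W⁻¹.det := isUnit_nonsing_inv_det _ hW
  have hWinv' : IsUnit W'⁻¹.det := isUnit_nonsing_inv_det _ hW'
  have hvinv : IsUnit v⁻¹.det := isUnit_nonsing_inv_det _ hv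
  have hdiag {t : ℚ} (ht : t ≠ 0) : IsUnit (v⁻¹ * !![1, 0; 0, t]).det := by
    rw [det_mul]
    exact hvinv.mul (by simpa using ht)
  rcases colIso_or_hex hb hb1 hc hb' hb1' hc' (colLe_of_simRepZ_subset hrep₂.le)
    (colLe_of_simRepZ_subset hrep₂.ge) with
    ⟨rfl, rfl, hcol⟩ | ⟨rfl, rfl, rfl, rfl, k1, k2, k3, k4⟩ | ⟨rfl, rfl, rfl, rfl, k1, k2, k3, k4⟩
  · left
    obtain ⟨w, hw, hw'⟩ := exists_pairAct_of_colIso hcol.symm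
    refine ⟨W⁻¹ * (w * W'), ?_, ?_⟩
    · rw [det_mul, det_mul]
      exact hWinv.mul (hw.mul hW')
    · have : pairAct (W.map ((↑) : ℤ → ℚ)) v A₁ B₁ = pairAct ((w * W').map ((↑) : ℤ → ℚ)) (1 * v) A₂ B₂ := by
        rw [pairAct_mul_map, h₁, h₂, hw']
      rw [eq_pairAct_of_eq hW hv this, one_mul, nonsing_inv_mul _ hv]
  · right
    obtain ⟨w₁, w₂, t, hw₁, hw₂, ht, h⟩ := exists_pairAct_hex (by exact_mod_cast hN) k1 k2 k3 k4
    refine ⟨W⁻¹ * w₁, W'⁻¹ * w₂, ?_, ?_, v⁻¹ * !![1, 0; 0, t], hdiag ht, ?_⟩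
    · rw [det_mul]; exact hWinv.mul hw₁
    · rw [det_mul]; exact hWinv'.mul hw₂
    rcases h with ⟨e₁, e₂⟩ | ⟨e₁, e₂⟩
    · left
      rw [eq_pairAct_of_eq hW hv (h₁.trans e₁), eq_pairAct_of_eq hW' hv (h₂.trans e₂)]
    · right
      rw [eq_pairAct_of_eq hW hv (h₁.trans e₁), eq_pairAct_of_eq hW' hv (h₂.trans e₂)]
  · right
    obtain ⟨w₁, w₂, t, hw₁, hw₂, ht, h⟩ := exists_pairAct_hex (by exact_mod_cast hN) k1 k2 k3 k4
    refine ⟨W'⁻¹ * w₁, W⁻¹ * w₂, ?_, ?_, v⁻¹ * !![1, 0; 0, t], hdiag ht, ?_⟩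
    · rw [det_mul]; exact hWinv'.mul hw₁
    · rw [det_mul]; exact hWinv.mul hw₂
    rcases h with ⟨e₁, e₂⟩ | ⟨e₁, e₂⟩
    · left
      rw [eq_pairAct_of_eq hW' hv (h₂.trans e₁), eq_pairAct_of_eq hW hv (h₁.trans e₂), Set.pair_comm]
    · right
      rw [eq_pairAct_of_eq hW' hv (h₂.trans e₁), eq_pairAct_of_eq hW hv (h₁.trans e₂), Set.pair_comm]
end

section
/- Let f and g be positive-definite ternary quadratic forms over ℚ (positive-definite symmetric 3×3 rational matrices) with the same representations over ℤ, i.e., {f(x) : 0 ≠ x ∈ ℤ³} = {g(x) : 0 ≠ x ∈ ℤ³}. Then f and g are equivalent over ℚ (there exists w ∈ GL₃(ℚ) with f(xw) = g(x) for all x, equivalently wᵀfw = g as matrices) if and only if det f / det g is a square in ℚ×. -/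
open Matrix

/-- `n` is represented by the norm form `x ^ 2 - D * y ^ 2`. -/
def IsQuadNorm {K : Type*} [Field K] (D n : K) : Prop := ∃ x y : K, n = x ^ 2 - D * y ^ 2

namespace IsQuadNorm

variable {K : Type*} [Field K] {D m n : K}

theorem mul (hm : IsQuadNorm D m) (hn : IsQuadNorm D n) : IsQuadNorm D (m * n) := by
  obtain ⟨x, y, rfl⟩ := hm
  obtain ⟨z, w, rfl⟩ := hn
  exact ⟨x * z + D * (y * w), x * w + y * z, by ring⟩

theorem sq (r : K) : IsQuadNorm D (r ^ 2) := ⟨r, 0, by ring⟩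

theorem neg_self : IsQuadNorm D (-D) := ⟨0, 1, by ring⟩

theorem mul_sq_iff {r : K} (hr : r ≠ 0) : IsQuadNorm D (r ^ 2 * n) ↔ IsQuadNorm D n := by
  refine ⟨fun h => ?_, (sq r).mul⟩
  have := (sq (D := D) r⁻¹).mul h
  rwa [← mul_assoc, ← mul_pow, inv_mul_cancel₀ hr, one_pow, one_mul] at this

theorem sq_mul_left_iff {r : K} (hr : r ≠ 0) : IsQuadNorm (r ^ 2 * D) n ↔ IsQuadNorm D n := by
  constructor
  · rintro ⟨x, y, rfl⟩
    exact ⟨x, r * y, by ring⟩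
  · rintro ⟨x, y, rfl⟩
    exact ⟨x, y / r, by field_simp⟩

theorem div (hm : IsQuadNorm D m) (hn : IsQuadNorm D n) (h0 : n ≠ 0) : IsQuadNorm D (m / n) := by
  rw [← mul_sq_iff h0]
  convert hm.mul hn using 1
  field_simp

theorem of_isSquare [CharZero K] (hD : IsSquare D) (h0 : D ≠ 0) (n : K) : IsQuadNorm D n := by
  obtain ⟨r, rfl⟩ := hD
  have hr : r ≠ 0 := by rintro rfl; simp at h0
  exact ⟨(n + 1) / 2, (n - 1) / (2 * r), by field_simp; ring⟩

/-- If `x ^ 2 - D * y ^ 2` vanishes nontrivially then the norm form is universal. -/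
theorem of_isotropic [CharZero K] (h0 : D ≠ 0) {x y : K} (hy : y ≠ 0) (h : x ^ 2 - D * y ^ 2 = 0)
    (n : K) : IsQuadNorm D n :=
  of_isSquare ⟨x / y, by field_simp; linear_combination -h⟩ h0 n

end IsQuadNorm

section Padic

variable {p : ℕ} [hp : Fact p.Prime]

theorem PadicInt.toZMod_ne_zero_iff_isUnit {x : ℤ_[p]} : toZMod x ≠ 0 ↔ IsUnit x := by
  rw [Ne, ← RingHom.mem_ker, ker_toZMod, IsLocalRing.mem_maximalIdeal, mem_nonunits_iff, not_not]

theorem PadicInt.isSquare_of_isSquare_toZMod (h2 : p ≠ 2) {u : ℤ_[p]} (hu : IsUnit u)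
    (h : IsSquare (toZMod u)) : IsSquare u := by
  obtain ⟨r, hr⟩ := h
  obtain ⟨a, rfl⟩ := ZMod.ringHom_surjective (toZMod (p := p)) r
  have ha : toZMod a ≠ 0 := by
    intro ha
    rw [ha, mul_zero] at hr
    exact toZMod_ne_zero_iff_isUnit.2 hu hr
  have h2u : IsUnit (2 * a) := by
    rw [← toZMod_ne_zero_iff_isUnit, map_mul]
    refine mul_ne_zero ?_ ha
    rw [map_ofNat]
    intro h
    have : ((2 : ℕ) : ZMod p) = 0 := by exact_mod_cast h
    rw [ZMod.natCast_eq_zero_iff] at this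
    exact h2 ((Nat.prime_dvd_prime_iff_eq hp.out Nat.prime_two).1 this)
  have hlt : ‖a ^ 2 - u‖ < 1 := by
    rw [← not_isUnit_iff, ← toZMod_ne_zero_iff_isUnit, not_not, map_sub, map_pow, hr]
    ring
  obtain ⟨z, hz, -⟩ := hensels_lemma (p := p) (F := (Polynomial.X ^ 2 - Polynomial.C u)) (a := a)
    (by simpa [isUnit_iff.1 h2u, one_add_one_eq_two] using hlt)
  refine ⟨z, ?_⟩
  simp at hz
  linear_combination -hz

/-- The square class of a nonzero `p`-adic number has a representative of valuation `0` or `1`. -/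
theorem Padic.exists_eq_sq_mul_unit (x : ℚ_[p]) (hx : x ≠ 0) :
    ∃ (r : ℚ_[p]) (u : ℤ_[p]ˣ), r ≠ 0 ∧
      (x = r ^ 2 * (u : ℤ_[p]) ∨ x = r ^ 2 * (p * (u : ℤ_[p]))) := by
  have hp0 : (p : ℚ_[p]) ≠ 0 := Nat.cast_ne_zero.2 hp.out.ne_zero
  have hn : ‖x * (p : ℚ_[p]) ^ (-x.valuation)‖ = 1 := by
    rw [norm_mul, Padic.norm_eq_zpow_neg_valuation hx, Padic.norm_p_zpow, neg_neg,
      ← zpow_add₀ (Nat.cast_ne_zero.2 hp.out.ne_zero), neg_add_cancel, zpow_zero]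
  have hxu : x = (p : ℚ_[p]) ^ x.valuation * ((PadicInt.mkUnits hn : ℤ_[p]ˣ) : ℤ_[p]) := by
    rw [PadicInt.mkUnits_eq, mul_comm x, ← mul_assoc, ← zpow_add₀ hp0, add_neg_cancel, zpow_zero,
      one_mul]
  generalize PadicInt.mkUnits hn = u at hxu
  obtain ⟨k, hk | hk⟩ := Int.even_or_odd' x.valuation
  · refine ⟨(p : ℚ_[p]) ^ k, u, zpow_ne_zero _ hp0, .inl ?_⟩
    rw [hxu, hk, mul_comm 2, _root_.zpow_mul, zpow_ofNat]
  · refine ⟨(p : ℚ_[p]) ^ k, u, zpow_ne_zero _ hp0, .inr ?_⟩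
    rw [hxu, hk, zpow_add₀ hp0, mul_comm 2, _root_.zpow_mul, zpow_ofNat, zpow_one, mul_assoc]

theorem FiniteField.isSquare_mul_of_not_isSquare {F : Type*} [Field F] [Finite F] {a b : F}
    (ha : ¬IsSquare a) (hb : ¬IsSquare b) : IsSquare (a * b) := by
  classical
  have := Fintype.ofFinite F
  have ha0 : a ≠ 0 := by rintro rfl; simp at ha
  have hb0 : b ≠ 0 := by rintro rfl; simp at hb
  by_cases h2 : ringChar F = 2
  · exact absurd (FiniteField.isSquare_of_char_two h2 a) ha
  rw [← quadraticChar_neg_one_iff_not_isSquare] at ha hb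
  rw [← quadraticChar_one_iff_isSquare (mul_ne_zero ha0 hb0), map_mul, ha, hb]
  norm_num

theorem PadicInt.isSquare_mul_of_not_isSquare (h2 : p ≠ 2) {u v : ℤ_[p]} (hu : IsUnit u)
    (hv : IsUnit v) (hu' : ¬IsSquare u) (hv' : ¬IsSquare v) : IsSquare (u * v) := by
  refine isSquare_of_isSquare_toZMod h2 (hu.mul hv) ?_
  rw [map_mul]
  exact FiniteField.isSquare_mul_of_not_isSquare (mt (isSquare_of_isSquare_toZMod h2 hu) hu')
    (mt (isSquare_of_isSquare_toZMod h2 hv) hv')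

/-- Units are norms from an unramified quadratic extension. -/
theorem PadicInt.isQuadNorm_unit (h2 : p ≠ 2) {d u : ℤ_[p]} (hd : IsUnit d)
    (hu : IsUnit u) :
    IsQuadNorm (d : ℚ_[p]) (u : ℚ_[p]) := by
  have hd' := toZMod_ne_zero_iff_isUnit.2 hd
  obtain ⟨x, y, hxy⟩ : ∃ x y : ZMod p, x ^ 2 - toZMod d * y ^ 2 = toZMod u := by
    obtain ⟨x, y, h⟩ := FiniteField.exists_root_sum_quadratic (R := ZMod p)
      (f := Polynomial.X ^ 2 - Polynomial.C (toZMod u))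
      (g := Polynomial.C (-toZMod d) * Polynomial.X ^ 2)
      (by compute_degree!) (by compute_degree!)
      (by rw [ZMod.card]; exact Nat.odd_iff.1 (hp.out.odd_of_ne_two h2))
    refine ⟨x, y, ?_⟩
    simp at h
    linear_combination h
  obtain ⟨x, rfl⟩ := ZMod.ringHom_surjective (toZMod (p := p)) x
  obtain ⟨y, rfl⟩ := ZMod.ringHom_surjective (toZMod (p := p)) y
  by_cases hx : toZMod x = 0
  · rw [hx] at hxy
    obtain ⟨r, hr⟩ : IsSquare (-d * u) := by
      refine isSquare_of_isSquare_toZMod h2 (hd.neg.mul hu)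
        ⟨toZMod d * toZMod y, ?_⟩
      rw [map_mul, map_neg, ← hxy]
      ring
    have h0 : (d : ℚ_[p]) ≠ 0 := by
      rw [Ne, PadicInt.coe_eq_zero]
      exact hd.ne_zero
    refine ⟨0, r / d, ?_⟩
    have hr' : -(d : ℚ_[p]) * u = r * r := by
      simpa using congrArg (fun z : ℤ_[p] => (z : ℚ_[p])) hr
    field_simp
    linear_combination -hr'
  · have hxu : toZMod (u + d * y ^ 2) = toZMod x * toZMod x := by
      rw [map_add, map_mul, map_pow, ← hxy]
      ring
    obtain ⟨r, hr⟩ : IsSquare (u + d * y ^ 2) := by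
      refine isSquare_of_isSquare_toZMod h2 ?_ ⟨_, hxu⟩
      rw [← toZMod_ne_zero_iff_isUnit, hxu]
      exact mul_ne_zero hx hx
    refine ⟨r, y, ?_⟩
    have hr' : (u : ℚ_[p]) + d * y ^ 2 = r * r := by
      simpa using congrArg (fun z : ℤ_[p] => (z : ℚ_[p])) hr
    linear_combination hr'

theorem Padic.isSquare_coe {u : ℤ_[p]} (h : IsSquare u) : IsSquare (u : ℚ_[p]) :=
  h.map PadicInt.Coe.ringHom

/-- For odd `p` the norms from a quadratic extension of `ℚ_[p]` have index at most two. -/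
theorem Padic.isQuadNorm_mul_of_not (h2 : p ≠ 2) {D m n : ℚ_[p]} (hD : D ≠ 0) (hm0 : m ≠ 0)
    (hn0 : n ≠ 0) (hm : ¬IsQuadNorm D m) (hn : ¬IsQuadNorm D n) : IsQuadNorm D (m * n) := by
  have hp0 : (p : ℚ_[p]) ≠ 0 := Nat.cast_ne_zero.2 hp.out.ne_zero
  obtain ⟨r, d, hr, rfl | rfl⟩ := exists_eq_sq_mul_unit D hD
  · rw [IsQuadNorm.sq_mul_left_iff hr] at hm hn ⊢
    have key : ∀ m : ℚ_[p], m ≠ 0 → ¬IsQuadNorm (((d : ℤ_[p]) : ℚ_[p])) m →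
        ∃ (s : ℚ_[p]) (u : ℤ_[p]ˣ), s ≠ 0 ∧ m = s ^ 2 * (p * (u : ℤ_[p])) := by
      intro m hm0 hm
      obtain ⟨s, u, hs, rfl | h⟩ := exists_eq_sq_mul_unit m hm0
      · exact absurd ((IsQuadNorm.sq s).mul (PadicInt.isQuadNorm_unit h2 d.isUnit u.isUnit)) hm
      · exact ⟨s, u, hs, h⟩
    obtain ⟨s, u, hs, rfl⟩ := key m hm0 hm
    obtain ⟨t, v, ht, rfl⟩ := key n hn0 hn
    convert (IsQuadNorm.sq (s * t * p)).mul
      (PadicInt.isQuadNorm_unit h2 d.isUnit (u * v).isUnit) using 1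
    push_cast
    ring
  · rw [IsQuadNorm.sq_mul_left_iff hr] at hm hn ⊢
    have key : ∀ m : ℚ_[p], m ≠ 0 → ¬IsQuadNorm (p * ((d : ℤ_[p]) : ℚ_[p])) m →
        ∃ (s : ℚ_[p]) (u : ℤ_[p]ˣ), IsQuadNorm (p * ((d : ℤ_[p]) : ℚ_[p])) s ∧
          ¬IsSquare (u : ℤ_[p]) ∧ m = s * (u : ℤ_[p]) := by
      intro m hm0 hm
      obtain ⟨s, u, hs, rfl | rfl⟩ := exists_eq_sq_mul_unit m hm0
      · refine ⟨s ^ 2, u, .sq s, fun hu => hm ?_, rfl⟩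
        obtain ⟨t, ht⟩ := isSquare_coe hu
        rw [ht, ← pow_two]
        exact (IsQuadNorm.sq s).mul (.sq t)
      · have hd : (((d⁻¹ : ℤ_[p]ˣ) : ℤ_[p]) : ℚ_[p]) * ((d : ℤ_[p]) : ℚ_[p]) = 1 := by
          rw [← PadicInt.coe_mul, d.inv_mul, PadicInt.coe_one]
        have he : s ^ 2 * (p * ((u : ℤ_[p]) : ℚ_[p])) = s ^ 2 * (-(p * ((d : ℤ_[p]) : ℚ_[p]))) *
            (((-(d⁻¹ * u) : ℤ_[p]ˣ) : ℤ_[p]) : ℚ_[p]) := by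
          push_cast
          linear_combination (-s ^ 2 * p * ((u : ℤ_[p]) : ℚ_[p])) * hd
        refine ⟨_, -(d⁻¹ * u), (IsQuadNorm.sq s).mul .neg_self, fun hu => hm ?_, he⟩
        obtain ⟨t, ht⟩ := isSquare_coe hu
        rw [he, ht, ← pow_two]
        exact ((IsQuadNorm.sq s).mul .neg_self).mul (.sq t)
    obtain ⟨s, u, hs, hu, rfl⟩ := key m hm0 hm
    obtain ⟨t, v, ht, hv, rfl⟩ := key n hn0 hn
    obtain ⟨w, hw⟩ := isSquare_coe (PadicInt.isSquare_mul_of_not_isSquare h2 u.isUnit v.isUnit hu hv)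
    convert (hs.mul ht).mul (.sq w) using 1
    push_cast at hw
    linear_combination s * t * hw

/-- A `p`-adic number close enough to `1` is a square. -/
theorem Padic.isSquare_of_norm_sub_one_lt (h2 : p ≠ 2) {x : ℚ_[p]} (h : ‖x - 1‖ < 1) :
    IsSquare x := by
  have hx : ‖x‖ = 1 := by
    have := Padic.norm_eq_of_norm_sub_lt_right (p := p) (z1 := x) (z2 := 1) (by simpa using h)
    simpa using this
  obtain ⟨u, rfl⟩ : ∃ u : ℤ_[p], (u : ℚ_[p]) = x := ⟨⟨x, hx.le⟩, rfl⟩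
  have h1 : ‖u - 1‖ < 1 := by simpa [PadicInt.norm_def] using h
  refine isSquare_coe (PadicInt.isSquare_of_isSquare_toZMod h2
    (PadicInt.isUnit_iff.2 hx) ⟨1, ?_⟩)
  rw [← PadicInt.not_isUnit_iff, ← PadicInt.toZMod_ne_zero_iff_isUnit, not_not, map_sub, map_one,
    sub_eq_zero] at h1
  rw [h1, mul_one]

end Padic

section HassePrinciple

theorem IsQuadNorm.swap {K : Type*} [Field K] [CharZero K] {a b : K} (hb : b ≠ 0)
    (h : IsQuadNorm a b) : IsQuadNorm b a := by
  obtain ⟨x, y, h⟩ := h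
  by_cases hy : y = 0
  · exact .of_isSquare ⟨x, by rw [h, hy]; ring⟩ hb a
  · refine ⟨x / y, 1 / y, ?_⟩
    field_simp
    linear_combination h

theorem Padic.norm_sq_ne_inv {p : ℕ} [hp : Fact p.Prime] (s : ℚ_[p]) :
    ‖s‖ ^ 2 ≠ (p : ℝ)⁻¹ := by
  intro h
  have hs : s ≠ 0 := by
    rintro rfl
    simp [eq_comm, hp.out.ne_zero] at h
  rw [Padic.norm_eq_zpow_neg_valuation hs, ← zpow_ofNat, ← _root_.zpow_mul,
    ← _root_.zpow_neg_one] at h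
  have := zpow_right_injective₀ (a := (p : ℝ)) (by exact_mod_cast hp.out.pos)
    (by exact_mod_cast hp.out.one_lt.ne') h
  omega

/-- If `A` is not a square modulo `p`, then norms have even valuation. -/
theorem Padic.exists_norm_sq_sub_mul_sq {p : ℕ} [hp : Fact p.Prime] {A : ℤ}
    (hA : ¬IsSquare (A : ZMod p)) (x y : ℚ_[p]) : ∃ s : ℚ_[p], ‖x ^ 2 - A * y ^ 2‖ = ‖s‖ ^ 2 := by
  by_cases hy : y = 0
  · exact ⟨x, by simp [hy]⟩
  obtain ⟨r, rfl⟩ : ∃ r, x = r * y := ⟨x / y, by field_simp⟩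
  have he : (r * y) ^ 2 - A * y ^ 2 = (r ^ 2 - A) * y ^ 2 := by ring
  rw [he, norm_mul, norm_pow]
  rcases le_or_gt ‖r‖ 1 with hr | hr
  · obtain ⟨u, rfl⟩ : ∃ u : ℤ_[p], (u : ℚ_[p]) = r := ⟨⟨r, hr⟩, rfl⟩
    have hu : IsUnit (u ^ 2 - (A : ℤ_[p])) := by
      rw [← PadicInt.toZMod_ne_zero_iff_isUnit, map_sub, map_pow, map_intCast, sub_ne_zero]
      intro h
      exact hA ⟨_, by rw [← h, pow_two]⟩
    rw [PadicInt.isUnit_iff, PadicInt.norm_def] at hu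
    push_cast at hu
    exact ⟨y, by rw [hu, one_mul]⟩
  · have hlt : ‖-(A : ℚ_[p])‖ < ‖r ^ 2‖ := by
      rw [norm_neg, norm_pow]
      exact (Padic.norm_int_le_one A).trans_lt (one_lt_pow₀ hr two_ne_zero)
    refine ⟨r * y, ?_⟩
    rw [sub_eq_add_neg, Padic.add_eq_max_of_ne hlt.ne', max_eq_left hlt.le, norm_mul, norm_pow,
      mul_pow]

theorem IsQuadNorm.isSquare_zmod {p : ℕ} [hp : Fact p.Prime] {A B : ℤ} (hB : Squarefree B)
    (hpB : (p : ℤ) ∣ B) (h : IsQuadNorm (A : ℚ_[p]) (B : ℚ_[p])) : IsSquare (A : ZMod p) := by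
  by_contra hA
  obtain ⟨x, y, hxy⟩ := h
  obtain ⟨s, hs⟩ := Padic.exists_norm_sq_sub_mul_sq hA x y
  obtain ⟨m, rfl⟩ := hpB
  have hm : ¬(p : ℤ) ∣ m := by
    rintro ⟨k, rfl⟩
    have := hB p ⟨k, by ring⟩
    rw [Int.isUnit_iff] at this
    have := hp.out.two_le
    omega
  have hm1 : ‖(m : ℚ_[p])‖ = 1 :=
    le_antisymm (Padic.norm_int_le_one m) (not_lt.1 (mt (Padic.norm_intCast_lt_one_iff (k := m)).1 hm))
  refine Padic.norm_sq_ne_inv s ?_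
  rw [← hs, ← hxy]
  push_cast
  rw [norm_mul, hm1, Padic.norm_p, mul_one]

theorem Int.exists_dvd_sq_sub_of_squarefree (A : ℤ) {n : ℕ} (hn : Squarefree n)
    (h : ∀ p : ℕ, p.Prime → p ∣ n → IsSquare (A : ZMod p)) : ∃ t : ℤ, (n : ℤ) ∣ t ^ 2 - A := by
  induction n using induction_on_primes with
  | zero => exact absurd hn not_squarefree_zero
  | one => exact ⟨0, by simp⟩
  | prime_mul p a hp ih =>
    obtain ⟨hc, -, ha⟩ := Nat.squarefree_mul_iff.1 hn
    obtain ⟨t₂, ht₂⟩ := ih ha fun q hq hqa => h q hq (hqa.mul_left p)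
    obtain ⟨r, hr⟩ := h p hp (dvd_mul_right p a)
    obtain ⟨t₁, rfl⟩ := ZMod.intCast_surjective r
    have ht₁ : (p : ℤ) ∣ t₁ ^ 2 - A := by
      have := Fact.mk hp
      rw [← ZMod.intCast_zmod_eq_zero_iff_dvd]
      push_cast
      rw [hr]
      ring
    have hc' : IsCoprime (p : ℤ) a := Nat.isCoprime_iff_coprime.2 hc
    obtain ⟨u, v, huv⟩ := id hc'
    refine ⟨t₂ * (u * p) + t₁ * (v * a), ?_⟩
    push_cast
    refine hc'.mul_dvd ?_ ?_
    · obtain ⟨k, hk⟩ := ht₁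
      obtain rfl : A = t₁ ^ 2 - p * k := by linear_combination -hk
      have hv : v * a = 1 - u * p := by linear_combination huv
      rw [hv]
      exact ⟨k + u * (t₂ - t₁) * (2 * t₁ + p * u * (t₂ - t₁)), by ring⟩
    · obtain ⟨k, hk⟩ := ht₂
      obtain rfl : A = t₂ ^ 2 - a * k := by linear_combination -hk
      have hu : u * p = 1 - v * a := by linear_combination huv
      rw [hu]
      exact ⟨k + v * (t₁ - t₂) * (2 * t₂ + a * v * (t₁ - t₂)), by ring⟩

/-- One step of Legendre's descent. -/
theorem Int.exists_mul_eq_sq_sub {A B : ℤ} (hB : Squarefree B) (hAB : |A| ≤ |B|) (hB2 : 2 ≤ |B|)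
    (h : ∀ p : ℕ, p.Prime → (p : ℤ) ∣ B → IsSquare (A : ZMod p)) :
    ∃ t C : ℤ, B * C = t ^ 2 - A ∧ |C| < |B| := by
  obtain ⟨t, ht⟩ := Int.exists_dvd_sq_sub_of_squarefree A (Int.squarefree_natAbs.2 hB)
    fun p hp hpB => h p hp (Int.natCast_dvd.2 hpB)
  set n := B.natAbs with hn
  have hnB : (n : ℤ) = |B| := Int.natCast_natAbs B
  have hn0 : 0 < n := by omega
  set s := t.bmod n with hs
  have hs1 : 2 * s ≤ n := by have := Int.bmod_lt (x := t) hn0; omega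
  have hs2 : -n ≤ 2 * s := by have := Int.le_bmod (x := t) hn0; omega
  have hst : (n : ℤ) ∣ s - t := Int.dvd_bmod_sub_self
  have hd : B ∣ s ^ 2 - A := by
    rw [← Int.natAbs_dvd, ← hn]
    have := dvd_add ht (hst.mul_right (s + t))
    rwa [show t ^ 2 - A + (s - t) * (s + t) = s ^ 2 - A by ring] at this
  obtain ⟨C, hC⟩ := hd
  refine ⟨s, C, hC.symm, ?_⟩
  rw [hnB] at hs1 hs2
  by_contra! hlt
  have h1 : |B| * |C| ≤ s ^ 2 + |A| := by
    rw [← abs_mul, ← hC]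
    exact (abs_sub _ _).trans (by rw [abs_of_nonneg (sq_nonneg s)])
  nlinarith

/-- The Hasse principle for conics over `ℚ`, without a condition at `2`. -/
theorem IsQuadNorm.of_padic_int (A B : ℤ) (hA : A ≠ 0) (hB : B ≠ 0) (hpos : 0 < A ∨ 0 < B)
    (h : ∀ (p : ℕ) [Fact p.Prime], p ≠ 2 → IsQuadNorm (A : ℚ_[p]) (B : ℚ_[p])) :
    IsQuadNorm (A : ℚ) (B : ℚ) := by
  induction hk : A.natAbs + B.natAbs using Nat.strong_induction_on generalizing A B with
  | _ k ih =>
  wlog hAB : |A| ≤ |B| generalizing A B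
  · refine (this B A hB hA hpos.symm (fun p _ hp => (h p hp).swap (by exact_mod_cast hB))
      (by omega) (by omega)).swap (by exact_mod_cast hA)
  by_cases hB1 : |B| < 2
  · have hB' : |B| = 1 := le_antisymm (by omega) (Int.one_le_abs hB)
    have hA' : |A| = 1 := le_antisymm (by omega) (Int.one_le_abs hA)
    rcases hpos with hpos | hpos
    · obtain rfl : A = 1 := by rwa [abs_of_pos hpos] at hA'
      exact .of_isSquare ⟨1, by simp⟩ (by simp) _
    · obtain rfl : B = 1 := by rwa [abs_of_pos hpos] at hB'
      exact ⟨1, 0, by simp⟩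
  push Not at hB1
  by_cases hsq : Squarefree B
  · obtain ⟨t, C, hC, hlt⟩ := Int.exists_mul_eq_sq_sub hsq hAB hB1 fun p hp hpB => by
      have := Fact.mk hp
      by_cases h2 : p = 2
      · subst h2
        exact FiniteField.isSquare_of_char_two (ZMod.ringChar_zmod_n 2) _
      · exact (h p h2).isSquare_zmod hsq hpB
    by_cases hC0 : C = 0
    · refine .of_isSquare (K := ℚ) ⟨(t : ℚ), ?_⟩ (by exact_mod_cast hA) _
      have : A = t * t := by rw [hC0] at hC; linear_combination hC
      exact_mod_cast this
    have key : ∀ {K : Type} [Field K] [CharZero K],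
        IsQuadNorm (A : K) ((B : K) * C) := fun {K} _ _ =>
      ⟨t, 1, by have : ((B * C : ℤ) : K) = ((t ^ 2 - A : ℤ) : K) := by rw [hC]
                push_cast at this
                linear_combination this⟩
    have hdesc : IsQuadNorm (A : ℚ) (C : ℚ) := by
      refine ih (A.natAbs + C.natAbs)
        (by rw [Int.abs_eq_natAbs, Int.abs_eq_natAbs] at hlt; omega) A C hA hC0 ?_
        (fun p _ hp => ?_) rfl
      · rcases hpos with hpos | hpos
        · exact .inl hpos
        · by_cases hA0 : 0 < A
          · exact .inl hA0
          · refine .inr (pos_of_mul_pos_right (a := B) ?_ hpos.le)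
            rw [hC]
            have : A < 0 := by omega
            nlinarith [sq_nonneg t]
      · have hB0 : (B : ℚ_[p]) ≠ 0 := by exact_mod_cast hB
        simpa [hB0] using (key (K := ℚ_[p])).div (h p hp) hB0
    have hC0' : (C : ℚ) ≠ 0 := by exact_mod_cast hC0
    simpa [hC0'] using (key (K := ℚ)).div hdesc hC0'
  · obtain ⟨d, ⟨c, rfl⟩, hd⟩ : ∃ d : ℤ, d * d ∣ B ∧ ¬IsUnit d := by
      simpa [Squarefree] using hsq
    have hd0 : d ≠ 0 := by rintro rfl; simp at hB
    have hc0 : c ≠ 0 := by rintro rfl; simp at hB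
    have hd2 : 2 ≤ d.natAbs := by
      rw [Int.isUnit_iff_natAbs_eq] at hd
      have := Int.natAbs_pos.2 hd0
      omega
    have he : ∀ {K : Type} [Field K] [CharZero K],
        IsQuadNorm (A : K) ((d * d * c : ℤ) : K) ↔ IsQuadNorm (A : K) (c : K) := fun {K} _ _ => by
      rw [← IsQuadNorm.mul_sq_iff (r := (d : K)) (n := (c : K)) (by exact_mod_cast hd0)]
      push_cast
      rw [pow_two]
    rw [he]
    refine ih _ ?_ A c hA hc0 (hpos.imp_right fun hp => ?_) (fun p _ hp => he.1 (h p hp)) rfl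
    · rw [← hk, Int.natAbs_mul, Int.natAbs_mul]
      have := Int.natAbs_pos.2 hc0
      nlinarith [Nat.mul_le_mul hd2 hd2]
    · exact pos_of_mul_pos_right hp (mul_self_nonneg d)

theorem IsQuadNorm.of_padic (a b : ℚ) (ha : a ≠ 0) (hb : b ≠ 0) (hpos : 0 < a ∨ 0 < b)
    (h : ∀ (p : ℕ) [Fact p.Prime], p ≠ 2 → IsQuadNorm (a : ℚ_[p]) (b : ℚ_[p])) :
    IsQuadNorm a b := by
  have hsq : ∀ q : ℚ, ((q.num * q.den : ℤ) : ℚ) = (q.den : ℚ) ^ 2 * q := fun q => by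
    push_cast
    rw [pow_two, mul_assoc, Rat.den_mul_eq_num, mul_comm]
  have he : ∀ {K : Type} [Field K] [CharZero K],
      IsQuadNorm ((a.num * a.den : ℤ) : K) ((b.num * b.den : ℤ) : K) ↔
        IsQuadNorm (a : K) (b : K) := fun {K} _ _ => by
    have hsq' : ∀ q : ℚ, ((q.num * q.den : ℤ) : K) = (q.den : K) ^ 2 * (q : K) := fun q => by
      exact_mod_cast congrArg (Rat.cast (K := K)) (hsq q)
    rw [hsq', hsq', IsQuadNorm.sq_mul_left_iff (by exact_mod_cast a.den_nz),
      IsQuadNorm.mul_sq_iff (by exact_mod_cast b.den_nz)]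
  have hp : ∀ q : ℚ, 0 < q → 0 < q.num * q.den := fun q hq =>
    mul_pos (Rat.num_pos.2 hq) (by exact_mod_cast q.den_pos)
  have := IsQuadNorm.of_padic_int (a.num * a.den) (b.num * b.den)
    (mul_ne_zero (Rat.num_ne_zero.2 ha) (by exact_mod_cast a.den_nz))
    (mul_ne_zero (Rat.num_ne_zero.2 hb) (by exact_mod_cast b.den_nz))
    (hpos.imp (hp a) (hp b)) (fun p _ hp => he.2 (h p hp))
  simpa using he.1 this

end HassePrinciple

section LocalTransfer

/-- If two diagonal ternary forms over `ℚ` with a common first coefficient and the same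
discriminant represent the same rationals, then isotropy at an odd prime transfers from the first
to the second. -/
theorem Padic.isQuadNorm_of_represents {p : ℕ} [hp : Fact p.Prime] (h2 : p ≠ 2)
    {a b₀ b₁ c₀ c₁ k : ℚ} (ha : a ≠ 0) (hb₀ : b₀ ≠ 0) (hb₁ : b₁ ≠ 0) (hc₀ : c₀ ≠ 0) (hc₁ : c₁ ≠ 0)
    (hk : c₀ * c₁ = b₀ * b₁ * k ^ 2)
    (hval : ∀ u₀ u₁ u₂ : ℚ, (u₀ ≠ 0 ∨ u₁ ≠ 0 ∨ u₂ ≠ 0) → ∃ w₀ w₁ w₂ : ℚ,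
      a * w₀ ^ 2 + c₀ * w₁ ^ 2 + c₁ * w₂ ^ 2 = a * u₀ ^ 2 + b₀ * u₁ ^ 2 + b₁ * u₂ ^ 2)
    (h : IsQuadNorm (-(b₀ * b₁ : ℚ_[p])) (-(a * b₀))) :
    IsQuadNorm (-(c₀ * c₁ : ℚ_[p])) (-(a * c₀)) := by
  have hk0 : k ≠ 0 := by rintro rfl; simp [hc₀, hc₁] at hk
  have ha' : (a : ℚ_[p]) ≠ 0 := by exact_mod_cast ha
  have hb' : (b₀ : ℚ_[p]) ≠ 0 := by exact_mod_cast hb₀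
  have hk' : (k : ℚ_[p]) ≠ 0 := by exact_mod_cast hk0
  have hc' : (-(c₀ * c₁) : ℚ_[p]) ≠ 0 := by
    rw [neg_ne_zero]
    exact_mod_cast mul_ne_zero hc₀ hc₁
  have hkp : (c₀ * c₁ : ℚ_[p]) = b₀ * b₁ * k ^ 2 := by exact_mod_cast hk
  obtain ⟨x, y, hxy⟩ := h
  let F : ℚ_[p] × ℚ_[p] → ℚ_[p] := fun z => -(b₀ * z.1 ^ 2 + b₁ * z.2 ^ 2) / a
  have hF : Continuous F := by fun_prop
  have hF1 : F (x / b₀, y) = 1 := by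
    simp only [F]
    field_simp
    linear_combination hxy
  obtain ⟨⟨X, Y⟩, hXY⟩ := ((denseRange_ratCast p).prodMap (denseRange_ratCast p)).exists_mem_open
    (Metric.isOpen_ball.preimage hF) ⟨(x / b₀, y), show F _ ∈ Metric.ball (1 : ℚ_[p]) 1 by
      rw [hF1]; exact Metric.mem_ball_self one_pos⟩
  have hlt : ‖F (X, Y) - 1‖ < 1 := by simpa [dist_eq_norm] using hXY
  have hF0 : F (X, Y) ≠ 0 := fun h0 => by simp [h0] at hlt
  obtain ⟨s, hs⟩ := isSquare_of_norm_sub_one_lt h2 hlt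
  have hs0 : s ≠ 0 := by rintro rfl; simp [hs] at hF0
  simp only [F] at hs hF0
  obtain ⟨w₀, w₁, w₂, hw⟩ := hval 0 (b₁ * Y) (b₀ * X) <| by
    by_contra! hcon
    have hY : Y = 0 := by simpa [hb₁] using hcon.2.1
    have hX : X = 0 := by simpa [hb₀] using hcon.2.2
    simp [hX, hY] at hF0
  have hw' : (a * w₀ ^ 2 + c₀ * w₁ ^ 2 + c₁ * w₂ ^ 2 : ℚ_[p]) =
      b₀ * (b₁ * Y) ^ 2 + b₁ * (b₀ * X) ^ 2 := by
    have := congrArg (Rat.cast (K := ℚ_[p])) hw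
    push_cast at this
    linear_combination this
  rw [div_eq_iff ha'] at hs
  have hm : (-(a * c₀) : ℚ_[p]) * (w₀ ^ 2 - -(c₀ * c₁) * (s / k) ^ 2) =
      (c₀ * w₁) ^ 2 - -(c₀ * c₁) * w₂ ^ 2 := by
    rw [hkp]
    field_simp
    linear_combination (-c₀ : ℚ_[p]) * hw' + (c₀ * b₀ * b₁ : ℚ_[p]) * hs + (w₂ : ℚ_[p]) ^ 2 * hkp
  by_cases h0 : (w₀ : ℚ_[p]) ^ 2 - -(c₀ * c₁) * (s / k) ^ 2 = 0
  · exact .of_isotropic hc' (div_ne_zero hs0 hk') h0 _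
  · rw [eq_div_of_mul_eq h0 hm]
    exact IsQuadNorm.div ⟨_, _, rfl⟩ ⟨_, _, rfl⟩ h0

/-- The binary complements of a common vector differ by a global norm. -/
theorem IsQuadNorm.of_represents {a b₀ b₁ c₀ c₁ k : ℚ} (ha : 0 < a) (hb₀ : 0 < b₀) (hb₁ : 0 < b₁)
    (hc₀ : 0 < c₀) (hc₁ : 0 < c₁) (hk : c₀ * c₁ = b₀ * b₁ * k ^ 2)
    (hbc : ∀ u₀ u₁ u₂ : ℚ, (u₀ ≠ 0 ∨ u₁ ≠ 0 ∨ u₂ ≠ 0) → ∃ w₀ w₁ w₂ : ℚ,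
      a * w₀ ^ 2 + c₀ * w₁ ^ 2 + c₁ * w₂ ^ 2 = a * u₀ ^ 2 + b₀ * u₁ ^ 2 + b₁ * u₂ ^ 2)
    (hcb : ∀ u₀ u₁ u₂ : ℚ, (u₀ ≠ 0 ∨ u₁ ≠ 0 ∨ u₂ ≠ 0) → ∃ w₀ w₁ w₂ : ℚ,
      a * w₀ ^ 2 + b₀ * w₁ ^ 2 + b₁ * w₂ ^ 2 = a * u₀ ^ 2 + c₀ * u₁ ^ 2 + c₁ * u₂ ^ 2) :
    IsQuadNorm (-(b₀ * b₁)) (b₀ * c₀) := by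
  have hk0 : k ≠ 0 := by
    rintro rfl
    have := mul_pos hc₀ hc₁
    simp [hk] at this
  refine .of_padic _ _ (neg_ne_zero.2 (by positivity)) (by positivity) (.inr (by positivity))
    fun p hp h2 => ?_
  have ha' : (a : ℚ_[p]) ≠ 0 := by exact_mod_cast ha.ne'
  have hb₀' : (b₀ : ℚ_[p]) ≠ 0 := by exact_mod_cast hb₀.ne'
  have hb₁' : (b₁ : ℚ_[p]) ≠ 0 := by exact_mod_cast hb₁.ne'
  have hc₀' : (c₀ : ℚ_[p]) ≠ 0 := by exact_mod_cast hc₀.ne'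
  have hk' : (k : ℚ_[p]) ≠ 0 := by exact_mod_cast hk0
  have hkp : (-(c₀ * c₁) : ℚ_[p]) = k ^ 2 * -(b₀ * b₁) := by
    have : (c₀ * c₁ : ℚ_[p]) = b₀ * b₁ * k ^ 2 := by exact_mod_cast hk
    linear_combination -this
  have hiff : IsQuadNorm (-(b₀ * b₁ : ℚ_[p])) (-(a * b₀)) ↔
      IsQuadNorm (-(b₀ * b₁ : ℚ_[p])) (-(a * c₀)) := by
    constructor
    · intro h
      rw [← IsQuadNorm.sq_mul_left_iff hk', ← hkp]
      exact Padic.isQuadNorm_of_represents h2 ha.ne' hb₀.ne' hb₁.ne' hc₀.ne' hc₁.ne' hk hbc h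
    · intro h
      rw [← IsQuadNorm.sq_mul_left_iff hk', ← hkp] at h
      refine Padic.isQuadNorm_of_represents (k := k⁻¹) h2 ha.ne' hc₀.ne' hc₁.ne' hb₀.ne' hb₁.ne' ?_
        hcb h
      rw [hk]
      field_simp
  push_cast
  rw [← IsQuadNorm.mul_sq_iff ha',
    show (a ^ 2 * (b₀ * c₀) : ℚ_[p]) = -(a * b₀) * -(a * c₀) by ring]
  by_cases h : IsQuadNorm (-(b₀ * b₁ : ℚ_[p])) (-(a * b₀))
  · exact h.mul (hiff.1 h)
  · exact Padic.isQuadNorm_mul_of_not h2 (by simp [hb₀', hb₁']) (by simp [ha', hb₀'])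
      (by simp [ha', hc₀']) h (mt hiff.2 h)

end LocalTransfer

section TernaryForms

theorem exists_ne_zero_dotProduct_eq_zero_and {K : Type*} [Field K] (u v : Fin 3 → K) :
    ∃ x : Fin 3 → K, x ≠ 0 ∧ u ⬝ᵥ x = 0 ∧ v ⬝ᵥ x = 0 := by
  obtain ⟨x, hx, h⟩ := (Matrix.exists_mulVec_eq_zero_iff (M := Matrix.of ![u, v, 0])).2 (by
    rw [Matrix.det_eq_zero_of_row_eq_zero 2]
    intro j
    rfl)
  exact ⟨x, hx, congrFun h 0, congrFun h 1⟩

theorem Matrix.dotProduct_mulVec_comm_of_isSymm {n R : Type*} [Fintype n] [CommSemiring R]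
    {f : Matrix n n R} (hf : f.IsSymm) (x y : n → R) : x ⬝ᵥ f *ᵥ y = y ⬝ᵥ f *ᵥ x := by
  rw [dotProduct_mulVec, dotProduct_comm, ← mulVec_transpose, hf.eq]

/-- A positive definite ternary form can be diagonalised with a prescribed first basis vector. -/
theorem Matrix.exists_transpose_mul_mul_eq_diagonal {f : Matrix (Fin 3) (Fin 3) ℚ} (hf : f.IsSymm)
    (hpos : ∀ v, v ≠ 0 → 0 < v ⬝ᵥ f *ᵥ v) {v : Fin 3 → ℚ} (hv : v ≠ 0) :
    ∃ (P : Matrix (Fin 3) (Fin 3) ℚ) (b c : ℚ), P.det ≠ 0 ∧ 0 < b ∧ 0 < c ∧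
      Pᵀ * f * P = diagonal ![v ⬝ᵥ f *ᵥ v, b, c] := by
  obtain ⟨x, hx, hvx, -⟩ := exists_ne_zero_dotProduct_eq_zero_and (f *ᵥ v) 0
  obtain ⟨y, hy, hvy, hxy⟩ := exists_ne_zero_dotProduct_eq_zero_and (f *ᵥ v) (f *ᵥ x)
  rw [dotProduct_comm] at hvx hvy hxy
  have hP : (of ![v, x, y]) * f * (of ![v, x, y])ᵀ =
      diagonal ![v ⬝ᵥ f *ᵥ v, x ⬝ᵥ f *ᵥ x, y ⬝ᵥ f *ᵥ y] := by
    have hent : ∀ i j, ((of ![v, x, y]) * f * (of ![v, x, y])ᵀ) i j =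
        (![v, x, y] i) ⬝ᵥ f *ᵥ (![v, x, y] j) := fun i j => by
      rw [dotProduct_mulVec]
      rfl
    ext i j
    rw [hent]
    have hs := dotProduct_mulVec_comm_of_isSymm hf
    fin_cases i <;> fin_cases j <;> simp [hvx, hvy, hxy, hs v x, hs v y, hs x y]
  refine ⟨(of ![v, x, y])ᵀ, _, _, fun h0 => ?_, hpos x hx, hpos y hy, hP⟩
  have := congrArg det hP
  rw [det_mul, h0, mul_zero, det_diagonal, Fin.prod_univ_three] at this
  exact (mul_pos (mul_pos (hpos v hv) (hpos x hx)) (hpos y hy)).ne this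

theorem Matrix.dotProduct_mulVec_of_diagonalization {f P : Matrix (Fin 3) (Fin 3) ℚ} {a b c : ℚ}
    (h : Pᵀ * f * P = diagonal ![a, b, c]) (u : Fin 3 → ℚ) :
    (P *ᵥ u) ⬝ᵥ f *ᵥ (P *ᵥ u) = a * u 0 ^ 2 + b * u 1 ^ 2 + c * u 2 ^ 2 := by
  have : (P *ᵥ u) ⬝ᵥ f *ᵥ (P *ᵥ u) = u ⬝ᵥ (Pᵀ * f * P) *ᵥ u := by
    rw [← mulVec_mulVec, ← mulVec_mulVec, dotProduct_mulVec u, vecMul_transpose]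
  rw [this, h]
  simp [dotProduct, mulVec_diagonal, Fin.sum_univ_three]
  ring

theorem Matrix.diagonal_represents {f g P Q : Matrix (Fin 3) (Fin 3) ℚ} {a b₀ b₁ c₀ c₁ : ℚ}
    (hP : Pᵀ * f * P = diagonal ![a, b₀, b₁]) (hQ : Qᵀ * g * Q = diagonal ![a, c₀, c₁])
    (hPd : P.det ≠ 0) (hQd : Q.det ≠ 0)
    (hval : ∀ v, v ≠ 0 → ∃ w, w ≠ 0 ∧ w ⬝ᵥ g *ᵥ w = v ⬝ᵥ f *ᵥ v) (u₀ u₁ u₂ : ℚ)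
    (hu : u₀ ≠ 0 ∨ u₁ ≠ 0 ∨ u₂ ≠ 0) : ∃ w₀ w₁ w₂ : ℚ,
      a * w₀ ^ 2 + c₀ * w₁ ^ 2 + c₁ * w₂ ^ 2 = a * u₀ ^ 2 + b₀ * u₁ ^ 2 + b₁ * u₂ ^ 2 := by
  obtain ⟨w, -, hw⟩ := hval (P *ᵥ ![u₀, u₁, u₂]) fun h => by
    have := eq_zero_of_mulVec_eq_zero hPd h
    have h0 := congrFun this 0
    have h1 := congrFun this 1
    have h2 := congrFun this 2
    simp at h0 h1 h2
    simp [h0, h1, h2] at hu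
  obtain ⟨w', rfl⟩ : ∃ w', Q *ᵥ w' = w :=
    ⟨Q⁻¹ *ᵥ w, by rw [mulVec_mulVec, mul_nonsing_inv _ (isUnit_iff_ne_zero.2 hQd), one_mulVec]⟩
  rw [dotProduct_mulVec_of_diagonalization hP, dotProduct_mulVec_of_diagonalization hQ] at hw
  exact ⟨_, _, _, by simpa using hw⟩

theorem Matrix.exists_transpose_mul_diagonal_mul {a b₀ b₁ c₀ c₁ k : ℚ} (hb₀ : b₀ ≠ 0)
    (hc₀ : c₀ ≠ 0) (hk : c₀ * c₁ = b₀ * b₁ * k ^ 2) (h : IsQuadNorm (-(b₀ * b₁)) (b₀ * c₀)) :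
    ∃ T : Matrix (Fin 3) (Fin 3) ℚ,
      Tᵀ * diagonal ![a, b₀, b₁] * T = diagonal ![a, c₀, c₁] := by
  obtain ⟨x, y, hxy⟩ := h
  obtain ⟨r, rfl⟩ : ∃ r, x = b₀ * r := ⟨x / b₀, by field_simp⟩
  have hc : b₀ * r ^ 2 + b₁ * y ^ 2 = c₀ :=
    mul_left_cancel₀ hb₀ (by linear_combination -hxy)
  have hc₁ : c₁ = b₀ * b₁ * (k / c₀) ^ 2 * c₀ := by
    field_simp
    linear_combination hk
  refine ⟨!![1, 0, 0; 0, r, -(b₁ * y * (k / c₀)); 0, y, b₀ * r * (k / c₀)], ?_⟩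
  generalize k / c₀ = t at hc₁
  subst hc₁
  ext i j
  fin_cases i <;> fin_cases j <;>
    simp [Matrix.mul_apply, Fin.sum_univ_three, diagonal_apply] <;>
    first
    | linear_combination hc
    | linear_combination (b₀ * b₁ * t ^ 2) * hc
    | ring

theorem Matrix.PosDef.rat_dotProduct_mulVec_pos {f : Matrix (Fin 3) (Fin 3) ℚ}
    (hf : (f.map ((↑) : ℚ → ℝ)).PosDef) (v : Fin 3 → ℚ) (hv : v ≠ 0) : 0 < v ⬝ᵥ f *ᵥ v := by
  have hv' : (fun i => (v i : ℝ)) ≠ 0 := fun h => hv <| funext fun i => by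
    simpa using congrFun h i
  have := hf.dotProduct_mulVec_pos hv'
  have he : star (fun i => (v i : ℝ)) ⬝ᵥ f.map ((↑) : ℚ → ℝ) *ᵥ (fun i => (v i : ℝ)) =
      ((v ⬝ᵥ f *ᵥ v : ℚ) : ℝ) := by
    simp [dotProduct, mulVec]
  rw [he] at this
  exact_mod_cast this

theorem Matrix.exists_rat_represents {f g : Matrix (Fin 3) (Fin 3) ℚ}
    (h : {r : ℚ | ∃ x : Fin 3 → ℤ, x ≠ 0 ∧
        (fun i => (x i : ℚ)) ⬝ᵥ (f *ᵥ fun i => (x i : ℚ)) = r}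
      ⊆ {r : ℚ | ∃ x : Fin 3 → ℤ, x ≠ 0 ∧
        (fun i => (x i : ℚ)) ⬝ᵥ (g *ᵥ fun i => (x i : ℚ)) = r})
    (v : Fin 3 → ℚ) (hv : v ≠ 0) : ∃ w, w ≠ 0 ∧ w ⬝ᵥ g *ᵥ w = v ⬝ᵥ f *ᵥ v := by
  obtain ⟨⟨b, hb⟩, hx⟩ := IsLocalization.exist_integer_multiples_of_finite (nonZeroDivisors ℤ) v
  choose x hx using hx
  have hb0 : (b : ℚ) ≠ 0 := by exact_mod_cast nonZeroDivisors.ne_zero hb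
  have hxv : (fun i => (x i : ℚ)) = (b : ℚ) • v := funext fun i => by simpa using hx i
  have hx0 : x ≠ 0 := by
    rintro rfl
    exact smul_ne_zero hb0 hv (hxv.symm.trans (by ext; simp))
  obtain ⟨y, hy, hyx⟩ := h ⟨x, hx0, rfl⟩
  refine ⟨(b : ℚ)⁻¹ • fun i => (y i : ℚ), smul_ne_zero (inv_ne_zero hb0) fun h0 => hy ?_, ?_⟩
  · ext i
    simpa using congrFun h0 i
  · rw [hxv] at hyx
    simp only [mulVec_smul, smul_dotProduct, dotProduct_smul, smul_eq_mul] at hyx ⊢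
    rw [hyx]
    field_simp

end TernaryForms

theorem stmt_16
    (f g : Matrix (Fin 3) (Fin 3) ℚ)
    (hsf : f.IsSymm) (hsg : g.IsSymm)
    (hpf : ((f.map ((↑) : ℚ → ℝ))).PosDef)
    (hpg : ((g.map ((↑) : ℚ → ℝ))).PosDef)
    -- identical representations over ℤ
    (hrep : {r : ℚ | ∃ x : Fin 3 → ℤ, x ≠ 0 ∧
        (fun i => (x i : ℚ)) ⬝ᵥ (f *ᵥ fun i => (x i : ℚ)) = r}
      = {r : ℚ | ∃ x : Fin 3 → ℤ, x ≠ 0 ∧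
        (fun i => (x i : ℚ)) ⬝ᵥ (g *ᵥ fun i => (x i : ℚ)) = r}) :
    (∃ w : Matrix (Fin 3) (Fin 3) ℚ, IsUnit w.det ∧ wᵀ * f * w = g)
    ↔ ∃ c : ℚ, c ≠ 0 ∧ f.det / g.det = c ^ 2 := by
  have hf := Matrix.PosDef.rat_dotProduct_mulVec_pos hpf
  have hg := Matrix.PosDef.rat_dotProduct_mulVec_pos hpg
  have hfg := Matrix.exists_rat_represents hrep.subset
  have hgf := Matrix.exists_rat_represents hrep.symm.subset
  have hv : (Pi.single 0 1 : Fin 3 → ℚ) ≠ 0 := by simp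
  obtain ⟨v', hv', hvv'⟩ := hfg _ hv
  obtain ⟨P, b₀, b₁, hPd, hb₀, hb₁, hP⟩ := Matrix.exists_transpose_mul_mul_eq_diagonal hsf hf hv
  obtain ⟨Q, c₀, c₁, hQd, hc₀, hc₁, hQ⟩ := Matrix.exists_transpose_mul_mul_eq_diagonal hsg hg hv'
  have ha := hf _ hv
  rw [hvv'] at hQ
  generalize (Pi.single 0 1 : Fin 3 → ℚ) ⬝ᵥ f *ᵥ Pi.single 0 1 = a at hP hQ ha
  have hdf : P.det ^ 2 * f.det = a * (b₀ * b₁) := by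
    have := congrArg det hP
    simp [Fin.prod_univ_three] at this
    linear_combination this
  have hdg : Q.det ^ 2 * g.det = a * (c₀ * c₁) := by
    have := congrArg det hQ
    simp [Fin.prod_univ_three] at this
    linear_combination this
  have hf0 : f.det ≠ 0 := by
    intro h
    rw [h, mul_zero] at hdf
    exact (mul_pos ha (mul_pos hb₀ hb₁)).ne hdf
  have hg0 : g.det ≠ 0 := by
    intro h
    rw [h, mul_zero] at hdg
    exact (mul_pos ha (mul_pos hc₀ hc₁)).ne hdg
  constructor
  · rintro ⟨w, hw, rfl⟩
    have hw0 := hw.ne_zero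
    refine ⟨w.det⁻¹, inv_ne_zero hw0, ?_⟩
    rw [det_mul, det_mul, det_transpose]
    field_simp
  · rintro ⟨k, hk0, hk⟩
    have hk' : c₀ * c₁ = b₀ * b₁ * (Q.det / (k * P.det)) ^ 2 := by
      refine mul_left_cancel₀ ha.ne' ?_
      rw [div_eq_iff hg0] at hk
      rw [← hdg, ← mul_assoc, ← hdf, hk]
      field_simp
    obtain ⟨T, hT⟩ := Matrix.exists_transpose_mul_diagonal_mul (a := a) hb₀.ne' hc₀.ne' hk'
      (IsQuadNorm.of_represents ha hb₀ hb₁ hc₀ hc₁ hk'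
        (Matrix.diagonal_represents hP hQ hPd hQd hfg)
        (Matrix.diagonal_represents hQ hP hQd hPd hgf))
    have hQu : IsUnit Q.det := isUnit_iff_ne_zero.2 hQd
    have hw : (P * T * Q⁻¹)ᵀ * f * (P * T * Q⁻¹) = g := calc
      _ = (Q⁻¹)ᵀ * (Tᵀ * (Pᵀ * f * P) * T) * Q⁻¹ := by simp only [transpose_mul, Matrix.mul_assoc]
      _ = (Q * Q⁻¹)ᵀ * g * (Q * Q⁻¹) := by
        rw [hP, hT, ← hQ]
        simp only [transpose_mul, Matrix.mul_assoc]
      _ = g := by simp [mul_nonsing_inv _ hQu]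
    refine ⟨P * T * Q⁻¹, isUnit_iff_ne_zero.2 fun h0 => hg0 ?_, hw⟩
    rw [← hw, det_mul, h0, mul_zero]
end

section
/- Let p be a prime number and let (A₁,B₁), (A₂,B₂) be pairs of symmetric 3×3 rational matrices such that q_ℚ(A₁,B₁) = q_ℚ(A₂,B₂), and such that both pairs are anisotropic over the field ℚ_p of p-adic numbers (for each i there is no nonzero x ∈ ℚ_p³ with xᵀAᵢx = xᵀBᵢx = 0). Then the simultaneous representations over ℚ_p coincide: {(xᵀA₁x, xᵀB₁x) : 0 ≠ x ∈ ℚ_p³} = {(xᵀA₂x, xᵀB₂x) : 0 ≠ x ∈ ℚ_p³}. (This holds because, for an anisotropic pair, the topological closure of q_ℚ(Aᵢ,Bᵢ) in ℚ_p² equals {(0,0)} ∪ q_{ℚ_p}(Aᵢ,Bᵢ).) -/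
open Matrix

/-- A continuous map from a finite-dimensional coordinate space over a proper field which is
homogeneous of degree two and vanishes only at the origin has closed range. -/
theorem isClosed_range_of_homogeneous_two {𝕜 ι E : Type*} [NontriviallyNormedField 𝕜]
    [ProperSpace 𝕜] [Fintype ι] [Nonempty ι] [NormedAddCommGroup E] [NormedSpace 𝕜 E]
    [ProperSpace E] {f : (ι → 𝕜) → E} (hf : Continuous f)
    (hsmul : ∀ (c : 𝕜) (x : ι → 𝕜), f (c • x) = c ^ 2 • f x) (hzero : ∀ x, f x = 0 → x = 0) :
    IsClosed (Set.range f) := by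
  have hne : (Metric.sphere (0 : ι → 𝕜) 1).Nonempty := ⟨1, by simp⟩
  obtain ⟨m, hm, hmin⟩ := (isCompact_sphere (0 : ι → 𝕜) 1).exists_isMinOn hne hf.norm.continuousOn
  have hm1 : ‖m‖ = 1 := by simpa using hm
  have hpos : 0 < ‖f m‖ := by
    rw [norm_pos_iff]
    intro h
    simp [hzero m h] at hm1
  have hbound : ∀ x, ‖f m‖ * ‖x‖ ^ 2 ≤ ‖f x‖ := by
    intro x
    rcases eq_or_ne x 0 with rfl | hx
    · simp
    obtain ⟨i, hi⟩ : ∃ i, ‖x‖ = ‖x i‖ := by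
      obtain ⟨i, -, hi⟩ := Finset.exists_mem_eq_sup Finset.univ Finset.univ_nonempty
        fun i => ‖x i‖₊
      exact ⟨i, by rw [← coe_nnnorm, ← coe_nnnorm, Pi.nnnorm_def, hi]⟩
    have hx0 : ‖x i‖ ≠ 0 := by rw [← hi]; exact norm_ne_zero_iff.mpr hx
    have hxi : x i ≠ 0 := norm_ne_zero_iff.mp hx0
    have hmem : (x i)⁻¹ • x ∈ Metric.sphere (0 : ι → 𝕜) 1 := by
      rw [mem_sphere_zero_iff_norm, norm_smul, norm_inv, hi, inv_mul_cancel₀ hx0]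
    calc ‖f m‖ * ‖x‖ ^ 2 ≤ ‖f ((x i)⁻¹ • x)‖ * ‖x‖ ^ 2 := by
          gcongr
          exact hmin hmem
      _ = ‖f x‖ := by
          rw [hsmul, norm_smul, norm_pow, norm_inv, hi]
          field_simp
  have hproper : IsProperMap f := by
    rw [isProperMap_iff_tendsto_cocompact]
    refine ⟨hf, ?_⟩
    rw [← Metric.cobounded_eq_cocompact, ← Metric.cobounded_eq_cocompact,
      ← tendsto_norm_atTop_iff_cobounded]
    refine Filter.tendsto_atTop_mono hbound ?_
    exact ((Filter.tendsto_pow_atTop two_ne_zero).comp tendsto_norm_cobounded_atTop).const_mul_atTop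
      hpos
  exact hproper.isClosedMap.isClosed_range

/-- The pair of values of two ternary rational quadratic forms at a `p`-adic vector. -/
noncomputable def padicFormPair (p : ℕ) [Fact p.Prime] (A B : Matrix (Fin 3) (Fin 3) ℚ)
    (x : Fin 3 → ℚ_[p]) : ℚ_[p] × ℚ_[p] :=
  (x ⬝ᵥ ((A.map (algebraMap ℚ ℚ_[p])) *ᵥ x), x ⬝ᵥ ((B.map (algebraMap ℚ ℚ_[p])) *ᵥ x))

theorem continuous_padicFormPair (p : ℕ) [Fact p.Prime] (A B : Matrix (Fin 3) (Fin 3) ℚ) :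
    Continuous (padicFormPair p A B) := by
  unfold padicFormPair
  fun_prop

theorem padicFormPair_smul (p : ℕ) [Fact p.Prime] (A B : Matrix (Fin 3) (Fin 3) ℚ)
    (c : ℚ_[p]) (x : Fin 3 → ℚ_[p]) :
    padicFormPair p A B (c • x) = c ^ 2 • padicFormPair p A B x := by
  simp only [padicFormPair, mulVec_smul, smul_dotProduct, dotProduct_smul, Prod.smul_mk, smul_smul,
    sq]

theorem padicFormPair_ratCast (p : ℕ) [Fact p.Prime] (A B : Matrix (Fin 3) (Fin 3) ℚ)
    (x : Fin 3 → ℚ) :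
    padicFormPair p A B (fun i => (x i : ℚ_[p])) =
      (((x ⬝ᵥ (A *ᵥ x) : ℚ) : ℚ_[p]), ((x ⬝ᵥ (B *ᵥ x) : ℚ) : ℚ_[p])) := by
  simp [padicFormPair, dotProduct, mulVec]

theorem denseRange_pi_ratCast (p : ℕ) [Fact p.Prime] (ι : Type*) :
    DenseRange (fun (x : ι → ℚ) (i : ι) => (x i : ℚ_[p])) := by
  have h : DenseRange (Rat.cast : ℚ → ℚ_[p]) := Padic.denseRange_ratCast p
  exact DenseRange.piMap fun _ => h

/-- If every pair of values that is taken at a rational vector by `(A₁, B₁)` is also taken by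
`(A₂, B₂)`, and `(A₂, B₂)` is anisotropic over `ℚ_[p]`, then the same inclusion holds for
`p`-adic vectors. -/
theorem range_padicFormPair_subset (p : ℕ) [Fact p.Prime]
    {A₁ B₁ A₂ B₂ : Matrix (Fin 3) (Fin 3) ℚ}
    (hrep : ∀ x : Fin 3 → ℚ, x ≠ 0 →
      ∃ y : Fin 3 → ℚ, y ⬝ᵥ (A₂ *ᵥ y) = x ⬝ᵥ (A₁ *ᵥ x) ∧ y ⬝ᵥ (B₂ *ᵥ y) = x ⬝ᵥ (B₁ *ᵥ x))
    (han : ∀ x, padicFormPair p A₂ B₂ x = 0 → x = 0) :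
    Set.range (padicFormPair p A₁ B₁) ⊆ Set.range (padicFormPair p A₂ B₂) := by
  have hclosed := isClosed_range_of_homogeneous_two (continuous_padicFormPair p A₂ B₂)
    (padicFormPair_smul p A₂ B₂) han
  rintro _ ⟨x, rfl⟩
  refine (denseRange_pi_ratCast p (Fin 3)).induction_on
    (p := fun x => padicFormPair p A₁ B₁ x ∈ Set.range (padicFormPair p A₂ B₂)) x
    (hclosed.preimage (continuous_padicFormPair p A₁ B₁)) fun x => ?_
  rcases eq_or_ne x 0 with rfl | hx
  · exact ⟨0, by simp [padicFormPair, ← Pi.zero_def]⟩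
  obtain ⟨y, hA, hB⟩ := hrep x hx
  exact ⟨fun i => y i, by rw [padicFormPair_ratCast, padicFormPair_ratCast, hA, hB]⟩

theorem stmt_17 (p : ℕ) [Fact p.Prime]
    (A₁ B₁ A₂ B₂ : Matrix (Fin 3) (Fin 3) ℚ)
    (hsA₁ : A₁.IsSymm) (hsB₁ : B₁.IsSymm) (hsA₂ : A₂.IsSymm) (hsB₂ : B₂.IsSymm)
    -- equal simultaneous rational representations
    (hrep : {q : ℚ × ℚ | ∃ x : Fin 3 → ℚ, x ≠ 0 ∧
          x ⬝ᵥ (A₁ *ᵥ x) = q.1 ∧ x ⬝ᵥ (B₁ *ᵥ x) = q.2}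
      = {q : ℚ × ℚ | ∃ x : Fin 3 → ℚ, x ≠ 0 ∧
          x ⬝ᵥ (A₂ *ᵥ x) = q.1 ∧ x ⬝ᵥ (B₂ *ᵥ x) = q.2})
    -- both pairs anisotropic over ℚ_p
    (han₁ : ∀ x : Fin 3 → ℚ_[p],
      x ⬝ᵥ ((A₁.map (algebraMap ℚ ℚ_[p])) *ᵥ x) = 0 →
      x ⬝ᵥ ((B₁.map (algebraMap ℚ ℚ_[p])) *ᵥ x) = 0 → x = 0)
    (han₂ : ∀ x : Fin 3 → ℚ_[p],
      x ⬝ᵥ ((A₂.map (algebraMap ℚ ℚ_[p])) *ᵥ x) = 0 →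
      x ⬝ᵥ ((B₂.map (algebraMap ℚ ℚ_[p])) *ᵥ x) = 0 → x = 0) :
    {q : ℚ_[p] × ℚ_[p] | ∃ x : Fin 3 → ℚ_[p], x ≠ 0 ∧
        x ⬝ᵥ ((A₁.map (algebraMap ℚ ℚ_[p])) *ᵥ x) = q.1 ∧
        x ⬝ᵥ ((B₁.map (algebraMap ℚ ℚ_[p])) *ᵥ x) = q.2}
    = {q : ℚ_[p] × ℚ_[p] | ∃ x : Fin 3 → ℚ_[p], x ≠ 0 ∧
        x ⬝ᵥ ((A₂.map (algebraMap ℚ ℚ_[p])) *ᵥ x) = q.1 ∧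
        x ⬝ᵥ ((B₂.map (algebraMap ℚ ℚ_[p])) *ᵥ x) = q.2} := by
  have hzero : ∀ A B : Matrix (Fin 3) (Fin 3) ℚ, padicFormPair p A B 0 = 0 := by
    intro A B
    simp [padicFormPair]
  have haniso₁ : ∀ x, padicFormPair p A₁ B₁ x = 0 → x = 0 := fun x hx =>
    han₁ x (congrArg Prod.fst hx) (congrArg Prod.snd hx)
  have haniso₂ : ∀ x, padicFormPair p A₂ B₂ x = 0 → x = 0 := fun x hx =>
    han₂ x (congrArg Prod.fst hx) (congrArg Prod.snd hx)
  have hsub₁₂ : Set.range (padicFormPair p A₁ B₁) ⊆ Set.range (padicFormPair p A₂ B₂) := by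
    refine range_padicFormPair_subset p (fun x hx => ?_) haniso₂
    obtain ⟨y, -, hy⟩ := (Set.ext_iff.mp hrep (x ⬝ᵥ (A₁ *ᵥ x), x ⬝ᵥ (B₁ *ᵥ x))).mp
      ⟨x, hx, rfl, rfl⟩
    exact ⟨y, hy⟩
  have hsub₂₁ : Set.range (padicFormPair p A₂ B₂) ⊆ Set.range (padicFormPair p A₁ B₁) := by
    refine range_padicFormPair_subset p (fun x hx => ?_) haniso₁
    obtain ⟨y, -, hy⟩ := (Set.ext_iff.mp hrep (x ⬝ᵥ (A₂ *ᵥ x), x ⬝ᵥ (B₂ *ᵥ x))).mpr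
      ⟨x, hx, rfl, rfl⟩
    exact ⟨y, hy⟩
  ext q
  constructor
  · rintro ⟨x, hx, hA, hB⟩
    obtain ⟨y, hy⟩ := hsub₁₂ ⟨x, rfl⟩
    refine ⟨y, ?_, (congrArg Prod.fst hy).trans hA, (congrArg Prod.snd hy).trans hB⟩
    rintro rfl
    exact hx (haniso₁ x (hy.symm.trans (hzero A₂ B₂)))
  · rintro ⟨x, hx, hA, hB⟩
    obtain ⟨y, hy⟩ := hsub₂₁ ⟨x, rfl⟩
    refine ⟨y, ?_, (congrArg Prod.fst hy).trans hA, (congrArg Prod.snd hy).trans hB⟩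
    rintro rfl
    exact hx (haniso₂ x (hy.symm.trans (hzero A₁ B₁)))
end
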